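/- Fix an integer d ≥ n and a natural number j. If j is not of the form s·(m−n)+1 for some s ∈ {1,…,n}, then Ext^j_S(S/I^d, S) = 0 (the Ext group is subsingleton). -/

import Mathlib

open MvPolynomial

section ExtGeneral

open CategoryTheory

universe w v u

theorem subsingleton_ext_of_split {C : Type u} [Category.{v} C] [Abelian C] [HasExt.{w} C]
    {T J Y : C} (P : ProjectiveResolution T) (α : T ⟶ J) (β : J ⟶ T) (hβ : β ≫ α = 𝟙 J)
    {k : T ⟶ T} (κ : ProjectiveResolution.Hom P P k) (hk : k ≫ α = 0) (p : ℕ)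
    (H : ∀ φ : P.complex.X (p + 1) ⟶ Y, P.complex.d (p + 2) (p + 1) ≫ φ = 0 →
      (∃ ψ : P.complex.X p ⟶ Y, P.complex.d (p + 1) p ≫ ψ = κ.hom.f (p + 1) ≫ φ) →
      ∃ u : P.complex.X p ⟶ Y, P.complex.d (p + 1) p ≫ u = φ) :
    Subsingleton (Abelian.Ext J Y (p + 1)) := by
  refine subsingleton_of_forall_eq 0 fun x => ?_
  obtain ⟨φ, hφ, hy⟩ := P.extMk_surjective ((Abelian.Ext.mk₀ α).comp x (zero_add _)) (p + 2) rfl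
  have h1 : (Abelian.Ext.mk₀ k).comp (P.extMk φ (p + 2) rfl hφ) (zero_add _) = 0 := by
    rw [hy, Abelian.Ext.mk₀_comp_mk₀_assoc, hk]
    simp
  rw [ProjectiveResolution.mk₀_comp_extMk φ (p + 2) rfl hφ κ,
    ProjectiveResolution.extMk_eq_zero_iff _ _ _ _ _ p rfl] at h1
  have h2 := (P.extMk_eq_zero_iff φ (p + 2) rfl hφ p rfl).2 (H φ hφ h1)
  rw [hy] at h2
  have h3 : (Abelian.Ext.mk₀ (β ≫ α)).comp x (zero_add _) = 0 := by
    rw [← Abelian.Ext.mk₀_comp_mk₀_assoc, h2]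
    simp
  simpa [hβ] using h3

theorem subsingleton_derived_ext_zero {R : Type u} [CommRing R] (X Y : ModuleCat.{u} R)
    (h : Subsingleton (X ⟶ Y)) :
    Subsingleton (((Ext R (ModuleCat.{u} R) 0).obj (Opposite.op X)).obj Y) := by
  let P := ProjectiveResolution.of X
  rw [← ModuleCat.isZero_iff_subsingleton]
  refine Limits.IsZero.of_iso ?_ (P.isoExt 0 Y)
  rw [← HomologicalComplex.exactAt_iff_isZero_homology,
    HomologicalComplex.exactAt_iff' _ 0 0 1 (by simp) (by simp),
    ShortComplex.moduleCat_exact_iff]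
  intro φ hφ
  refine ⟨0, ?_⟩
  have hφ' : P.complex.d 1 0 ≫ φ = 0 := hφ
  have h1 := P.isColimitCokernelCofork.fac (Limits.CokernelCofork.ofπ φ hφ')
    Limits.WalkingParallelPair.one
  have h2 : P.isColimitCokernelCofork.desc (Limits.CokernelCofork.ofπ φ hφ') = 0 :=
    Subsingleton.elim (α := X ⟶ Y) _ _
  rw [h2, Limits.comp_zero] at h1
  rw [map_zero]
  exact h1

theorem subsingleton_derived_ext_succ {R : Type u} [CommRing R] (X Y : ModuleCat.{u} R) (p : ℕ)
    (h : Subsingleton (Abelian.Ext.{u} X Y (p + 1))) :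
    Subsingleton (((Ext R (ModuleCat.{u} R) (p + 1)).obj (Opposite.op X)).obj Y) := by
  let P := ProjectiveResolution.of X
  rw [← ModuleCat.isZero_iff_subsingleton]
  refine Limits.IsZero.of_iso ?_ (P.isoExt (p + 1) Y)
  rw [← HomologicalComplex.exactAt_iff_isZero_homology,
    HomologicalComplex.exactAt_iff' _ p (p + 1) (p + 2) (by simp) (by simp),
    ShortComplex.moduleCat_exact_iff]
  intro φ hφ
  have hφ' : P.complex.d (p + 2) (p + 1) ≫ φ = 0 := hφ
  obtain ⟨g, hg⟩ := (P.extMk_eq_zero_iff φ (p + 2) rfl hφ' p rfl).1 (Subsingleton.elim _ _)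
  exact ⟨g, hg⟩

/-- The short exact sequence `0 → J → R → R/J → 0`. -/
noncomputable abbrev idealShortComplex {R : Type u} [CommRing R] (J : Ideal R) :
    ShortComplex (ModuleCat.{u} R) :=
  ShortComplex.mk (ModuleCat.ofHom J.subtype) (ModuleCat.ofHom (Submodule.mkQ J)) (by
    ext x; exact (Submodule.Quotient.mk_eq_zero J).2 x.2)

theorem idealShortComplex_shortExact {R : Type u} [CommRing R] (J : Ideal R) :
    (idealShortComplex J).ShortExact where
  exact := by
    rw [ShortComplex.moduleCat_exact_iff]
    intro x hx
    exact ⟨⟨x, (Submodule.Quotient.mk_eq_zero J).1 hx⟩, rfl⟩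
  mono_f := (ModuleCat.mono_iff_injective _).2 Subtype.val_injective
  epi_g := (ModuleCat.epi_iff_surjective _).2 (Submodule.mkQ_surjective J)

theorem subsingleton_ext_quotient {R : Type u} [CommRing R] (J : Ideal R) (p : ℕ)
    (h : Subsingleton (Abelian.Ext.{u} (ModuleCat.of R J) (ModuleCat.of R R) (p + 1))) :
    Subsingleton (Abelian.Ext.{u} (ModuleCat.of R (R ⧸ J)) (ModuleCat.of R R) (p + 2)) := by
  refine subsingleton_of_forall_eq 0 fun x => ?_
  obtain ⟨y, hy⟩ := Abelian.Ext.contravariant_sequence_exact₃ (idealShortComplex_shortExact J)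
    (ModuleCat.of R R) x (Abelian.Ext.eq_zero_of_projective _) (n₀ := p + 1) (by omega)
  rw [← hy, h.elim y 0, Abelian.Ext.comp_zero]

theorem subsingleton_ext_one_quotient {R : Type u} [CommRing R] (J : Ideal R)
    (h : ∀ f : J →ₗ[R] R, ∃ s : R, ∀ x : J, f x = x * s) :
    Subsingleton (Abelian.Ext.{u} (ModuleCat.of R (R ⧸ J)) (ModuleCat.of R R) 1) := by
  refine subsingleton_of_forall_eq 0 fun x => ?_
  obtain ⟨y, hy⟩ := Abelian.Ext.contravariant_sequence_exact₃ (idealShortComplex_shortExact J)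
    (ModuleCat.of R R) x (Abelian.Ext.eq_zero_of_projective _) (n₀ := 0) (by omega)
  obtain ⟨f, rfl⟩ := Abelian.Ext.homEquiv₀.symm.surjective y
  obtain ⟨s, hs⟩ := h f.hom
  have hf : f = (idealShortComplex J).f ≫ ModuleCat.ofHom (LinearMap.toSpanSingleton R R s) := by
    ext x
    exact hs x
  rw [← hy, hf]
  change (idealShortComplex_shortExact J).extClass.comp (Abelian.Ext.mk₀ _) _ = 0
  rw [← Abelian.Ext.mk₀_comp_mk₀]
  exact (idealShortComplex_shortExact J).extClass_comp_assoc _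

end ExtGeneral

section LinearResolution

open CategoryTheory

universe u

variable {R : Type u} [CommRing R] (P : ℕ → Type u) [∀ j, AddCommGroup (P j)]
  [∀ j, Module R (P j)] (δ : ∀ j, P (j + 1) →ₗ[R] P j)
  (hex : ∀ j, Function.Exact (δ (j + 1)) (δ j))

/-- The chain complex attached to an exact sequence of modules. -/
noncomputable def linearComplex : ChainComplex (ModuleCat.{u} R) ℕ :=
  ChainComplex.of (fun j => ModuleCat.of R (P j)) (fun j => ModuleCat.ofHom (δ j)) (by
    intro j
    ext x
    exact (hex j).apply_apply_eq_zero x)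

theorem linearComplex_d (j : ℕ) : (linearComplex P δ hex).d (j + 1) j = ModuleCat.ofHom (δ j) := by
  exact ChainComplex.of_d (fun j => ModuleCat.of R (P j)) (fun j => ModuleCat.ofHom (δ j)) j

/-- The augmentation of `linearComplex` to the cokernel of its last differential. -/
noncomputable def linearComplexAug : (linearComplex P δ hex) ⟶
    (ChainComplex.single₀ (ModuleCat.{u} R)).obj (ModuleCat.of R (P 0 ⧸ LinearMap.range (δ 0))) :=
  (ChainComplex.toSingle₀Equiv _ _).symm
    ⟨ModuleCat.ofHom (LinearMap.range (δ 0)).mkQ, by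
      rw [linearComplex_d]
      ext x
      exact (Submodule.Quotient.mk_eq_zero _).2 ⟨x, rfl⟩⟩

theorem linearComplexAug_f_zero :
    (linearComplexAug P δ hex).f 0 = ModuleCat.ofHom (LinearMap.range (δ 0)).mkQ := by
  exact ChainComplex.toSingle₀Equiv_symm_apply_f_zero _ _

theorem linearComplexAug_quasiIso : QuasiIso (linearComplexAug P δ hex) := ⟨fun n => by
  cases n with
  | zero =>
    rw [ChainComplex.quasiIsoAt₀_iff, ShortComplex.quasiIso_iff_of_zeros']
    · constructor
      · rw [ShortComplex.moduleCat_exact_iff]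
        intro x hx
        change (ModuleCat.Hom.hom ((linearComplexAug P δ hex).f 0)) x = 0 at hx
        rw [linearComplexAug_f_zero] at hx
        obtain ⟨y, hy⟩ := (Submodule.Quotient.mk_eq_zero _).1 hx
        refine ⟨y, ?_⟩
        change (ModuleCat.Hom.hom ((linearComplex P δ hex).d 1 0)) y = x
        rw [linearComplex_d]
        exact hy
      · change Epi ((linearComplexAug P δ hex).f 0)
        rw [linearComplexAug_f_zero]
        exact (ModuleCat.epi_iff_surjective _).2 (Submodule.mkQ_surjective _)
    all_goals rfl
  | succ n =>
    rw [quasiIsoAt_iff_exactAt']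
    · rw [HomologicalComplex.exactAt_iff' _ (n + 2) (n + 1) n (by simp) (by simp),
        ShortComplex.moduleCat_exact_iff]
      intro x hx
      change (ModuleCat.Hom.hom ((linearComplex P δ hex).d (n + 1) n)) x = 0 at hx
      rw [linearComplex_d] at hx
      obtain ⟨y, hy⟩ := (hex n x).1 hx
      refine ⟨y, ?_⟩
      change (ModuleCat.Hom.hom ((linearComplex P δ hex).d (n + 2) (n + 1))) y = x
      rw [linearComplex_d]
      exact hy
    · apply ChainComplex.exactAt_succ_single_obj⟩

/-- A projective resolution given by an exact sequence of projective modules. -/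
noncomputable def linearResolution [∀ j, Module.Projective R (P j)] :
    ProjectiveResolution (ModuleCat.of R (P 0 ⧸ LinearMap.range (δ 0))) where
  complex := linearComplex P δ hex
  projective j := (IsProjective.iff_projective (P j)).1 inferInstance
  π := linearComplexAug P δ hex
  quasiIso := linearComplexAug_quasiIso P δ hex

/-- The chain map induced by linear maps commuting with the differentials. -/
noncomputable def linearComplexMap (k : ∀ j, P j →ₗ[R] P j)
    (hk : ∀ j, k j ∘ₗ δ j = δ j ∘ₗ k (j + 1)) :
    linearComplex P δ hex ⟶ linearComplex P δ hex where
  f j := ModuleCat.ofHom (k j)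
  comm' i j hij := by
    obtain rfl : j + 1 = i := hij
    rw [linearComplex_d]
    ext x
    exact (LinearMap.congr_fun (hk j) x).symm

theorem subsingleton_ext_of_linear_resolution (hex : ∀ j, Function.Exact (δ (j + 1)) (δ j))
    [∀ j, Module.Projective R (P j)]
    {J Y : Type u} [AddCommGroup J] [Module R J] [AddCommGroup Y] [Module R Y]
    (α : P 0 ⧸ LinearMap.range (δ 0) →ₗ[R] J) (β : J →ₗ[R] P 0 ⧸ LinearMap.range (δ 0))
    (hβ : ∀ x, α (β x) = x) (k : ∀ j, P j →ₗ[R] P j)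
    (hk : ∀ j, k j ∘ₗ δ j = δ j ∘ₗ k (j + 1))
    (hkα : ∀ x, α (Submodule.Quotient.mk (k 0 x)) = 0) (p : ℕ)
    (H : ∀ φ : P (p + 1) →ₗ[R] Y, φ ∘ₗ δ (p + 1) = 0 →
      (∃ ψ : P p →ₗ[R] Y, ψ ∘ₗ δ p = φ ∘ₗ k (p + 1)) → ∃ u : P p →ₗ[R] Y, u ∘ₗ δ p = φ) :
    Subsingleton (Abelian.Ext.{u} (ModuleCat.of R J) (ModuleCat.of R Y) (p + 1)) := by
  let kb : P 0 ⧸ LinearMap.range (δ 0) →ₗ[R] P 0 ⧸ LinearMap.range (δ 0) :=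
    Submodule.mapQ _ _ (k 0) (by
      rintro _ ⟨y, rfl⟩
      exact ⟨k 1 y, (LinearMap.congr_fun (hk 0) y).symm⟩)
  refine subsingleton_ext_of_split (linearResolution P δ hex) (ModuleCat.ofHom α)
    (ModuleCat.ofHom β) (by ext x; exact hβ x) (k := ModuleCat.ofHom kb)
    ⟨linearComplexMap P δ hex k hk, ?_⟩ ?_ p ?_
  · change ModuleCat.ofHom (k 0) ≫ (linearComplexAug P δ hex).f 0 =
      (linearComplexAug P δ hex).f 0 ≫ _
    rw [linearComplexAug_f_zero]
    ext x
    rfl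
  · ext x

    exact hkα x
  · intro φ hφ hψ
    have hd := fun j => linearComplex_d P δ hex j
    change (linearComplex P δ hex).d (p + 2) (p + 1) ≫ φ = 0 at hφ
    rw [hd (p + 1)] at hφ
    obtain ⟨ψ, hψ⟩ := hψ
    change (linearComplex P δ hex).d (p + 1) p ≫ ψ = ModuleCat.ofHom (k (p + 1)) ≫ φ at hψ
    rw [hd p] at hψ
    obtain ⟨u, hu⟩ := H φ.hom (congrArg ModuleCat.Hom.hom hφ)
      ⟨ψ.hom, congrArg ModuleCat.Hom.hom hψ⟩
    refine ⟨ModuleCat.ofHom u, ?_⟩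
    change (linearComplex P δ hex).d (p + 1) p ≫ _ = φ
    rw [hd p]
    ext x
    exact LinearMap.congr_fun hu x

end LinearResolution

section Fock

set_option linter.unusedSectionVars false

variable {ι : Type*} [Fintype ι] [DecidableEq ι]

/-- The sign of moving a generator to its position in an exterior monomial. -/
noncomputable def ksign (a : ι) (s : Finset ι) : ℤ :=
  (-1) ^ (s.filter fun b => Fintype.equivFin ι b < Fintype.equivFin ι a).card

theorem ksign_insert_self (a : ι) (s : Finset ι) : ksign a (insert a s) = ksign a s := by
  simp [ksign, Finset.filter_insert]

theorem ksign_erase_self (a : ι) (s : Finset ι) : ksign a (s.erase a) = ksign a s := by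
  simp [ksign, Finset.filter_erase]

theorem ksign_mul_self (a : ι) (s : Finset ι) : ksign a s * ksign a s = 1 := by
  simp [ksign, ← mul_pow]

theorem ksign_insert {a b : ι} {s : Finset ι} (hb : b ∉ s) :
    ksign a (insert b s) =
      (if Fintype.equivFin ι b < Fintype.equivFin ι a then -1 else 1) * ksign a s := by
  unfold ksign
  rw [Finset.filter_insert]
  split_ifs with h
  · rw [Finset.card_insert_of_notMem (by simp [hb]), pow_succ]; ring
  · ring

theorem ksign_comm {a b : ι} {s : Finset ι} (hab : a ≠ b) (ha : a ∉ s) (hb : b ∉ s) :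
    ksign a s * ksign b (insert a s) = - (ksign b s * ksign a (insert b s)) := by
  rw [ksign_insert ha, ksign_insert hb]
  have : Fintype.equivFin ι a ≠ Fintype.equivFin ι b := by simpa using hab
  rcases lt_or_gt_of_ne this with h | h
  · simp [h, not_lt.2 h.le]; ring
  · simp [h, not_lt.2 h.le]; ring

variable (R : Type*) [CommRing R] {G : Type*} [AddCommGroup G] [Module R G]

/-- Exterior multiplication by a generator. -/
noncomputable def cr (a : ι) : Module.End R (Finset ι → G) where
  toFun f s := if a ∈ s then ksign a s • f (s.erase a) else 0
  map_add' f g := by ext s; by_cases h : a ∈ s <;> simp [h]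
  map_smul' c f := by ext s; by_cases h : a ∈ s <;> simp [h, smul_comm c]

/-- Contraction with a generator. -/
noncomputable def an (a : ι) : Module.End R (Finset ι → G) where
  toFun f s := if a ∈ s then 0 else ksign a s • f (insert a s)
  map_add' f g := by ext s; by_cases h : a ∈ s <;> simp [h]
  map_smul' c f := by ext s; by_cases h : a ∈ s <;> simp [h, smul_comm c]

/-- A linear map applied to every coefficient of an exterior form. -/
noncomputable def lift0 : Module.End R G →+* Module.End R (Finset ι → G) where
  toFun T := T.compLeft (Finset ι)
  map_one' := by ext; rfl
  map_mul' _ _ := by ext; rfl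
  map_zero' := by ext; rfl
  map_add' _ _ := by ext; rfl

theorem cr_apply (a : ι) (f : Finset ι → G) (s : Finset ι) :
    cr R a f s = if a ∈ s then ksign a s • f (s.erase a) else 0 := rfl

theorem an_apply (a : ι) (f : Finset ι → G) (s : Finset ι) :
    an R a f s = if a ∈ s then 0 else ksign a s • f (insert a s) := rfl

theorem lift0_apply (T : Module.End R G) (f : Finset ι → G) (s : Finset ι) :
    lift0 R T f s = T (f s) := rfl

theorem lift0_mul_cr (T : Module.End R G) (a : ι) :
    lift0 R T * cr (ι := ι) R a = cr R a * lift0 R T := by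
  refine LinearMap.ext fun f => funext fun s => ?_
  simp only [Module.End.mul_apply, lift0_apply, cr_apply]
  split_ifs <;> simp

theorem lift0_mul_an (T : Module.End R G) (a : ι) :
    lift0 R T * an (ι := ι) R a = an R a * lift0 R T := by
  refine LinearMap.ext fun f => funext fun s => ?_
  simp only [Module.End.mul_apply, lift0_apply, an_apply]
  split_ifs <;> simp

theorem cr_mul_an_self_apply (a : ι) (f : Finset ι → G) (s : Finset ι) :
    (cr R a * an R a : Module.End R (Finset ι → G)) f s = if a ∈ s then f s else 0 := by
  simp only [Module.End.mul_apply, cr_apply, an_apply]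
  by_cases h : a ∈ s
  · simp [h, ksign_erase_self, smul_smul, ksign_mul_self, Finset.insert_erase h]
  · simp [h]

theorem an_mul_cr_self_apply (a : ι) (f : Finset ι → G) (s : Finset ι) :
    (an R a * cr R a : Module.End R (Finset ι → G)) f s = if a ∈ s then 0 else f s := by
  simp only [Module.End.mul_apply, cr_apply, an_apply]
  by_cases h : a ∈ s
  · simp [h]
  · simp [h, ksign_insert_self, smul_smul, ksign_mul_self, Finset.erase_insert h]

theorem cr_anticomm (a b : ι) :
    cr R (G := G) a * cr R b + cr R b * cr R a = 0 := by
  refine LinearMap.ext fun f => funext fun s => ?_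
  simp only [LinearMap.add_apply, Module.End.mul_apply, cr_apply, Pi.add_apply,
    LinearMap.zero_apply, Pi.zero_apply, Finset.mem_erase]
  rcases eq_or_ne a b with rfl | hab
  · simp
  by_cases ha : a ∈ s
  · by_cases hb : b ∈ s
    · obtain ⟨t, hat, hbt, rfl⟩ : ∃ t, a ∉ t ∧ b ∉ t ∧ s = insert a (insert b t) :=
        ⟨(s.erase a).erase b, by simp, by simp, by
          rw [Finset.insert_erase (by simp [hb, hab.symm]), Finset.insert_erase ha]⟩
      have e1 : (insert a (insert b t)).erase a = insert b t :=
        Finset.erase_insert (by simp [hab, hat])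
      have e2 : (insert a (insert b t)).erase b = insert a t := by
        rw [Finset.insert_comm]; exact Finset.erase_insert (by simp [hab.symm, hbt])
      have e3 : ksign b (insert a (insert b t)) = ksign b (insert a t) := by
        rw [Finset.insert_comm, ksign_insert_self]
      simp only [ha, hb, hab, hab.symm, e1, e2, e3, ksign_insert_self, ne_eq, not_false_eq_true,
        true_and, if_true, smul_smul, Finset.erase_insert hat, Finset.erase_insert hbt,
        ← add_smul]
      rw [show ksign a (insert b t) * ksign b t + ksign b (insert a t) * ksign a t = 0 by
        have := ksign_comm hab hat hbt
        linarith, zero_smul]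
    · simp [hb]
  · simp [ha]

theorem an_anticomm (a b : ι) :
    an R (G := G) a * an R b + an R b * an R a = 0 := by
  refine LinearMap.ext fun f => funext fun s => ?_
  simp only [LinearMap.add_apply, Module.End.mul_apply, an_apply, Pi.add_apply,
    LinearMap.zero_apply, Pi.zero_apply, Finset.mem_insert]
  rcases eq_or_ne a b with rfl | hab
  · simp
  by_cases ha : a ∈ s
  · simp [ha]
  by_cases hb : b ∈ s
  · simp [hb]
  simp only [ha, hb, hab, hab.symm, if_false, or_self, smul_smul, Finset.insert_comm b a,
    ← add_smul]
  rw [show ksign a s * ksign b (insert a s) + ksign b s * ksign a (insert b s) = 0 by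
    rw [ksign_comm hab ha hb]; ring, zero_smul]

theorem cr_an_anticomm (a b : ι) :
    cr R (G := G) a * an R b + an R b * cr R a = if a = b then 1 else 0 := by
  rcases eq_or_ne a b with rfl | hab
  · refine LinearMap.ext fun f => funext fun s => ?_
    rw [if_pos rfl, LinearMap.add_apply, Pi.add_apply, cr_mul_an_self_apply, an_mul_cr_self_apply]
    split_ifs <;> simp
  rw [if_neg hab]
  refine LinearMap.ext fun f => funext fun s => ?_
  simp only [LinearMap.add_apply, Module.End.mul_apply, cr_apply, an_apply, Pi.add_apply,
    LinearMap.zero_apply, Pi.zero_apply, Finset.mem_insert, Finset.mem_erase]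
  by_cases hb : b ∈ s
  · simp [hb, hab.symm]
  by_cases ha : a ∈ s
  · obtain ⟨t, hat, rfl⟩ : ∃ t, a ∉ t ∧ s = insert a t :=
      ⟨s.erase a, by simp, by rw [Finset.insert_erase ha]⟩
    have hbt : b ∉ t := fun h => hb (by simp [h])
    have e : (insert b (insert a t)).erase a = insert b t := by
      rw [Finset.insert_comm]; exact Finset.erase_insert (by simp [hab, hat])
    have e3 : ksign a (insert b (insert a t)) = ksign a (insert b t) := by
      rw [Finset.insert_comm, ksign_insert_self]
    simp only [ha, hb, and_false, if_true, if_false, or_true, ksign_insert_self, smul_smul,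
      Finset.erase_insert hat, e, e3, ← add_smul]
    rw [show ksign a t * ksign b t + ksign b (insert a t) * ksign a (insert b t) = 0 by
      rw [ksign_insert hat, ksign_insert hbt]
      have : Fintype.equivFin ι a ≠ Fintype.equivFin ι b := by simpa using hab
      rcases lt_or_gt_of_ne this with h | h
      · simp [h, not_lt.2 h.le]; ring
      · simp [h, not_lt.2 h.le]; ring, zero_smul]
  · simp [ha, hab]

end Fock

section GlRelations

set_option linter.unusedSectionVars false

variable {𝓔 : Type*} [Ring 𝓔]

/-- The commutator in a ring. -/
def cm (a b : 𝓔) : 𝓔 := a * b - b * a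

theorem cm_skew (a b : 𝓔) : -cm b a = cm a b := by simp [cm]

theorem cm_add (a b c : 𝓔) : cm a (b + c) = cm a b + cm a c := by
  simp only [cm]; noncomm_ring

theorem add_cm (a b c : 𝓔) : cm (a + b) c = cm a c + cm b c := by
  simp only [cm]; noncomm_ring

theorem cm_neg (a b : 𝓔) : cm a (-b) = -cm a b := by
  simp only [cm]; noncomm_ring

theorem neg_cm (a b : 𝓔) : cm (-a) b = -cm a b := by
  simp only [cm]; noncomm_ring

theorem cm_sum {κ : Type*} (s : Finset κ) (a : 𝓔) (f : κ → 𝓔) :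
    cm a (∑ i ∈ s, f i) = ∑ i ∈ s, cm a (f i) := by
  simp [cm, Finset.mul_sum, Finset.sum_mul]

theorem sum_cm {κ : Type*} (s : Finset κ) (a : 𝓔) (f : κ → 𝓔) :
    cm (∑ i ∈ s, f i) a = ∑ i ∈ s, cm (f i) a := by
  simp [cm, Finset.mul_sum, Finset.sum_mul]

theorem cm_eq_zero_iff {a b : 𝓔} : cm a b = 0 ↔ a * b = b * a := sub_eq_zero

theorem cm_mul (a b c : 𝓔) : cm (a) (b * c) = cm (a) (b) * c + b * cm (a) (c) := by
  simp only [cm]; noncomm_ring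

theorem mul_cm (a b c : 𝓔) : cm (a * b) (c) = a * cm (b) (c) + cm (a) (c) * b := by
  simp only [cm]; noncomm_ring

/-- The commutation relations of matrix units. -/
def IsGl {σ : Type*} [DecidableEq σ] (u : σ → σ → 𝓔) : Prop :=
  ∀ p q p' q', cm (u p q) (u p' q') = (if q = p' then u p q' else 0) - if q' = p then u p' q else 0

theorem isGl_boson {σ : Type*} [DecidableEq σ] (z D : σ → 𝓔)
    (hzz : ∀ p q, cm (z p) (z q) = 0) (hDD : ∀ p q, cm (D p) (D q) = 0)
    (hDz : ∀ p q, cm (D p) (z q) = if p = q then 1 else 0) : IsGl fun p q => z p * D q := by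
  intro p q p' q'
  have hzD : ∀ p q, cm (z p) (D q) = - if q = p then 1 else 0 := fun p q => by
    rw [← cm_skew, hDz]
  rw [cm_mul, mul_cm, mul_cm, hzz, hDz, hDD, hzD]
  split_ifs <;> simp [sub_eq_add_neg]

theorem fermion_cm_cr {σ : Type*} [DecidableEq σ] {ε ι : σ → 𝓔}
    (hεε : ∀ p q, ε p * ε q + ε q * ε p = 0)
    (hει : ∀ p q, ε p * ι q + ι q * ε p = if p = q then 1 else 0) (p q c : σ) :
    cm (ε p * ι q) (ε c) = if q = c then ε p else 0 := by
  have h : cm (ε p * ι q) (ε c) =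
      ε p * (ε c * ι q + ι q * ε c) - (ε p * ε c + ε c * ε p) * ι q := by
    simp only [cm]; noncomm_ring
  rw [h, hει, hεε]
  simp [eq_comm]

theorem fermion_cm_an {σ : Type*} [DecidableEq σ] {ε ι : σ → 𝓔}
    (hιι : ∀ p q, ι p * ι q + ι q * ι p = 0)
    (hει : ∀ p q, ε p * ι q + ι q * ε p = if p = q then 1 else 0) (p q c : σ) :
    cm (ε p * ι q) (ι c) = - if p = c then ι q else 0 := by
  have h : cm (ε p * ι q) (ι c) =
      ε p * (ι q * ι c + ι c * ι q) - (ε p * ι c + ι c * ε p) * ι q := by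
    simp only [cm]; noncomm_ring
  rw [h, hει, hιι]
  simp

theorem isGl_fermion {σ : Type*} [DecidableEq σ] (ε ι : σ → 𝓔)
    (hεε : ∀ p q, ε p * ε q + ε q * ε p = 0) (hιι : ∀ p q, ι p * ι q + ι q * ι p = 0)
    (hει : ∀ p q, ε p * ι q + ι q * ε p = if p = q then 1 else 0) :
    IsGl fun p q => ε p * ι q := by
  intro p q p' q'
  rw [cm_mul, fermion_cm_cr hεε hει, fermion_cm_an hιι hει]
  simp only [eq_comm (a := q')]
  split_ifs <;> simp [sub_eq_add_neg]

variable {I C : Type*} [DecidableEq I] [DecidableEq C] [Fintype I] [Fintype C]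

theorem IsGl.sum_left {u : I × C → I × C → 𝓔} (hu : IsGl u) :
    IsGl fun c c' => ∑ i, u (i, c) (i, c') := by
  intro p q p' q'
  simp only [sum_cm, cm_sum, hu _ _ _ _, Prod.mk.injEq, Finset.sum_sub_distrib]
  congr 1
  · rw [Finset.sum_comm]
    split_ifs with h <;> simp [h]
  · split_ifs with h <;> simp [h]

theorem IsGl.sum_right {u : I × C → I × C → 𝓔} (hu : IsGl u) :
    IsGl fun i i' => ∑ c, u (i, c) (i', c) := by
  intro p q p' q'
  simp only [sum_cm, cm_sum, hu _ _ _ _, Prod.mk.injEq, Finset.sum_sub_distrib]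
  congr 1
  · split_ifs with h <;> simp [h]
  · split_ifs with h <;> simp [h]

theorem IsGl.cm_sum_sum {u : I × C → I × C → 𝓔} (hu : IsGl u) (c c' : C) (i i' : I) :
    cm (∑ j, u (j, c) (j, c')) (∑ b, u (i, b) (i', b)) = 0 := by
  simp only [sum_cm, cm_sum, hu _ _ _ _, Prod.mk.injEq, Finset.sum_sub_distrib, ite_and]
  simp

theorem IsGl.neg_transpose {u : I → I → 𝓔} (hu : IsGl u) : IsGl fun p q => - u q p := by
  intro p q p' q'
  rw [neg_cm, cm_neg, neg_neg, hu]
  simp only [eq_comm (a := p), eq_comm (a := q)]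
  split_ifs <;> simp <;> abel

theorem IsGl.add {u v : I → I → 𝓔} (hu : IsGl u) (hv : IsGl v)
    (huv : ∀ p q p' q', cm (u p q) (v p' q') = 0) : IsGl fun p q => u p q + v p q := by
  intro p q p' q'
  rw [add_cm, cm_add, cm_add, hu, hv, huv, ← cm_skew, huv]
  split_ifs <;> simp <;> abel

end GlRelations

theorem IsGl.casimir {𝓔 : Type*} [Ring 𝓔] {σ : Type*} [Fintype σ] [LinearOrder σ]
    {u : σ → σ → 𝓔} (hu : IsGl u) :
    ∑ p, ∑ q, u p q * u q p = ∑ p, u p p * u p p +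
      ∑ p, ∑ q, if p < q then 2 * (u q p * u p q) + (u p p - u q q) else 0 := by
  have h : ∀ p q, u p q * u q p = (if p = q then u p p * u p p else 0) +
      ((if p < q then u q p * u p q + (u p p - u q q) else 0) +
        if q < p then u p q * u q p else 0) := by
    intro p q
    rcases lt_trichotomy p q with h | rfl | h
    · have := hu p q q p
      simp only [cm, if_true] at this
      rw [if_neg h.ne, if_pos h, if_neg (not_lt.2 h.le), ← this]
      abel
    · simp
    · rw [if_neg h.ne', if_pos h, if_neg (not_lt.2 h.le)]
      abel
  have h1 : ∑ p, ∑ q, u p q * u q p = ∑ p, ∑ q, ((if p = q then u p p * u p p else 0) +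
      ((if p < q then u q p * u p q + (u p p - u q q) else 0) +
        if q < p then u p q * u q p else 0)) :=
    Finset.sum_congr rfl fun p _ => Finset.sum_congr rfl fun q _ => h p q
  have h2 : ∑ p, ∑ q, (if q < p then u p q * u q p else 0) =
      ∑ p, ∑ q, (if p < q then u q p * u p q else 0) := Finset.sum_comm
  rw [h1]
  simp only [Finset.sum_add_distrib, h2, Finset.sum_ite_eq, Finset.mem_univ, if_true]
  rw [← Finset.sum_add_distrib]
  congr 1
  refine Finset.sum_congr rfl fun p _ => ?_
  rw [← Finset.sum_add_distrib]
  refine Finset.sum_congr rfl fun q _ => ?_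
  split_ifs
  · rw [two_mul]; abel
  · simp

section Laplacian

set_option linter.unusedSectionVars false

variable {𝓔 : Type*} [Ring 𝓔] {κ μ : Type*} [Fintype κ] [DecidableEq κ] [Fintype μ]
  [DecidableEq μ]

/-- Data of a Kostant-type Laplacian: matrix units and a commuting Clifford system. -/
structure KData (E : κ ⊕ μ → κ ⊕ μ → 𝓔) (ε ι : κ × μ → 𝓔) : Prop where
  gl : IsGl E
  crcr : ∀ p q, ε p * ε q + ε q * ε p = 0
  anan : ∀ p q, ι p * ι q + ι q * ι p = 0
  cran : ∀ p q, ε p * ι q + ι q * ε p = if p = q then 1 else 0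
  cmcr : ∀ c c' p, E c c' * ε p = ε p * E c c'
  cman : ∀ c c' p, E c c' * ι p = ι p * E c c'

/-- The fermionic action on rows. -/
def ferK (ε ι : κ × μ → 𝓔) (k k' : κ) : 𝓔 := ∑ l, ε (k, l) * ι (k', l)

/-- The fermionic action on columns. -/
def ferL (ε ι : κ × μ → 𝓔) (l l' : μ) : 𝓔 := ∑ k, ε (k, l) * ι (k, l')

/-- The total action of the first block. -/
def hatK (E : κ ⊕ μ → κ ⊕ μ → 𝓔) (ε ι : κ × μ → 𝓔) (k k' : κ) : 𝓔 :=
  E (.inl k) (.inl k') + -ferK ε ι k' k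

/-- The total action of the second block. -/
def hatL (E : κ ⊕ μ → κ ⊕ μ → 𝓔) (ε ι : κ × μ → 𝓔) (l l' : μ) : 𝓔 :=
  E (.inr l) (.inr l') + ferL ε ι l l'

/-- The differential. -/
def dd (E : κ ⊕ μ → κ ⊕ μ → 𝓔) (ε : κ × μ → 𝓔) : 𝓔 :=
  ∑ p : κ × μ, E (.inl p.1) (.inr p.2) * ε p

/-- The formal adjoint of the differential. -/
def dstar (E : κ ⊕ μ → κ ⊕ μ → 𝓔) (ι : κ × μ → 𝓔) : 𝓔 :=
  ∑ p : κ × μ, E (.inr p.2) (.inl p.1) * ι p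

variable {E : κ ⊕ μ → κ ⊕ μ → 𝓔} {ε ι : κ × μ → 𝓔}

theorem isGl_ferK (h : KData E ε ι) : IsGl (ferK ε ι) :=
  (isGl_fermion ε ι h.crcr h.anan h.cran).sum_right

theorem isGl_ferL (h : KData E ε ι) : IsGl (ferL ε ι) :=
  (isGl_fermion ε ι h.crcr h.anan h.cran).sum_left

theorem cm_ferL_ferK (h : KData E ε ι) (l l' k k') : cm (ferL ε ι l l') (ferK ε ι k k') = 0 :=
  (isGl_fermion ε ι h.crcr h.anan h.cran).cm_sum_sum l l' k k'

theorem KData.cm_cr (h : KData E ε ι) (c c' p) : cm (E c c') (ε p) = 0 :=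
  cm_eq_zero_iff.2 (h.cmcr c c' p)

theorem KData.cm_an (h : KData E ε ι) (c c' p) : cm (E c c') (ι p) = 0 :=
  cm_eq_zero_iff.2 (h.cman c c' p)

theorem cm_ferK (h : KData E ε ι) (c c' k k') : cm (E c c') (ferK ε ι k k') = 0 := by
  simp [ferK, cm_sum, cm_mul, h.cm_cr, h.cm_an]

theorem cm_ferL (h : KData E ε ι) (c c' l l') : cm (E c c') (ferL ε ι l l') = 0 := by
  simp [ferL, cm_sum, cm_mul, h.cm_cr, h.cm_an]

theorem cm_ferK_cr (h : KData E ε ι) (k k' p) :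
    cm (ferK ε ι k k') (ε p) = if k' = p.1 then ε (k, p.2) else 0 := by
  obtain ⟨a, b⟩ := p
  simp only [ferK, sum_cm, fermion_cm_cr h.crcr h.cran, Prod.mk.injEq, ite_and]
  simp

theorem cm_ferL_cr (h : KData E ε ι) (l l' p) :
    cm (ferL ε ι l l') (ε p) = if l' = p.2 then ε (p.1, l) else 0 := by
  obtain ⟨a, b⟩ := p
  simp only [ferL, sum_cm, fermion_cm_cr h.crcr h.cran, Prod.mk.injEq, ite_and]
  simp

theorem cm_ferK_an (h : KData E ε ι) (k k' p) :
    cm (ferK ε ι k k') (ι p) = -if k = p.1 then ι (k', p.2) else 0 := by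
  obtain ⟨a, b⟩ := p
  simp only [ferK, sum_cm, fermion_cm_an h.anan h.cran, Prod.mk.injEq, ite_and]
  simp

theorem isGl_hatK (h : KData E ε ι) : IsGl (hatK E ε ι) := by
  refine IsGl.add (u := fun k k' => E (.inl k) (.inl k')) (fun p q p' q' => ?_)
    (isGl_ferK h).neg_transpose (fun p q p' q' => ?_)
  · simp [h.gl _ _ _ _]
  · rw [cm_neg, cm_ferK h, neg_zero]

theorem isGl_hatL (h : KData E ε ι) : IsGl (hatL E ε ι) := by
  refine IsGl.add (u := fun k k' => E (.inr k) (.inr k')) (fun p q p' q' => ?_)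
    (isGl_ferL h) (fun p q p' q' => ?_)
  · simp [h.gl _ _ _ _]
  · rw [cm_ferL h]

theorem cm_hatK_hatL (h : KData E ε ι) (k k' l l') :
    cm (hatK E ε ι k k') (hatL E ε ι l l') = 0 := by
  have h1 : cm (ferK ε ι k' k) (E (.inr l) (.inr l')) = 0 := by
    rw [← cm_skew, cm_ferK h, neg_zero]
  have h2 : cm (ferK ε ι k' k) (ferL ε ι l l') = 0 := by
    rw [← cm_skew, cm_ferL_ferK h, neg_zero]
  simp [hatK, hatL, add_cm, cm_add, cm_ferL h, neg_cm, h1, h2, h.gl _ _ _ _]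

theorem cm_hatK_dd (h : KData E ε ι) (k k') : cm (hatK E ε ι k k') (dd E ε) = 0 := by
  simp only [hatK, dd, cm_sum, add_cm, cm_mul, h.cm_cr, neg_cm, cm_ferK_cr h, h.gl _ _ _ _,
    ← cm_skew (ferK _ _ _ _), cm_ferK h, Fintype.sum_prod_type, Finset.sum_add_distrib]
  simp

theorem cm_hatL_dd (h : KData E ε ι) (k k') : cm (hatL E ε ι k k') (dd E ε) = 0 := by
  simp only [hatL, dd, cm_sum, add_cm, cm_mul, h.cm_cr, cm_ferL_cr h, h.gl _ _ _ _,
    ← cm_skew (ferL _ _ _ _), cm_ferL h, Fintype.sum_prod_type, Finset.sum_add_distrib]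
  simp

theorem cm_hatK_dstar (h : KData E ε ι) (k k') : cm (hatK E ε ι k k') (dstar E ι) = 0 := by
  simp only [hatK, dstar, cm_sum, add_cm, cm_mul, h.cm_an, neg_cm, cm_ferK_an h, h.gl _ _ _ _,
    ← cm_skew (ferK _ _ _ _), cm_ferK h, Fintype.sum_prod_type, Finset.sum_add_distrib]
  simp

theorem dd_mul_dd_add (h : KData E ε ι) : dd E ε * dd E ε + dd E ε * dd E ε = 0 := by
  have h1 : dd E ε * dd E ε = ∑ p : κ × μ, ∑ q : κ × μ,
      E (.inl p.1) (.inr p.2) * E (.inl q.1) (.inr q.2) * (ε p * ε q) := by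
    simp only [dd, Finset.sum_mul_sum]
    refine Finset.sum_congr rfl fun p _ => Finset.sum_congr rfl fun q _ => ?_
    simp only [mul_assoc]
    rw [← mul_assoc (ε p), ← h.cmcr, mul_assoc]
  have h3 : dd E ε * dd E ε = ∑ p : κ × μ, ∑ q : κ × μ,
      E (.inl q.1) (.inr q.2) * E (.inl p.1) (.inr p.2) * (ε q * ε p) := by
    rw [h1, Finset.sum_comm]
  nth_rewrite 2 [h3]
  rw [h1, ← Finset.sum_add_distrib]
  refine Finset.sum_eq_zero fun p _ => ?_
  rw [← Finset.sum_add_distrib]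
  refine Finset.sum_eq_zero fun q _ => ?_
  have h2 : cm (E (.inl p.1) (.inr p.2)) (E (.inl q.1) (.inr q.2)) = 0 := by simp [h.gl _ _ _ _]
  rw [cm_eq_zero_iff] at h2
  rw [h2, ← mul_add, h.crcr, mul_zero]

theorem dd_dstar (h : KData E ε ι) : dd E ε * dstar E ι + dstar E ι * dd E ε =
    ∑ k, ∑ l, E (.inr l) (.inl k) * E (.inl k) (.inr l) +
      ∑ k, ∑ k', E (.inl k) (.inl k') * ferK ε ι k k' -
      ∑ l, ∑ l', E (.inr l') (.inr l) * ferL ε ι l l' := by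
  have h1 : dd E ε * dstar E ι + dstar E ι * dd E ε = ∑ p : κ × μ, ∑ q : κ × μ,
      (E (.inr q.2) (.inl q.1) * E (.inl p.1) (.inr p.2) * (if p = q then 1 else 0) +
        cm (E (.inl p.1) (.inr p.2)) (E (.inr q.2) (.inl q.1)) * (ε p * ι q)) := by
    simp only [dd, dstar, Finset.sum_mul_sum]
    rw [Finset.sum_comm (f := fun i j => E (.inr i.2) (.inl i.1) * ι i * (E _ _ * ε j)),
      ← Finset.sum_add_distrib]
    refine Finset.sum_congr rfl fun p _ => ?_
    rw [← Finset.sum_add_distrib]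
    refine Finset.sum_congr rfl fun q _ => ?_
    rw [← h.cran, cm]
    have e1 : E (.inl p.1) (.inr p.2) * ε p * (E (.inr q.2) (.inl q.1) * ι q) =
        E (.inl p.1) (.inr p.2) * E (.inr q.2) (.inl q.1) * (ε p * ι q) := by
      simp only [mul_assoc]
      rw [← mul_assoc (ε p), ← h.cmcr, mul_assoc]
    have e2 : E (.inr q.2) (.inl q.1) * ι q * (E (.inl p.1) (.inr p.2) * ε p) =
        E (.inr q.2) (.inl q.1) * E (.inl p.1) (.inr p.2) * (ι q * ε p) := by
      simp only [mul_assoc]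
      rw [← mul_assoc (ι q), ← h.cman, mul_assoc]
    rw [e1, e2]
    noncomm_ring
  rw [h1]
  simp only [h.gl _ _ _ _, Finset.sum_add_distrib, add_sub_assoc, sub_mul, Finset.sum_sub_distrib,
    ferK, ferL, Finset.mul_sum]
  congr 1
  · simp [Fintype.sum_prod_type]
  congr 1
  · simp only [Fintype.sum_prod_type, Sum.inr.injEq, ite_mul, zero_mul, Finset.sum_ite_eq,
      Finset.mem_univ, if_true]
    refine Finset.sum_congr rfl fun k _ => ?_
    rw [Finset.sum_comm]
  · simp only [Fintype.sum_prod_type, Sum.inl.injEq, ite_mul, zero_mul]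
    rw [Finset.sum_comm]
    refine Finset.sum_congr rfl fun l _ => ?_
    have : ∀ k : κ, ∑ k', ∑ l', (if k' = k then
        E (.inr l') (.inr l) * (ε (k, l) * ι (k', l')) else 0) =
        ∑ l', E (.inr l') (.inr l) * (ε (k, l) * ι (k, l')) := fun k => by
      rw [Finset.sum_comm]; simp
    simp only [this]
    rw [Finset.sum_comm]

/-- The number operator. -/
def numOp (ε ι : κ × μ → 𝓔) : 𝓔 := ∑ p, ε p * ι p

theorem casimir_fer (h : KData E ε ι) :
    ∑ k, ∑ k', ferK ε ι k k' * ferK ε ι k' k + ∑ l, ∑ l', ferL ε ι l l' * ferL ε ι l' l =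
      (Fintype.card κ + Fintype.card μ : ℕ) • numOp ε ι := by
  have aux : ∀ p q p' q', ε p * ι q * (ε p' * ι q') =
      (if p' = q then ε p * ι q' else 0) - ε p * ε p' * (ι q * ι q') := by
    intro p q p' q'
    have : ε p * ι q * (ε p' * ι q') =
      ε p * ((ε p' * ι q + ι q * ε p') - ε p' * ι q) * ι q' := by noncomm_ring
    rw [this, h.cran]
    split_ifs <;> noncomm_ring
  have hK : ∑ k, ∑ k', ferK ε ι k k' * ferK ε ι k' k = Fintype.card κ • numOp ε ι -
      ∑ k, ∑ k', ∑ l, ∑ l', ε (k, l) * ε (k', l') * (ι (k', l) * ι (k, l')) := by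
    simp only [ferK, Finset.sum_mul_sum, aux, Finset.sum_sub_distrib]
    congr 1
    simp [numOp, Fintype.sum_prod_type, Finset.smul_sum]
  have hL : ∑ l, ∑ l', ferL ε ι l l' * ferL ε ι l' l = Fintype.card μ • numOp ε ι -
      ∑ k, ∑ k', ∑ l, ∑ l', ε (k, l) * ε (k', l') * (ι (k, l') * ι (k', l)) := by
    simp only [ferL, Finset.sum_mul_sum, aux, Finset.sum_sub_distrib]
    congr 1
    · simp only [numOp, Fintype.sum_prod_type, Prod.mk.injEq, and_true, Finset.sum_ite_eq',
        Finset.mem_univ, if_true, Finset.sum_const, Finset.card_univ]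
      rw [Finset.sum_comm, ← Finset.smul_sum]
    · calc _ = ∑ l, ∑ k, ∑ l', ∑ k', ε (k, l) * ε (k', l') * (ι (k, l') * ι (k', l)) :=
            Finset.sum_congr rfl fun l _ => Finset.sum_comm
        _ = ∑ k, ∑ l, ∑ k', ∑ l', ε (k, l) * ε (k', l') * (ι (k, l') * ι (k', l)) := by
            rw [Finset.sum_comm]
            exact Finset.sum_congr rfl fun k _ => Finset.sum_congr rfl fun l _ => Finset.sum_comm
        _ = _ := Finset.sum_congr rfl fun k _ => Finset.sum_comm
  have hc : (∑ k, ∑ k', ∑ l, ∑ l', ε (k, l) * ε (k', l') * (ι (k', l) * ι (k, l'))) +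
      ∑ k, ∑ k', ∑ l, ∑ l', ε (k, l) * ε (k', l') * (ι (k, l') * ι (k', l)) = 0 := by
    simp only [← Finset.sum_add_distrib, ← mul_add, h.anan, mul_zero, Finset.sum_const_zero]
  rw [hK, hL, add_smul, eq_neg_of_add_eq_zero_left hc]
  abel

theorem laplacian_identity (h : KData E ε ι) :
    2 * (dd E ε * dstar E ι + dstar E ι * dd E ε) =
      ∑ c, ∑ c', E c c' * E c' c - ∑ k, ∑ k', hatK E ε ι k k' * hatK E ε ι k' k -
      ∑ l, ∑ l', hatL E ε ι l l' * hatL E ε ι l' l -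
      Fintype.card μ • ∑ k, hatK E ε ι k k + Fintype.card κ • ∑ l, hatL E ε ι l l := by
  have hKc : ∑ k, ∑ k', hatK E ε ι k k' * hatK E ε ι k' k =
      ∑ k, ∑ k', E (.inl k) (.inl k') * E (.inl k') (.inl k) -
        2 * (∑ k, ∑ k', E (.inl k) (.inl k') * ferK ε ι k k') +
        ∑ k, ∑ k', ferK ε ι k k' * ferK ε ι k' k := by
    have e : ∀ k k', hatK E ε ι k k' * hatK E ε ι k' k =
        E (.inl k) (.inl k') * E (.inl k') (.inl k) - E (.inl k) (.inl k') * ferK ε ι k k'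
          - E (.inl k') (.inl k) * ferK ε ι k' k + ferK ε ι k' k * ferK ε ι k k' := by
      intro k k'
      have := cm_eq_zero_iff.1 (cm_ferK h (.inl k') (.inl k) k' k)
      rw [this]
      simp only [hatK]
      noncomm_ring
    simp only [e, Finset.sum_add_distrib, Finset.sum_sub_distrib]
    rw [Finset.sum_comm (f := fun k k' => E (.inl k') (.inl k) * ferK ε ι k' k),
      Finset.sum_comm (f := fun k k' => ferK ε ι k' k * ferK ε ι k k'), two_mul]
    abel
  have hLc : ∑ k, ∑ k', hatL E ε ι k k' * hatL E ε ι k' k =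
      ∑ k, ∑ k', E (.inr k) (.inr k') * E (.inr k') (.inr k) +
        2 * (∑ l, ∑ l', E (.inr l') (.inr l) * ferL ε ι l l') +
        ∑ k, ∑ k', ferL ε ι k k' * ferL ε ι k' k := by
    have e : ∀ k k', hatL E ε ι k k' * hatL E ε ι k' k =
        E (.inr k) (.inr k') * E (.inr k') (.inr k) + E (.inr k) (.inr k') * ferL ε ι k' k
          + E (.inr k') (.inr k) * ferL ε ι k k' + ferL ε ι k k' * ferL ε ι k' k := by
      intro k k'
      have := cm_eq_zero_iff.1 (cm_ferL h (.inr k') (.inr k) k k')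
      rw [this]
      simp only [hatL]
      noncomm_ring
    simp only [e, Finset.sum_add_distrib]
    rw [Finset.sum_comm (f := fun k k' => E (.inr k) (.inr k') * ferL ε ι k' k), two_mul]
    abel
  have hE : ∑ c, ∑ c', E c c' * E c' c =
      ∑ k, ∑ k', E (.inl k) (.inl k') * E (.inl k') (.inl k) +
      ∑ k, ∑ k', E (.inr k) (.inr k') * E (.inr k') (.inr k) +
      2 * (∑ k, ∑ l, E (.inr l) (.inl k) * E (.inl k) (.inr l)) +
      Fintype.card μ • ∑ k, E (.inl k) (.inl k) - Fintype.card κ • ∑ l, E (.inr l) (.inr l) := by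
    have e : ∀ k l, E (.inl k) (.inr l) * E (.inr l) (.inl k) =
        E (.inr l) (.inl k) * E (.inl k) (.inr l) + E (.inl k) (.inl k) - E (.inr l) (.inr l) := by
      intro k l
      have := h.gl (.inl k) (.inr l) (.inr l) (.inl k)
      rw [if_pos rfl, if_pos rfl, cm] at this
      rw [add_sub_assoc, ← this]
      abel
    simp only [Fintype.sum_sum_type, Finset.sum_add_distrib, e, Finset.sum_sub_distrib,
      Finset.sum_const, Finset.card_univ]
    rw [Finset.sum_comm (f := fun l k => E (.inr l) (.inl k) * E (.inl k) (.inr l)), two_mul,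
      ← Finset.smul_sum]
    abel
  have hNK : ∑ k, hatK E ε ι k k = ∑ k, E (.inl k) (.inl k) - numOp ε ι := by
    simp [hatK, Finset.sum_add_distrib, numOp, ferK, Fintype.sum_prod_type, sub_eq_add_neg]
  have hNL : ∑ l, hatL E ε ι l l = ∑ l, E (.inr l) (.inr l) + numOp ε ι := by
    simp [hatL, Finset.sum_add_distrib, numOp, ferL, Fintype.sum_prod_type_right]
  have hf := casimir_fer h
  rw [← eq_sub_iff_add_eq] at hf
  rw [dd_dstar h, hKc, hLc, hE, hNK, hNL, hf, add_smul, smul_sub, smul_add]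
  noncomm_ring

end Laplacian

theorem mul_sum_le_sum_mul_of_antitone : ∀ {m : ℕ} (a b : Fin m → ℤ), Antitone a →
    (∀ t ≤ m, 0 ≤ ∑ i : Fin m, if i.val < t then b i else 0) → ∀ c, (∀ i, c ≤ a i) →
    c * ∑ i, b i ≤ ∑ i, a i * b i
  | 0, _, _, _, _, _, _ => by simp
  | m + 1, a, b, ha, hb, c, hc => by
    have ih := mul_sum_le_sum_mul_of_antitone (fun i => a i.castSucc) (fun i => b i.castSucc)
      (fun i j h => ha (Fin.castSucc_le_castSucc_iff.2 h))
      (fun t ht => by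
        have := hb t (by omega)
        rwa [Fin.sum_univ_castSucc, Fin.val_last, if_neg (by omega), add_zero] at this)
      (a (Fin.last m)) (fun i => ha (Fin.le_last _))
    have h0 := hb (m + 1) le_rfl
    simp only [Fin.is_lt, if_true] at h0
    calc c * ∑ i, b i ≤ a (Fin.last m) * ∑ i, b i := mul_le_mul_of_nonneg_right (hc _) h0
      _ ≤ _ := by
        rw [Fin.sum_univ_castSucc, Fin.sum_univ_castSucc, mul_add]
        linarith

section Tournament

variable {C : Type*} [Fintype C] [DecidableEq C] {m : ℕ}

theorem sum_antisymm_eq_zero {κ : Type*} (s : Finset κ) (f : κ → κ → ℤ)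
    (hf : ∀ i j, f i j = - f j i) : ∑ i ∈ s, ∑ j ∈ s, f i j = 0 := by
  have h : ∑ i ∈ s, ∑ j ∈ s, f i j = - ∑ i ∈ s, ∑ j ∈ s, f i j := by
    conv_rhs => rw [Finset.sum_comm]
    simp only [← Finset.sum_neg_distrib, ← hf]
  omega

theorem tournament_aux (w : C → C → Prop) [DecidableRel w]
    (hw0 : ∀ c, ¬ w c c) (hw : ∀ c c', c ≠ c' → (w c c' ↔ ¬ w c' c))
    (η : C → ℤ) (σ : Fin m → ℤ)
    (hM : ∀ B : Finset C, ∑ c ∈ B, η c ≤ ∑ i : Fin m, if i.val < B.card then σ i else 0)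
    (htot : ∑ c, η c = ∑ i, σ i) (u : C → ℤ)
    (hu : ∀ c, u c = η c + ∑ c', if w c c' then 1 else 0)
    (hsq : ∑ i : Fin m, (σ i + (m - 1 - i.val)) ^ 2 = ∑ c, u c ^ 2)
    (e : Fin m ≃ C) (he : Antitone (u ∘ e)) {i j : Fin m} (hij : i < j) : w (e i) (e j) := by
  set f : Fin m → Fin m → ℤ := fun i j =>
    (if i < j then 1 else 0) - if w (e i) (e j) then 1 else 0 with hf
  have hfa : ∀ i j, f i j = - f j i := by
    intro i j
    rcases lt_trichotomy i j with h | rfl | h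
    · have := hw (e i) (e j) (by simpa using h.ne)
      by_cases h' : w (e i) (e j) <;> simp_all [not_lt.2 h.le]
    · simp [hf, hw0]
    · have := hw (e i) (e j) (by simpa using h.ne')
      by_cases h' : w (e i) (e j) <;> simp_all [not_lt.2 h.le]
  have hfp : ∀ i j, i < j → 0 ≤ f i j := by
    intro i j h
    simp only [hf, h, if_true]
    split_ifs <;> simp
  have hD : ∀ t : ℕ, ∑ i : Fin m with i.val < t, ∑ j, f i j =
      ∑ i : Fin m with i.val < t, ∑ j : Fin m with ¬ j.val < t, f i j := by
    intro t
    have := sum_antisymm_eq_zero (Finset.univ.filter fun i : Fin m => i.val < t) f hfa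
    rw [← add_zero (∑ i : Fin m with i.val < t, ∑ j : Fin m with ¬ j.val < t, f i j), ← this,
      ← Finset.sum_add_distrib]
    refine Finset.sum_congr rfl fun i _ => ?_
    rw [add_comm, Finset.sum_filter_add_sum_filter_not]
  have hDp : ∀ t : ℕ, 0 ≤ ∑ i : Fin m with i.val < t, ∑ j : Fin m with ¬ j.val < t, f i j := by
    intro t
    refine Finset.sum_nonneg fun i hi => Finset.sum_nonneg fun j hj => hfp _ _ ?_
    simp only [Finset.mem_filter, Finset.mem_univ, true_and] at hi hj
    exact Fin.lt_def.2 (by omega)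
  set b : Fin m → ℤ := fun i => (σ i + (m - 1 - i.val)) - u (e i) with hb
  have hscore : ∀ i, b i = (σ i - η (e i)) + ∑ j, f i j := by
    intro i
    have h1 : ∑ j : Fin m, (if i < j then (1 : ℤ) else 0) = m - 1 - i.val := by
      rw [Finset.sum_boole]
      have : (Finset.univ.filter fun x => i < x) = Finset.Ioi i := by ext; simp
      rw [this, Fin.card_Ioi]
      have := i.is_lt
      omega
    simp only [hb, hu, hf, Finset.sum_sub_distrib, h1]
    rw [← e.sum_comp (fun c' => if w (e i) c' then (1 : ℤ) else 0)]
    ring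
  have hcard : ∀ t ≤ m, (Finset.univ.filter fun i : Fin m => i.val < t).card = t := by
    intro t ht
    rw [Fin.card_filter_val_lt]
    omega
  have hpart : ∀ t ≤ m, ∑ i : Fin m with i.val < t, η (e i) ≤ ∑ i : Fin m with i.val < t, σ i := by
    intro t ht
    have := hM ((Finset.univ.filter fun i : Fin m => i.val < t).map e.toEmbedding)
    rw [Finset.sum_map, Finset.card_map, hcard t ht] at this
    simpa [Finset.sum_filter] using this
  have hbt : ∀ t, ∑ i : Fin m with i.val < t, b i = (∑ i : Fin m with i.val < t, σ i -
      ∑ i : Fin m with i.val < t, η (e i)) +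
      ∑ i : Fin m with i.val < t, ∑ j : Fin m with ¬ j.val < t, f i j := by
    intro t
    rw [← hD]
    simp only [hscore, Finset.sum_add_distrib, Finset.sum_sub_distrib]
  have hb0 : ∑ i, b i = 0 := by
    simp only [hscore, Finset.sum_add_distrib, Finset.sum_sub_distrib]
    rw [sum_antisymm_eq_zero _ _ hfa, ← htot, e.sum_comp η]
    ring
  have hab : 0 ≤ ∑ i, u (e i) * b i := by
    obtain ⟨c, hc⟩ : ∃ c, ∀ i, c ≤ (u ∘ e) i := by
      obtain ⟨c, hc⟩ := (Set.finite_range (u ∘ e)).bddBelow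
      exact ⟨c, fun i => hc ⟨i, rfl⟩⟩
    have := mul_sum_le_sum_mul_of_antitone (u ∘ e) b he (fun t ht => by
      rw [← Finset.sum_filter, hbt]
      linarith [hDp t, hpart t ht]) c hc
    simpa [hb0] using this
  have hsq' : ∑ i, b i ^ 2 + 2 * ∑ i, u (e i) * b i = 0 := by
    rw [← e.sum_comp (fun c => u c ^ 2)] at hsq
    rw [Finset.mul_sum, ← Finset.sum_add_distrib, ← sub_eq_zero.2 hsq, ← Finset.sum_sub_distrib]
    refine Finset.sum_congr rfl fun i _ => ?_
    simp only [hb]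
    ring
  have hbz : ∀ i, b i = 0 := by
    have h0 : ∑ i, b i ^ 2 = 0 :=
      le_antisymm (by linarith) (Finset.sum_nonneg fun i _ => sq_nonneg _)
    intro i
    exact pow_eq_zero_iff (two_ne_zero) |>.1
      ((Finset.sum_eq_zero_iff_of_nonneg fun i _ => sq_nonneg _).1 h0 i (Finset.mem_univ _))
  have hDz := hbt j.val
  simp only [hbz, Finset.sum_const_zero] at hDz
  have hz : ∑ i : Fin m with i.val < j.val, ∑ j' : Fin m with ¬ j'.val < j.val, f i j' = 0 :=
    le_antisymm (by linarith [hpart j.val j.is_lt.le]) (hDp _)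
  rw [Finset.sum_eq_zero_iff_of_nonneg (fun i hi => Finset.sum_nonneg fun j' hj => hfp _ _ (by
    simp only [Finset.mem_filter, Finset.mem_univ, true_and] at hi hj
    exact Fin.lt_def.2 (by omega)))] at hz
  have hz' := hz i (by simpa using hij)
  rw [Finset.sum_eq_zero_iff_of_nonneg (fun j' hj => hfp _ _ (by
    simp only [Finset.mem_filter, Finset.mem_univ, true_and] at hj
    exact Fin.lt_def.2 (by have := Fin.lt_def.1 hij; omega)))] at hz'
  have := hz' j (by simp)
  by_contra hne
  simp [hf, hij, hne] at this

theorem tournament_of_sum_sq_eq (hC : Fintype.card C = m) (w : C → C → Prop) [DecidableRel w]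
    (hw0 : ∀ c, ¬ w c c) (hw : ∀ c c', c ≠ c' → (w c c' ↔ ¬ w c' c))
    (η : C → ℤ) (σ : Fin m → ℤ)
    (hM : ∀ B : Finset C, ∑ c ∈ B, η c ≤ ∑ i : Fin m, if i.val < B.card then σ i else 0)
    (htot : ∑ c, η c = ∑ i, σ i) (u : C → ℤ)
    (hu : ∀ c, u c = η c + ∑ c', if w c c' then 1 else 0)
    (hsq : ∑ i : Fin m, (σ i + (m - 1 - i.val)) ^ 2 = ∑ c, u c ^ 2)
    {c c' : C} (hc : c ≠ c') : u c ≠ u c' ∧ (u c' < u c → w c c') := by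
  obtain ⟨e0⟩ : Nonempty (Fin m ≃ C) := ⟨(Fintype.equivFinOfCardEq hC).symm⟩
  set e : Fin m ≃ C := (Tuple.sort fun i => - u (e0 i)).trans e0 with he
  have hanti : Antitone (u ∘ e) := by
    intro i j hij
    have := Tuple.monotone_sort (fun i => - u (e0 i)) hij
    simpa [he] using this
  have key := tournament_aux w hw0 hw η σ hM htot u hu hsq
  have hlt : ∀ c c', u c' < u c → w c c' := by
    intro c c' h
    have := key e hanti (i := e.symm c) (j := e.symm c') (by
      by_contra hge
      have := hanti (not_lt.1 hge)
      simp at this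
      omega)
    simpa using this
  refine ⟨fun heq => ?_, hlt c c'⟩
  wlog hij : e.symm c < e.symm c' generalizing c c'
  · exact this hc.symm heq.symm (lt_of_le_of_ne (not_lt.1 hij) (by simpa using hc.symm))
  have h1 := key e hanti hij
  have h2 := key ((Equiv.swap (e.symm c) (e.symm c')).trans e) (by
    have : u ∘ ((Equiv.swap (e.symm c) (e.symm c')).trans e) = u ∘ e := by
      funext i
      simp only [Function.comp, Equiv.trans_apply, Equiv.swap_apply_def]
      split_ifs with h h'
      · simp [h, heq]
      · simp [h', heq]
      · rfl
    rwa [this]) hij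
  simp only [Equiv.trans_apply, Equiv.swap_apply_left, Equiv.swap_apply_right,
    Equiv.apply_symm_apply] at h1 h2
  exact (hw _ _ hc).1 h1 h2

end Tournament

/-- The combinatorial heart: an extremal pair of weights forces the exterior monomial to be a
union of full rows. -/
theorem card_eq_mul_of_weights {n r : ℕ} (s : Finset (Fin n × Fin r)) (σ : Fin (n + r) → ℤ)
    (β : Fin n → ℤ) (d : ℤ) (η : Fin n ⊕ Fin r → ℤ)
    (hηk : ∀ k, η (.inl k) = β k + ∑ l, if (k, l) ∈ s then 1 else 0)
    (hηl : ∀ l, η (.inr l) = d - ∑ k, if (k, l) ∈ s then 1 else 0)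
    (hM : ∀ B : Finset (Fin n ⊕ Fin r),
      ∑ c ∈ B, η c ≤ ∑ i : Fin (n + r), if i.val < B.card then σ i else 0)
    (htot : ∑ c, η c = ∑ i, σ i)
    (hsq : ∑ i : Fin (n + r), (σ i + ((n + r : ℕ) - 1 - i.val)) ^ 2 =
      ∑ k : Fin n, (β k + ((n + r : ℕ) - 1 - k.val)) ^ 2 + ∑ l : Fin r, (d + (r - 1 - l.val)) ^ 2) :
    ∃ t ≤ n, s.card = t * r := by
  classical
  set w : Fin n ⊕ Fin r → Fin n ⊕ Fin r → Prop := fun c c' => match c, c' with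
    | .inl k, .inl k' => k < k'
    | .inr l, .inr l' => l < l'
    | .inl k, .inr l => (k, l) ∉ s
    | .inr l, .inl k => (k, l) ∈ s with hw
  set u : Fin n ⊕ Fin r → ℤ := Sum.elim (fun k => β k + ((n + r : ℕ) - 1 - k.val))
    (fun l => d + (r - 1 - l.val)) with hu
  have hIoi : ∀ (N : ℕ) (i : Fin N), ∑ j : Fin N, (if i < j then (1 : ℤ) else 0) = N - 1 - i.val := by
    intro N i
    rw [Finset.sum_boole]
    have : (Finset.univ.filter fun x => i < x) = Finset.Ioi i := by ext; simp
    rw [this, Fin.card_Ioi]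
    have := i.is_lt
    omega
  have key : ∀ c c', c ≠ c' → u c ≠ u c' ∧ (u c' < u c → w c c') := by
    intro c c' hcc
    refine tournament_of_sum_sq_eq (by simp) w ?_ ?_ η σ hM htot u ?_ ?_ hcc
    · rintro (k | l) <;> simp [hw]
    · rintro (k | l) (k' | l') h
      · have : k ≠ k' := by simpa using h
        simp only [hw]; omega
      · simp [hw]
      · simp [hw]
      · have : l ≠ l' := by simpa using h
        simp only [hw]; omega
    · rintro (k | l)
      · have e : ∀ l, (if (k, l) ∉ s then (1 : ℤ) else 0) = 1 - if (k, l) ∈ s then 1 else 0 := by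
          intro l; split_ifs <;> simp_all
        rw [Fintype.sum_sum_type, hηk]
        simp only [hw, hu, Sum.elim_inl, e, Finset.sum_sub_distrib, hIoi]
        simp
        ring
      · rw [Fintype.sum_sum_type, hηl]
        simp only [hw, hu, Sum.elim_inr, hIoi]
        ring
    · rw [Fintype.sum_sum_type, hsq]
      simp [hu]
  have hs : ∀ k l, (k, l) ∈ s ↔ u (.inl k) < u (.inr l) := by
    intro k l
    constructor
    · intro h
      by_contra hlt
      have h2 := key (.inl k) (.inr l) (by simp)
      exact h2.2 (lt_of_le_of_ne (not_lt.1 hlt) h2.1.symm) h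
    · intro h
      exact (key (.inr l) (.inl k) (by simp)).2 h
  have hstep : ∀ k (l l' : Fin r), l.val + 1 = l'.val → ((k, l) ∈ s ↔ (k, l') ∈ s) := by
    intro k l l' hl
    rw [hs, hs]
    have h1 := (key (.inl k) (.inr l) (by simp)).1
    have h2 := (key (.inl k) (.inr l') (by simp)).1
    have : u (.inr l') + 1 = u (.inr l) := by
      simp only [hu, Sum.elim_inr, ← hl]
      push_cast
      ring
    omega
  rcases Nat.eq_zero_or_pos r with rfl | hr
  · exact ⟨0, by simp, by simp [Finset.eq_empty_of_isEmpty s]⟩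
  have hall : ∀ k (l : Fin r), (k, l) ∈ s ↔ (k, (⟨0, hr⟩ : Fin r)) ∈ s := by
    rintro k ⟨l, hl⟩
    induction l with
    | zero => rfl
    | succ l ih => rw [← hstep k ⟨l, by omega⟩ ⟨l + 1, hl⟩ rfl, ih]
  have hprod : s = (Finset.univ.filter fun k => (k, (⟨0, hr⟩ : Fin r)) ∈ s) ×ˢ Finset.univ := by
    ext ⟨k, l⟩
    simp [hall k l]
  refine ⟨_, ?_, by rw [hprod, Finset.card_product, Finset.card_univ, Fintype.card_fin]⟩
  exact (Finset.card_le_univ _).trans (by simp)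

section Weights

variable {R V Ξ M : Type*} [CommRing R] [AddCommGroup V] [Module R V] [AddCommGroup M]

/-- `T` shifts weights by `δ`: every basis vector occurring in `T v` has weight `δ` more than
some basis vector occurring in `v`. -/
def Shifts (b : Module.Basis Ξ R V) (wt : Ξ → M) (T : Module.End R V) (δ : M) : Prop :=
  ∀ v, ∀ y, b.repr (T v) y ≠ 0 → ∃ x, b.repr v x ≠ 0 ∧ wt y = wt x + δ

variable {b : Module.Basis Ξ R V} {wt : Ξ → M} {T T' : Module.End R V} {δ δ' : M}

theorem Shifts.mul (h : Shifts b wt T δ) (h' : Shifts b wt T' δ') :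
    Shifts b wt (T * T') (δ + δ') := by
  intro v y hy
  obtain ⟨x, hx, e⟩ := h _ _ hy
  obtain ⟨x', hx', e'⟩ := h' _ _ hx
  exact ⟨x', hx', by rw [e, e', add_assoc, add_comm δ']⟩

theorem Shifts.zero : Shifts b wt (0 : Module.End R V) δ := fun v y hy => by simp at hy

theorem Shifts.add (h : Shifts b wt T δ) (h' : Shifts b wt T' δ) : Shifts b wt (T + T') δ := by
  intro v y hy
  by_cases h1 : b.repr (T v) y = 0
  · refine h' v y fun h2 => hy ?_
    rw [LinearMap.add_apply, map_add, Finsupp.add_apply, h1, h2, add_zero]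
  · exact h v y h1

theorem Shifts.neg (h : Shifts b wt T δ) : Shifts b wt (-T) δ := by
  intro v y hy
  exact h v y fun h1 => hy (by rw [LinearMap.neg_apply, map_neg, Finsupp.neg_apply, h1, neg_zero])

theorem Shifts.sum {κ : Type*} (s : Finset κ) {f : κ → Module.End R V}
    (h : ∀ i ∈ s, Shifts b wt (f i) δ) : Shifts b wt (∑ i ∈ s, f i) δ := by
  classical
  induction s using Finset.induction_on with
  | empty => simpa using Shifts.zero
  | insert a s ha ih =>
    rw [Finset.sum_insert ha]
    exact (h a (by simp)).add (ih fun i hi => h i (by simp [hi]))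

theorem Shifts.congr (h : Shifts b wt T δ) (hδ : δ = δ') : Shifts b wt T δ' := hδ ▸ h

theorem exists_split (b : Module.Basis Ξ R V) (P : Ξ → Prop) (v : V) : ∃ v₁ v₂, v = v₁ + v₂ ∧
    (∀ x, b.repr v₁ x ≠ 0 → b.repr v x ≠ 0 ∧ P x) ∧ (∀ x, b.repr v₂ x ≠ 0 → ¬ P x) ∧
      (∀ x, P x → b.repr v₁ x = b.repr v x) := by
  classical
  refine ⟨b.repr.symm ((b.repr v).filter P), b.repr.symm ((b.repr v).filter fun x => ¬ P x),
    ?_, ?_, ?_, ?_⟩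
  · rw [← map_add, Finsupp.filter_add_filter_not, LinearEquiv.symm_apply_apply]
  · intro x hx
    rw [LinearEquiv.apply_symm_apply, Finsupp.filter_apply] at hx
    split_ifs at hx with h
    · exact ⟨hx, h⟩
    · simp at hx
  · intro x hx
    rw [LinearEquiv.apply_symm_apply, Finsupp.filter_apply] at hx
    split_ifs at hx with h
    · simp at hx
    · exact h
  · intro x hx
    rw [LinearEquiv.apply_symm_apply, Finsupp.filter_apply, if_pos hx]

/-- If two vectors with disjoint sets of weights have equal sum zero, both vanish. -/
theorem eq_zero_of_add_eq_zero_of_disjoint (P : Ξ → Prop) {v₁ v₂ : V} (h : v₁ + v₂ = 0)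
    (h1 : ∀ x, b.repr v₁ x ≠ 0 → P x) (h2 : ∀ x, b.repr v₂ x ≠ 0 → ¬ P x) : v₁ = 0 := by
  apply b.repr.injective
  ext x
  rw [map_zero, Finsupp.zero_apply]
  by_contra hx
  have hx2 : b.repr v₂ x = 0 := by
    by_contra h'
    exact h2 x h' (h1 x hx)
  have := congrArg (fun w => b.repr w x) h
  simp only [map_add, Finsupp.add_apply, hx2, add_zero, map_zero, Finsupp.zero_apply] at this
  exact hx this

theorem Shifts.eq_zero_of_split (h : Shifts b wt T δ) (x₀ : M) {v v₁ v₂ : V} (hv : v = v₁ + v₂)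
    (h1 : ∀ x, b.repr v₁ x ≠ 0 → wt x = x₀) (h2 : ∀ x, b.repr v₂ x ≠ 0 → ¬ wt x = x₀)
    (hT : T v = 0) : T v₁ = 0 := by
  rw [hv, map_add] at hT
  refine eq_zero_of_add_eq_zero_of_disjoint (b := b) (fun x => wt x = x₀ + δ) hT ?_ ?_
  · intro y hy
    obtain ⟨x, hx, e⟩ := h _ _ hy
    rw [e, h1 x hx]
  · intro y hy
    obtain ⟨x, hx, e⟩ := h _ _ hy
    rw [e]
    exact fun h' => h2 x hx (add_right_cancel h')

end Weights

section Boson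

variable (R : Type*) [CommRing R] {σ : Type*} [DecidableEq σ]

/-- Multiplication by a variable. -/
noncomputable def mz (c : σ) : Module.End R (MvPolynomial σ R) := LinearMap.mulLeft R (X c)

/-- Partial derivative. -/
noncomputable def pd (c : σ) : Module.End R (MvPolynomial σ R) := (pderiv c).toLinearMap

theorem mz_apply (c : σ) (f : MvPolynomial σ R) : mz R c f = X c * f := rfl

theorem pd_apply (c : σ) (f : MvPolynomial σ R) : pd R c f = pderiv c f := rfl

theorem cm_mz_mz (p q : σ) : cm (mz R p) (mz R q) = 0 := by
  refine LinearMap.ext fun f => ?_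
  simp [cm, mz_apply, mul_left_comm]

theorem cm_pd_mz (p q : σ) : cm (pd R p) (mz R q) = if p = q then 1 else 0 := by
  refine LinearMap.ext fun f => ?_
  simp only [cm, LinearMap.sub_apply, Module.End.mul_apply, mz_apply, pd_apply, pderiv_mul,
    pderiv_X, Pi.single_apply, eq_comm (a := q)]
  split_ifs <;> simp

theorem cm_pd_pd (p q : σ) : cm (pd R p) (pd R q) = 0 := by
  refine LinearMap.ext fun f => ?_
  induction f using MvPolynomial.induction_on' with
  | monomial a c =>
    simp only [cm, LinearMap.sub_apply, Module.End.mul_apply, pd_apply, pderiv_monomial,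
      LinearMap.zero_apply]
    rw [sub_eq_zero, tsub_right_comm]
    rcases eq_or_ne p q with rfl | h
    · rfl
    · simp [h, h.symm, mul_right_comm]
  | add f g hf hg => rw [map_add, hf, hg]; simp

theorem isGl_mz_pd : IsGl fun p q : σ => mz R p * pd R q :=
  isGl_boson _ _ (cm_mz_mz R) (cm_pd_pd R) (cm_pd_mz R)

variable {R} {M : Type*} [AddCommGroup M]

theorem shifts_mz {wt : (σ →₀ ℕ) → M} {δ : M} (c : σ)
    (h : ∀ a, wt (a + Finsupp.single c 1) = wt a + δ) :
    Shifts (basisMonomials σ R) wt (mz R c) δ := by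
  intro v y hy
  change coeff y (X c * v) ≠ 0 at hy
  rw [coeff_X_mul'] at hy
  split_ifs at hy with hc
  · refine ⟨y - Finsupp.single c 1, hy, ?_⟩
    rw [← h, tsub_add_cancel_of_le]
    rw [Finsupp.single_le_iff]
    exact Nat.one_le_iff_ne_zero.2 (by simpa using hc)
  · simp at hy

theorem shifts_pd {wt : (σ →₀ ℕ) → M} {δ : M} (c : σ)
    (h : ∀ a, wt (a + Finsupp.single c 1) = wt a - δ) :
    Shifts (basisMonomials σ R) wt (pd R c) δ := by
  intro v y hy
  change coeff y (pderiv c v) ≠ 0 at hy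
  rw [coeff_pderiv] at hy
  refine ⟨y + Finsupp.single c 1, left_ne_zero_of_mul hy, ?_⟩
  rw [h, sub_add_cancel]

end Boson

section FockWeights

variable (R : Type*) [CommRing R] (ι σ : Type*) [Fintype ι] [DecidableEq ι] [DecidableEq σ]

/-- The monomial basis of the Fock space. -/
noncomputable def fb : Module.Basis (Σ _ : Finset ι, σ →₀ ℕ) R (Finset ι → MvPolynomial σ R) :=
  Pi.basis fun _ => basisMonomials σ R

variable {R ι σ}

theorem fb_repr (v : Finset ι → MvPolynomial σ R) (x) : (fb R ι σ).repr v x = coeff x.2 (v x.1) := by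
  rw [fb, Pi.basis_repr]; rfl

variable {M : Type*} [AddCommGroup M] {wt : (Σ _ : Finset ι, σ →₀ ℕ) → M} {δ : M}

theorem shifts_lift0 {T : Module.End R (MvPolynomial σ R)}
    (h : ∀ s, Shifts (basisMonomials σ R) (fun a => wt ⟨s, a⟩) T δ) :
    Shifts (fb R ι σ) wt (lift0 R T) δ := by
  rintro v ⟨s, a⟩ hy
  rw [fb_repr] at hy
  obtain ⟨x, hx, e⟩ := h s (v s) a hy
  exact ⟨⟨s, x⟩, by rwa [fb_repr], e⟩

theorem coeff_ksign_smul_ne_zero {p : ι} {t : Finset ι} {a : σ →₀ ℕ} {f : MvPolynomial σ R}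
    (h : coeff a (ksign p t • f) ≠ 0) : coeff a f ≠ 0 := by
  intro h'
  rw [coeff_smul, h', smul_zero] at h
  exact h rfl

theorem shifts_cr (p : ι) (h : ∀ s a, p ∉ s → wt ⟨insert p s, a⟩ = wt ⟨s, a⟩ + δ) :
    Shifts (fb R ι σ) wt (cr R p) δ := by
  rintro v ⟨s, a⟩ hy
  rw [fb_repr, cr_apply] at hy
  dsimp only at hy
  split_ifs at hy with hs
  · refine ⟨⟨s.erase p, a⟩, ?_, ?_⟩
    · rw [fb_repr]
      exact coeff_ksign_smul_ne_zero hy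
    · rw [← h _ _ (by simp), Finset.insert_erase hs]
  · simp at hy

theorem shifts_an (p : ι) (h : ∀ s a, p ∉ s → wt ⟨insert p s, a⟩ = wt ⟨s, a⟩ - δ) :
    Shifts (fb R ι σ) wt (an R p) δ := by
  rintro v ⟨s, a⟩ hy
  rw [fb_repr, an_apply] at hy
  dsimp only at hy
  split_ifs at hy with hs
  · simp at hy
  · refine ⟨⟨insert p s, a⟩, ?_, ?_⟩
    · rw [fb_repr]
      exact coeff_ksign_smul_ne_zero hy
    · rw [h _ _ hs, sub_add_cancel]

end FockWeights

section Majorization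

variable {K : Type*} [Field K] {m : ℕ} {C : Type*} [Fintype C] [DecidableEq C]

theorem det_X_ne_zero {σ τ : Type*} [Fintype τ] [DecidableEq τ] (g : τ × τ → σ)
    (hg : Function.Injective g) :
    (Matrix.of fun i j => (X (g (i, j)) : MvPolynomial σ K)).det ≠ 0 := by
  have : (Matrix.of fun i j => (X (g (i, j)) : MvPolynomial σ K)) =
      (rename g : _ →ₐ[K] _).toRingHom.mapMatrix (Matrix.mvPolynomialX τ τ K) := by
    ext i j
    simp
  rw [this, ← RingHom.map_det]
  intro h
  exact Matrix.det_mvPolynomialX_ne_zero τ K (rename_injective g hg (by simpa using h))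

theorem majorization [CharZero K] (f : MvPolynomial (Fin m × C) K) (hf : f ≠ 0)
    (hR : ∀ i i' : Fin m, i < i' → (∑ c, mz K (i, c) * pd K (i', c)) f = 0)
    (σ : Fin m → ℤ) (η : C → ℤ)
    (hσ : ∀ a, coeff a f ≠ 0 → ∀ i, ∑ c, (a (i, c) : ℤ) = σ i)
    (hη : ∀ a, coeff a f ≠ 0 → ∀ c, ∑ i, (a (i, c) : ℤ) = η c) (B : Finset C) :
    ∑ c ∈ B, η c ≤ ∑ i : Fin m, if i.val < B.card then σ i else 0 := by
  set θ : ((Fin m × C) →₀ ℕ) → Fin m → ℤ := fun a i => ∑ c ∈ B, (a (i, c) : ℤ) with hθ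
  set ht : (Fin m → ℤ) → ℤ := fun x => ∑ i : Fin m, (i.val : ℤ) * x i with hht
  obtain ⟨a₀, ha₀, hmin⟩ := Finset.exists_min_image f.support (fun a => ht (θ a))
    (by simpa using hf)
  rw [mem_support_iff] at ha₀
  obtain ⟨f₁, f₂, hsplit, h1, h2, h3⟩ :=
    exists_split (basisMonomials (Fin m × C) K) (fun a => θ a = θ a₀) f
  have hkill : ∀ i i' : Fin m, i < i' → (∑ c ∈ B, mz K (i, c) * pd K (i', c)) f₁ = 0 := by
    intro i i' hii
    set δ : Fin m → ℤ := Pi.single i 1 + -Pi.single i' 1 with hδ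
    have hz : ∀ c ∈ B, ∀ i a, θ (a + Finsupp.single (i, c) 1) = θ a + Pi.single i 1 := by
      intro c hc i a
      funext j
      simp only [hθ, Finsupp.add_apply, Nat.cast_add, Finset.sum_add_distrib, Pi.add_apply,
        add_right_inj, Finsupp.single_apply, Prod.mk.injEq, Pi.single_apply]
      by_cases hj : j = i
      · simp [hj, hc]
      · simp [hj, eq_comm (a := i)]
    have hz' : ∀ c ∉ B, ∀ i a, θ (a + Finsupp.single (i, c) 1) = θ a := by
      intro c hc i a
      funext j
      simp only [hθ, Finsupp.add_apply, Nat.cast_add, Finset.sum_add_distrib,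
        add_eq_left, Finsupp.single_apply, Prod.mk.injEq]
      refine Finset.sum_eq_zero fun x hx => ?_
      rw [if_neg]
      · rfl
      · rintro ⟨_, rfl⟩
        exact hc hx
    have hT1 : Shifts (basisMonomials (Fin m × C) K) θ
        (∑ c ∈ B, mz K (i, c) * pd K (i', c)) δ :=
      Shifts.sum _ fun c hc => (shifts_mz _ (hz c hc i)).mul
        (shifts_pd _ fun a => by rw [hz c hc i', sub_neg_eq_add])
    have hT2 : Shifts (basisMonomials (Fin m × C) K) θ
        (∑ c ∈ Bᶜ, mz K (i, c) * pd K (i', c)) 0 :=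
      Shifts.sum _ fun c hc => ((shifts_mz (δ := 0) _ fun a => by
        rw [hz' c (by simpa using hc) i, add_zero]).mul
        (shifts_pd (δ := 0) _ fun a => by rw [hz' c (by simpa using hc) i', sub_zero])).congr
        (add_zero 0)
    have hsum := hR i i' hii
    rw [← Finset.sum_add_sum_compl B, LinearMap.add_apply] at hsum
    nth_rewrite 1 [hsplit] at hsum
    rw [map_add, add_assoc] at hsum
    refine eq_zero_of_add_eq_zero_of_disjoint (b := basisMonomials (Fin m × C) K)
      (fun a => θ a = θ a₀ + δ) hsum ?_ ?_
    · intro y hy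
      obtain ⟨x, hx, e⟩ := hT1 _ _ hy
      rw [e, (h1 x hx).2]
    · intro y hy hyP
      rw [map_add, Finsupp.add_apply] at hy
      by_cases hy1 : (basisMonomials (Fin m × C) K).repr
          ((∑ c ∈ B, mz K (i, c) * pd K (i', c)) f₂) y = 0
      · rw [hy1, zero_add] at hy
        obtain ⟨x, hx, e⟩ := hT2 _ _ hy
        have := hmin x (mem_support_iff.2 hx)
        rw [add_zero] at e
        rw [← e, hyP] at this
        have hadd : ht (θ a₀ + δ) = ht (θ a₀) + (i.val - i'.val) := by
          simp only [hht, hδ, Pi.add_apply, mul_add, Finset.sum_add_distrib, Pi.neg_apply,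
            Pi.single_apply]
          simp [sub_eq_add_neg]
        have hlt : (i.val : ℤ) < i'.val := by exact_mod_cast hii
        linarith
      · obtain ⟨x, hx, e⟩ := hT1 _ _ hy1
        rw [e] at hyP
        exact h2 x hx (add_right_cancel hyP)
  have hpd : ∀ i' : Fin m, B.card ≤ i'.val → ∀ c ∈ B, pderiv (i', c) f₁ = 0 := by
    intro i' hi'
    let eB := B.equivFin
    let g : Fin B.card × Fin B.card → Fin m × C :=
      fun p => (⟨p.1, by have := p.1.is_lt; have := i'.is_lt; omega⟩, eB.symm p.2)
    have hg : Function.Injective g := by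
      rintro ⟨p, q⟩ ⟨p', q'⟩ h
      simp only [g, Prod.mk.injEq, Fin.mk.injEq] at h
      have h' := eB.symm.injective (Subtype.ext h.2)
      rw [h', Fin.ext h.1]
    have hz := Matrix.eq_zero_of_mulVec_eq_zero (det_X_ne_zero (K := K) g hg)
      (v := fun j => pderiv (i', (eB.symm j : C)) f₁) (by
        funext i
        have := hkill (g (i, i)).1 i' (Fin.lt_def.2 (by have := i.is_lt; simp only [g]; omega))
        rw [LinearMap.sum_apply] at this
        simp only [Matrix.mulVec, dotProduct, Matrix.of_apply, Pi.zero_apply]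
        rw [← this, ← Finset.sum_coe_sort B, ← eB.symm.sum_comp]
        rfl)
    intro c hc
    have := congrFun hz (eB ⟨c, hc⟩)
    simpa using this
  have ha₁ : coeff a₀ f₁ ≠ 0 := by
    have := h3 a₀ rfl
    change coeff a₀ f₁ = coeff a₀ f at this
    rwa [this]
  have hθ0 : ∀ i' : Fin m, B.card ≤ i'.val → ∀ c ∈ B, a₀ (i', c) = 0 := by
    intro i' hi' c hc
    by_contra hne
    have h := congrArg (coeff (a₀ - Finsupp.single (i', c) 1)) (hpd i' hi' c hc)
    rw [coeff_pderiv, tsub_add_cancel_of_le (by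
      rw [Finsupp.single_le_iff]; exact Nat.one_le_iff_ne_zero.2 hne), coeff_zero] at h
    have h' := (mul_eq_zero.1 h).resolve_left ha₁
    norm_cast at h'
  calc ∑ c ∈ B, η c = ∑ i, ∑ c ∈ B, (a₀ (i, c) : ℤ) := by
        rw [Finset.sum_comm]
        exact Finset.sum_congr rfl fun c _ => (hη a₀ ha₀ c).symm
    _ ≤ _ := by
        refine Finset.sum_le_sum fun i _ => ?_
        split_ifs with h
        · rw [← hσ a₀ ha₀ i]
          exact Finset.sum_le_sum_of_subset_of_nonneg (Finset.subset_univ _) fun c _ _ => by positivity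
        · rw [Finset.sum_eq_zero fun c hc => by rw [hθ0 i (not_lt.1 h) c hc]; rfl]

end Majorization

section BosonCasimir

theorem boson_casimir {𝓔 : Type*} [Ring 𝓔] {I C : Type*} [Fintype I] [DecidableEq I] [Fintype C]
    [DecidableEq C] (hIC : Fintype.card I = Fintype.card C) (z D : I × C → 𝓔)
    (hDD : ∀ p q, cm (D p) (D q) = 0)
    (hDz : ∀ p q, cm (D p) (z q) = if p = q then 1 else 0) :
    ∑ c, ∑ c', (∑ i, z (i, c) * D (i, c')) * (∑ i, z (i, c') * D (i, c)) =
      ∑ i, ∑ i', (∑ c, z (i, c) * D (i', c)) * (∑ c, z (i', c) * D (i, c)) := by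
  have aux : ∀ p q p' q', z p * D q * (z p' * D q') =
      z p * z p' * (D q * D q') + if q = p' then z p * D q' else 0 := by
    intro p q p' q'
    have h : D q * z p' = z p' * D q + if q = p' then 1 else 0 := by
      rw [← hDz, cm]; abel
    have : z p * D q * (z p' * D q') = z p * (D q * z p') * D q' := by noncomm_ring
    rw [this, h]
    split_ifs <;> noncomm_ring
  simp only [Finset.sum_mul_sum, aux, Finset.sum_add_distrib, Prod.mk.injEq]
  congr 1
  · calc _ = ∑ c, ∑ c', ∑ i, ∑ i', z (i, c) * z (i', c') * (D (i', c) * D (i, c')) := by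
          refine Finset.sum_congr rfl fun c _ => Finset.sum_congr rfl fun c' _ =>
            Finset.sum_congr rfl fun i _ => Finset.sum_congr rfl fun i' _ => ?_
          rw [cm_eq_zero_iff.1 (hDD (i, c') (i', c))]
      _ = ∑ c, ∑ i, ∑ c', ∑ i', z (i, c) * z (i', c') * (D (i', c) * D (i, c')) :=
          Finset.sum_congr rfl fun c _ => Finset.sum_comm
      _ = ∑ i, ∑ c, ∑ i', ∑ c', z (i, c) * z (i', c') * (D (i', c) * D (i, c')) := by
          rw [Finset.sum_comm]
          exact Finset.sum_congr rfl fun i _ => Finset.sum_congr rfl fun c _ => Finset.sum_comm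
      _ = _ := Finset.sum_congr rfl fun i _ => Finset.sum_comm
  · have h1 : ∑ c : C, ∑ c' : C, ∑ i : I, ∑ j : I, (if i = j ∧ True then z (i, c) * D (j, c) else 0)
        = Fintype.card C • ∑ c, ∑ i, z (i, c) * D (i, c) := by
      simp [Finset.smul_sum]
    have h2 : ∑ i : I, ∑ i' : I, ∑ c : C, ∑ c' : C, (if True ∧ c = c' then z (i, c) * D (i, c') else 0)
        = Fintype.card I • ∑ c, ∑ i, z (i, c) * D (i, c) := by
      rw [Finset.sum_comm (f := fun c i => z (i, c) * D (i, c))]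
      simp [Finset.smul_sum]
    rw [h1, h2, hIC]

end BosonCasimir

section FockKostant

variable (K : Type*) [Field K] (n r : ℕ)

/-- Exterior forms with polynomial coefficients in a square generic matrix. -/
abbrev Fk := Finset (Fin n × Fin r) → MvPolynomial (Fin (n + r) × (Fin n ⊕ Fin r)) K

/-- Column operators. -/
noncomputable def En (c c' : Fin n ⊕ Fin r) : Module.End K (Fk K n r) :=
  lift0 K (∑ i, mz K (i, c) * pd K (i, c'))

/-- Row operators. -/
noncomputable def Rn (i i' : Fin (n + r)) : Module.End K (Fk K n r) :=
  lift0 K (∑ c, mz K (i, c) * pd K (i', c))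

theorem cm_lift0 {ι R G : Type*} [Fintype ι] [DecidableEq ι] [CommRing R] [AddCommGroup G] [Module R G]
    (T T' : Module.End R G) : cm (lift0 (ι := ι) R T) (lift0 R T') = lift0 R (cm T T') := by
  simp [cm]

theorem isGl_En : IsGl (En K n r) := by
  intro p q p' q'
  simp only [En]
  rw [cm_lift0, (isGl_mz_pd K).sum_left]
  split_ifs <;> simp

theorem isGl_Rn : IsGl (Rn K n r) := by
  intro p q p' q'
  simp only [Rn]
  rw [cm_lift0, (isGl_mz_pd K).sum_right]
  split_ifs <;> simp

theorem cm_En_Rn (c c' i i') : cm (En K n r c c') (Rn K n r i i') = 0 := by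
  rw [En, Rn, cm_lift0, (isGl_mz_pd K).cm_sum_sum, map_zero]

theorem kdata : KData (En K n r) (cr K) (an K) where
  gl := isGl_En K n r
  crcr := cr_anticomm K
  anan := an_anticomm K
  cran := cr_an_anticomm K
  cmcr _ _ _ := lift0_mul_cr K _ _
  cman _ _ _ := lift0_mul_an K _ _

theorem casimir_En_eq : ∑ c, ∑ c', En K n r c c' * En K n r c' c =
    ∑ i, ∑ i', Rn K n r i i' * Rn K n r i' i := by
  have := boson_casimir (I := Fin (n + r)) (C := Fin n ⊕ Fin r) (by simp) _ _
    (cm_pd_pd K) (cm_pd_mz K)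
  have h := congrArg (lift0 (ι := Fin n × Fin r) K) this
  simpa only [map_sum, map_mul, En, Rn] using h

/-- The operator `K_r`. -/
noncomputable def Kr : Module.End K (Fk K n r) :=
  ∑ l, ∑ l', if l < l' then
    hatL (En K n r) (cr K) (an K) l' l * hatL (En K n r) (cr K) (an K) l l' else 0

/-- The twisted Laplacian. -/
noncomputable def Lp : Module.End K (Fk K n r) :=
  dd (En K n r) (cr K) * dstar (En K n r) (an K) +
    dstar (En K n r) (an K) * dd (En K n r) (cr K) + Kr K n r

variable {K n r}

local notation "hK" => hatK (En K n r) (cr K) (an K)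
local notation "hL" => hatL (En K n r) (cr K) (an K)
local notation "dK" => dd (En K n r) (cr K)
local notation "dS" => dstar (En K n r) (an K)

theorem cm_Kr_of {T : Module.End K (Fk K n r)} (h : ∀ l l', cm T (hL l l') = 0) :
    cm T (Kr K n r) = 0 := by
  simp only [Kr, cm_sum]
  refine Finset.sum_eq_zero fun l _ => Finset.sum_eq_zero fun l' _ => ?_
  split_ifs
  · rw [cm_mul, h, h]; simp
  · simp [cm]

theorem cm_Lp_of {T : Module.End K (Fk K n r)} (h : ∀ l l', cm T (hL l l') = 0)
    (h1 : cm T dK = 0) (h2 : cm T dS = 0) : cm T (Lp K n r) = 0 := by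
  simp [Lp, cm_add, cm_mul, h1, h2, cm_Kr_of h]

theorem cm_Rn_cr (i i' p) : cm (Rn K n r i i') (cr K p) = 0 :=
  cm_eq_zero_iff.2 (lift0_mul_cr K _ _)

theorem cm_Rn_an (i i' p) : cm (Rn K n r i i') (an K p) = 0 :=
  cm_eq_zero_iff.2 (lift0_mul_an K _ _)

theorem cm_Rn_En (c c' i i') : cm (Rn K n r i i') (En K n r c c') = 0 := by
  rw [← cm_skew, cm_En_Rn, neg_zero]

theorem cm_Rn_Lp (i i') : cm (Rn K n r i i') (Lp K n r) = 0 := by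
  apply cm_Lp_of
  · intro l l'
    simp [hatL, ferL, cm_add, cm_sum, cm_mul, cm_Rn_cr, cm_Rn_an, cm_Rn_En]
  · simp [dd, cm_sum, cm_mul, cm_Rn_cr, cm_Rn_En]
  · simp [dstar, cm_sum, cm_mul, cm_Rn_an, cm_Rn_En]

theorem cm_hatK_Lp (k k') : cm (hK k k') (Lp K n r) = 0 :=
  cm_Lp_of (cm_hatK_hatL (kdata K n r) k k') (cm_hatK_dd (kdata K n r) k k')
    (cm_hatK_dstar (kdata K n r) k k')

theorem dd_mul_dd [CharZero K] : dK * dK = 0 := by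
  have h := dd_mul_dd_add (kdata K n r)
  refine LinearMap.ext fun v => ?_
  have := LinearMap.congr_fun h v
  rw [LinearMap.add_apply, ← two_smul K, LinearMap.zero_apply, smul_eq_zero] at this
  simpa using this

theorem cm_dd_Lp [CharZero K] : cm dK (Lp K n r) = 0 := by
  have h : cm dK (Kr K n r) = 0 := cm_Kr_of fun l l' => by
    rw [← cm_skew, cm_hatL_dd (kdata K n r), neg_zero]
  have h2 : dK * dK = 0 := dd_mul_dd
  rw [Lp, cm_add, h, add_zero, cm, mul_add, add_mul, ← mul_assoc, h2, mul_assoc _ dK dK, h2]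
  simp [mul_assoc]

end FockKostant

section FockKostantWeights

variable {K : Type*} [Field K] {n r : ℕ}

local notation "hK" => hatK (En K n r) (cr K) (an K)
local notation "hL" => hatL (En K n r) (cr K) (an K)
local notation "dK" => dd (En K n r) (cr K)
local notation "dS" => dstar (En K n r) (an K)

/-- The exterior contribution to the column weight. -/
def fw (p : Fin n × Fin r) : Fin n ⊕ Fin r → ℤ :=
  Pi.single (.inr p.2) 1 - Pi.single (.inl p.1) 1

/-- The full weight of a monomial: row weight, column weight, exterior degree. -/
def W (x : Σ _ : Finset (Fin n × Fin r), (Fin (n + r) × (Fin n ⊕ Fin r)) →₀ ℕ) :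
    (Fin (n + r) → ℤ) × (Fin n ⊕ Fin r → ℤ) × ℤ :=
  (fun i => ∑ c, (x.2 (i, c) : ℤ), fun c => ∑ i, (x.2 (i, c) : ℤ) + ∑ p ∈ x.1, fw p c, x.1.card)

theorem W_add_single (s : Finset (Fin n × Fin r)) (a) (i : Fin (n + r)) (c : Fin n ⊕ Fin r) :
    W ⟨s, a + Finsupp.single (i, c) 1⟩ = W ⟨s, a⟩ + (Pi.single i 1, Pi.single c 1, 0) := by
  refine Prod.ext ?_ (Prod.ext ?_ ?_)
  · funext j
    by_cases hj : j = i
    · simp [W, Finset.sum_add_distrib, Finsupp.single_apply, hj, Finset.filter_eq]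
    · simp [W, Finset.sum_add_distrib, Finsupp.single_apply, hj, eq_comm (a := i)]
  · funext c'
    by_cases hj : c' = c
    · simp [W, Finset.sum_add_distrib, Finsupp.single_apply, hj, Finset.filter_eq]; ring
    · simp [W, Finset.sum_add_distrib, Finsupp.single_apply, hj, eq_comm (a := c)]
  · simp [W]

theorem W_insert (s : Finset (Fin n × Fin r)) (a) (p : Fin n × Fin r) (hp : p ∉ s) :
    W (n := n) (r := r) ⟨insert p s, a⟩ = W ⟨s, a⟩ + (0, fw p, 1) := by
  refine Prod.ext ?_ (Prod.ext ?_ ?_)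
  · simp [W]
  · funext c'
    simp [W, Finset.sum_insert hp]; ring
  · simp [W, Finset.card_insert_of_notMem hp]

theorem shifts_En (c c' : Fin n ⊕ Fin r) : Shifts (fb K (Fin n × Fin r) _) W (En K n r c c')
    (0, Pi.single c 1 - Pi.single c' 1, 0) :=
  shifts_lift0 fun s => Shifts.sum _ fun i _ => ((shifts_mz (δ := (Pi.single i 1, Pi.single c 1, 0))
    _ fun a => W_add_single s a i c).mul (shifts_pd
      (δ := -(Pi.single i 1, Pi.single c' 1, 0)) _ fun a => by
        rw [W_add_single s a i c', sub_neg_eq_add])).congr (by simp [sub_eq_add_neg])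

theorem shifts_Rn (i i' : Fin (n + r)) : Shifts (fb K (Fin n × Fin r) _) W (Rn K n r i i')
    (Pi.single i 1 - Pi.single i' 1, 0, 0) :=
  shifts_lift0 fun s => Shifts.sum _ fun c _ => ((shifts_mz (δ := (Pi.single i 1, Pi.single c 1, 0))
    _ fun a => W_add_single s a i c).mul (shifts_pd
      (δ := -(Pi.single i' 1, Pi.single c 1, 0)) _ fun a => by
        rw [W_add_single s a i' c, sub_neg_eq_add])).congr (by simp [sub_eq_add_neg])

theorem shifts_W_cr (p : Fin n × Fin r) : Shifts (fb K (Fin n × Fin r) _) W (cr K p) (0, fw p, 1) :=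
  shifts_cr _ fun s a hs => W_insert s a p hs

theorem shifts_W_an (p : Fin n × Fin r) :
    Shifts (fb K (Fin n × Fin r) _) W (an K p) (-(0, fw p, 1)) :=
  shifts_an _ fun s a hs => by rw [W_insert s a p hs, sub_neg_eq_add]

theorem shifts_hatK (k k' : Fin n) : Shifts (fb K (Fin n × Fin r) _) W (hK k k')
    (0, Pi.single (.inl k) 1 - Pi.single (.inl k') 1, 0) :=
  (shifts_En _ _).add (Shifts.neg (Shifts.sum _ fun l _ =>
    ((shifts_W_cr _).mul (shifts_W_an _)).congr (by
      simp only [fw, Prod.neg_mk, Prod.mk_add_mk]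
      refine Prod.ext (by simp) (Prod.ext ?_ (by simp))
      dsimp only
      abel)))

theorem shifts_hatL (l l' : Fin r) : Shifts (fb K (Fin n × Fin r) _) W (hL l l')
    (0, Pi.single (.inr l) 1 - Pi.single (.inr l') 1, 0) :=
  (shifts_En _ _).add (Shifts.sum _ fun k _ =>
    ((shifts_W_cr _).mul (shifts_W_an _)).congr (by
      simp only [fw, Prod.neg_mk, Prod.mk_add_mk]
      refine Prod.ext (by simp) (Prod.ext ?_ (by simp))
      dsimp only
      abel))

theorem shifts_dd : Shifts (fb K (Fin n × Fin r) _) W dK (0, 0, 1) :=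
  Shifts.sum _ fun p _ => ((shifts_En _ _).mul (shifts_W_cr _)).congr (by
      simp only [fw, Prod.mk_add_mk]
      refine Prod.ext (by simp) (Prod.ext ?_ (by simp))
      dsimp only
      abel)

theorem shifts_dstar : Shifts (fb K (Fin n × Fin r) _) W dS (0, 0, -1) :=
  Shifts.sum _ fun p _ => ((shifts_En _ _).mul (shifts_W_an _)).congr (by
      simp only [fw, Prod.neg_mk, Prod.mk_add_mk]
      refine Prod.ext (by simp) (Prod.ext ?_ (by simp))
      dsimp only
      abel)

theorem shifts_Kr : Shifts (fb K (Fin n × Fin r) _) W (Kr K n r) 0 := by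
  refine Shifts.sum _ fun l _ => Shifts.sum _ fun l' _ => ?_
  split_ifs
  · exact ((shifts_hatL _ _).mul (shifts_hatL _ _)).congr (by simp)
  · exact Shifts.zero

theorem shifts_Lp : Shifts (fb K (Fin n × Fin r) _) W (Lp K n r) 0 :=
  (((shifts_dd.mul shifts_dstar).congr (by simp)).add
    ((shifts_dstar.mul shifts_dd).congr (by simp))).add shifts_Kr

theorem coeff_mz_pd_self {σ : Type*} [DecidableEq σ] (c : σ) (f : MvPolynomial σ K) (a : σ →₀ ℕ) :
    coeff a ((mz K c * pd K c) f) = (a c : K) * coeff a f := by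
  rw [Module.End.mul_apply, mz_apply, pd_apply, coeff_X_mul']
  split_ifs with h
  · rw [Finsupp.mem_support_iff] at h
    rw [coeff_pderiv, tsub_add_cancel_of_le (by
      rw [Finsupp.single_le_iff]; exact Nat.one_le_iff_ne_zero.2 h), mul_comm]
    congr 1
    have : ((a - Finsupp.single c 1 : σ →₀ ℕ) c) + 1 = a c := by
      simp; omega
    rw [← this]; push_cast; ring
  · rw [Finsupp.notMem_support_iff] at h
    simp [h]

theorem repr_Rn_self (i : Fin (n + r)) (v : Fk K n r) (x) :
    (fb K _ _).repr (Rn K n r i i v) x = ((W x).1 i : K) * (fb K _ _).repr v x := by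
  simp only [fb_repr, Rn, lift0_apply, LinearMap.sum_apply, coeff_sum, coeff_mz_pd_self, W]
  push_cast
  rw [Finset.sum_mul]

theorem repr_hatK_self (k : Fin n) (v : Fk K n r) (x) :
    (fb K _ _).repr (hK k k v) x = ((W x).2.1 (.inl k) : K) * (fb K _ _).repr v x := by
  obtain ⟨s, a⟩ := x
  have h1 : ∀ l, coeff a ((cr K (k, l) * an K (k, l) : Module.End K (Fk K n r)) v s) =
      (if (k, l) ∈ s then 1 else 0) * coeff a (v s) := by
    intro l
    rw [cr_mul_an_self_apply]
    split_ifs <;> simp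
  have h2 : ∑ p ∈ s, fw p (.inl k) = - ∑ l, if (k, l) ∈ s then (1 : ℤ) else 0 := by
    rw [← Finset.sum_neg_distrib, ← Finset.sum_filter_add_sum_filter_not s (fun p => p.1 = k)]
    rw [Finset.sum_eq_zero (s := s.filter fun p => ¬ p.1 = k) (fun p hp => by
      simp only [Finset.mem_filter] at hp
      simp [fw, Pi.single_apply, eq_comm (a := k), hp.2]), add_zero]
    rw [Finset.sum_congr (g := fun _ => (-1 : ℤ)) rfl (fun p hp => by
      simp only [Finset.mem_filter] at hp
      simp [fw, Pi.single_apply, eq_comm (a := k), hp.2])]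
    rw [show (∑ l, -if (k, l) ∈ s then (1 : ℤ) else 0) = ∑ l with (k, l) ∈ s, (-1 : ℤ) by
      rw [Finset.sum_filter]; exact Finset.sum_congr rfl fun l _ => by split_ifs <;> simp]
    simp only [Finset.sum_const]
    congr 1
    refine Finset.card_bij' (fun p _ => p.2) (fun l _ => (k, l)) ?_ ?_ ?_ ?_ <;> aesop
  simp only [fb_repr, hatK, En, ferK, LinearMap.add_apply, LinearMap.neg_apply, Pi.add_apply,
    Pi.neg_apply, coeff_add, coeff_neg, lift0_apply, LinearMap.sum_apply, Finset.sum_apply,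
    coeff_sum, coeff_mz_pd_self, h1, W, h2]
  push_cast
  rw [← Finset.sum_mul, ← Finset.sum_mul]
  ring

theorem repr_hatL_self (l : Fin r) (v : Fk K n r) (x) :
    (fb K _ _).repr (hL l l v) x = ((W x).2.1 (.inr l) : K) * (fb K _ _).repr v x := by
  obtain ⟨s, a⟩ := x
  have h1 : ∀ k, coeff a ((cr K (k, l) * an K (k, l) : Module.End K (Fk K n r)) v s) =
      (if (k, l) ∈ s then 1 else 0) * coeff a (v s) := by
    intro l
    rw [cr_mul_an_self_apply]
    split_ifs <;> simp
  have h2 : ∑ p ∈ s, fw p (.inr l) = ∑ k, if (k, l) ∈ s then (1 : ℤ) else 0 := by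
    rw [← Finset.sum_filter_add_sum_filter_not s (fun p => p.2 = l)]
    rw [Finset.sum_eq_zero (s := s.filter fun p => ¬ p.2 = l) (fun p hp => by
      simp only [Finset.mem_filter] at hp
      simp [fw, Pi.single_apply, eq_comm (a := l), hp.2]), add_zero]
    rw [Finset.sum_congr (g := fun _ => (1 : ℤ)) rfl (fun p hp => by
      simp only [Finset.mem_filter] at hp
      simp [fw, Pi.single_apply, eq_comm (a := l), hp.2])]
    rw [← Finset.sum_filter]
    simp only [Finset.sum_const]
    congr 1
    refine Finset.card_bij' (fun p _ => p.1) (fun k _ => (k, l)) ?_ ?_ ?_ ?_ <;> aesop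
  simp only [fb_repr, hatL, En, ferL, LinearMap.add_apply, Pi.add_apply,
    coeff_add, lift0_apply, LinearMap.sum_apply, Finset.sum_apply,
    coeff_sum, coeff_mz_pd_self, h1, W, h2]
  push_cast
  rw [← Finset.sum_mul, ← Finset.sum_mul]
  ring

end FockKostantWeights

section BracketArithmetic

theorem sum_lt_sub (N : ℕ) (x : Fin N → ℤ) :
    ∑ i, ∑ j, (if i < j then x i - x j else 0) = ∑ i, x i * ((N : ℤ) - 1 - 2 * i.val) := by
  have h1 : ∀ i j, (if i < j then x i - x j else 0) =
      (if i < j then x i else 0) - if i < j then x j else 0 := by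
    intro i j; split_ifs <;> simp
  simp only [h1, Finset.sum_sub_distrib]
  rw [Finset.sum_comm (f := fun i j => if i < j then x j else 0), ← Finset.sum_sub_distrib]
  refine Finset.sum_congr rfl fun i _ => ?_
  rw [← Finset.sum_filter, ← Finset.sum_filter, Finset.sum_const, Finset.sum_const]
  have h2 : (Finset.univ.filter fun j => i < j).card = N - 1 - i.val := by
    rw [Finset.filter_lt_eq_Ioi, Fin.card_Ioi]
  have h3 : (Finset.univ.filter fun j => j < i).card = i.val := by
    rw [Finset.filter_gt_eq_Iio, Fin.card_Iio]
  rw [h2, h3, nsmul_eq_mul, nsmul_eq_mul]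
  have : ((N - 1 - i.val : ℕ) : ℤ) = (N : ℤ) - 1 - i.val := by have := i.2; omega
  rw [this]; ring

theorem sum_sq_eq_of_bracket {n r : ℕ} (σ : Fin (n + r) → ℤ) (β : Fin n → ℤ) (d : ℤ)
    (htot : ∑ i, σ i = ∑ k, β k + r * d)
    (hb : ∑ i, σ i * σ i + ∑ i, ∑ j, (if i < j then σ i - σ j else 0) -
      (∑ k, β k * β k + ∑ k, ∑ k', if k < k' then β k - β k' else 0) - r * (d * d) -
      r * ∑ k, β k + n * (r * d) = 0) :
    ∑ i : Fin (n + r), (σ i + ((n + r : ℕ) - 1 - i.val)) ^ 2 =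
      ∑ k : Fin n, (β k + ((n + r : ℕ) - 1 - k.val)) ^ 2 +
        ∑ l : Fin r, (d + (r - 1 - l.val)) ^ 2 := by
  rw [sum_lt_sub, sum_lt_sub] at hb
  have e1 : ∑ i : Fin (n + r), (σ i + ((n + r : ℕ) - 1 - i.val)) ^ 2 =
      (∑ i, σ i * σ i + ∑ i, σ i * (((n + r : ℕ) : ℤ) - 1 - 2 * i.val)) +
        ((n + r : ℕ) - 1) * ∑ i, σ i + ∑ i : Fin (n + r), (((n + r : ℕ) : ℤ) - 1 - i.val) ^ 2 := by
    rw [Finset.mul_sum, ← Finset.sum_add_distrib, ← Finset.sum_add_distrib,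
      ← Finset.sum_add_distrib]
    exact Finset.sum_congr rfl fun i _ => by ring
  have e2 : ∑ k : Fin n, (β k + ((n + r : ℕ) - 1 - k.val)) ^ 2 =
      (∑ i, β i * β i + ∑ i, β i * ((n : ℤ) - 1 - 2 * i.val)) +
        ((n + r : ℕ) - 1 + r) * ∑ i, β i + ∑ i : Fin n, (((n + r : ℕ) : ℤ) - 1 - i.val) ^ 2 := by
    rw [Finset.mul_sum, ← Finset.sum_add_distrib, ← Finset.sum_add_distrib,
      ← Finset.sum_add_distrib]
    exact Finset.sum_congr rfl fun i _ => by push_cast; ring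
  have e3 : ∑ l : Fin r, (d + (r - 1 - l.val)) ^ 2 =
      r * (d * d) + r * ((r - 1) * d) + ∑ l : Fin r, ((r : ℤ) - 1 - l.val) ^ 2 := by
    have h0 : ∑ l : Fin r, ((r : ℤ) - 1 - 2 * l.val) = 0 := by
      have := sum_lt_sub r (fun _ => 1)
      simpa using this.symm
    have : ∑ l : Fin r, (d + (r - 1 - l.val)) ^ 2 =
        ∑ l : Fin r, (d * d + (r - 1) * d + d * ((r : ℤ) - 1 - 2 * l.val) +
          ((r : ℤ) - 1 - l.val) ^ 2) := Finset.sum_congr rfl fun i _ => by ring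
    rw [this, Finset.sum_add_distrib, Finset.sum_add_distrib, ← Finset.mul_sum, h0]
    simp; ring
  have e4 : ∑ i : Fin (n + r), (((n + r : ℕ) : ℤ) - 1 - i.val) ^ 2 =
      ∑ i : Fin n, (((n + r : ℕ) : ℤ) - 1 - i.val) ^ 2 + ∑ l : Fin r, ((r : ℤ) - 1 - l.val) ^ 2 := by
    rw [Fin.sum_univ_add]
    congr 1
    refine Finset.sum_congr rfl fun l _ => ?_
    simp only [Fin.val_natAdd]
    push_cast; ring
  rw [e1, e2, e3, e4]
  push_cast at hb htot ⊢
  rw [htot]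
  linear_combination hb

end BracketArithmetic

section FockKostantVanishing

variable {K : Type*} [Field K] {n r : ℕ}

local notation "hK" => hatK (En K n r) (cr K) (an K)
local notation "hL" => hatL (En K n r) (cr K) (an K)
local notation "dK" => dd (En K n r) (cr K)
local notation "dS" => dstar (En K n r) (an K)

/-- A height function on weights, lowered by the raising operators. -/
def wtHeight (w : (Fin (n + r) → ℤ) × (Fin n ⊕ Fin r → ℤ) × ℤ) : ℤ :=
  ∑ i, (i.val : ℤ) * w.1 i + ∑ k : Fin n, (k.val : ℤ) * (w.2.1 (.inl k) + r)

theorem sum_fw_inl (s : Finset (Fin n × Fin r)) (k : Fin n) :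
    ∑ p ∈ s, fw p (.inl k) = - ∑ l, if (k, l) ∈ s then (1 : ℤ) else 0 := by
  have h : ∑ p ∈ s, fw p (.inl k) = ∑ p, if p ∈ s then fw p (.inl k) else 0 := by simp
  rw [h, Fintype.sum_prod_type, Finset.sum_eq_single k, ← Finset.sum_neg_distrib]
  · refine Finset.sum_congr rfl fun l _ => ?_
    simp [fw]; split_ifs <;> simp
  · intro b _ hb
    refine Finset.sum_eq_zero fun l _ => ?_
    simp [fw, Pi.single_apply, hb.symm]
  · simp

theorem sum_fw_inr (s : Finset (Fin n × Fin r)) (l : Fin r) :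
    ∑ p ∈ s, fw p (.inr l) = ∑ k, if (k, l) ∈ s then (1 : ℤ) else 0 := by
  have h : ∑ p ∈ s, fw p (.inr l) = ∑ p, if p ∈ s then fw p (.inr l) else 0 := by simp
  rw [h, Fintype.sum_prod_type]
  refine Finset.sum_congr rfl fun k _ => ?_
  rw [Finset.sum_eq_single l]
  · simp [fw]
  · intro b _ hb
    simp [fw, Pi.single_apply, hb.symm]
  · simp

theorem wtHeight_nonneg (x) : 0 ≤ wtHeight (W (n := n) (r := r) x) := by
  obtain ⟨s, a⟩ := x
  refine add_nonneg (Finset.sum_nonneg fun i _ => mul_nonneg (by positivity)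
    ?_) (Finset.sum_nonneg fun k _ =>
      mul_nonneg (by positivity) ?_)
  · simp only [W]; positivity
  simp only [W, sum_fw_inl]
  have h1 : 0 ≤ ∑ i, (a (i, Sum.inl k) : ℤ) := Finset.sum_nonneg fun c _ => by positivity
  have h2 : (∑ l : Fin r, if (k, l) ∈ s then (1 : ℤ) else 0) ≤ r := by
    calc _ ≤ ∑ l : Fin r, (1 : ℤ) := Finset.sum_le_sum fun l _ => by split_ifs <;> simp
      _ = r := by simp
  linarith

theorem wtHeight_add_row (w) (i i' : Fin (n + r)) : wtHeight (n := n) (r := r)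
    (w + (Pi.single i 1 - Pi.single i' 1, 0, 0)) = wtHeight w + (i.val - i'.val) := by
  simp [wtHeight, mul_add, mul_sub, Finset.sum_add_distrib, Finset.sum_sub_distrib,
    Pi.single_apply]
  ring

theorem wtHeight_add_col (w) (i i' : Fin n) : wtHeight (n := n) (r := r)
    (w + (0, Pi.single (.inl i) 1 - Pi.single (.inl i') 1, 0)) = wtHeight w + (i.val - i'.val) := by
  simp [wtHeight, mul_add, mul_sub, Finset.sum_add_distrib, Finset.sum_sub_distrib,
    Pi.single_apply]
  ring

theorem sum_W_col (x) : ∑ c, (W (n := n) (r := r) x).2.1 c = ∑ i, (W x).1 i := by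
  obtain ⟨s, a⟩ := x
  have h : ∀ p : Fin n × Fin r, ∑ c, fw p c = 0 := fun p => by simp [fw]
  simp only [W, Finset.sum_add_distrib]
  rw [Finset.sum_comm (s := Finset.univ) (t := s)]
  simp only [h, Finset.sum_const_zero, add_zero]
  exact Finset.sum_comm

theorem eq_zero_of_repr_eq_zero {v : Fk K n r} (h : ∀ x, (fb K _ _).repr v x = 0) : v = 0 :=
  (fb K _ _).repr.injective (by ext x; simp [h x])

theorem apply_eq_smul_of_repr {T : Module.End K (Fk K n r)} {v : Fk K n r} (c : K)
    (h : ∀ x, (fb K _ _).repr v x ≠ 0 → (fb K _ _).repr (T v) x = c * (fb K _ _).repr v x)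
    (h0 : ∀ x, (fb K _ _).repr v x = 0 → (fb K _ _).repr (T v) x = 0) : T v = c • v := by
  apply (fb K _ _).repr.injective
  ext x
  rw [map_smul, Finsupp.smul_apply, smul_eq_mul]
  by_cases hx : (fb K _ _).repr v x = 0
  · rw [h0 x hx, hx, mul_zero]
  · exact h x hx

/-- `v` is homogeneous of weight `w`. -/
def IsWt (w : (Fin (n + r) → ℤ) × (Fin n ⊕ Fin r → ℤ) × ℤ) (v : Fk K n r) : Prop :=
  ∀ x, (fb K _ _).repr v x ≠ 0 → W x = w

theorem IsWt.Rn_self {w v} (h : IsWt (K := K) (n := n) (r := r) w v) (i) :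
    Rn K n r i i v = (w.1 i : K) • v :=
  apply_eq_smul_of_repr _ (fun x hx => by rw [repr_Rn_self, h x hx])
    (fun x hx => by rw [repr_Rn_self, hx, mul_zero])

theorem IsWt.hatK_self {w v} (h : IsWt (K := K) (n := n) (r := r) w v) (k) :
    hK k k v = (w.2.1 (.inl k) : K) • v :=
  apply_eq_smul_of_repr _ (fun x hx => by rw [repr_hatK_self, h x hx])
    (fun x hx => by rw [repr_hatK_self, hx, mul_zero])

theorem IsWt.hatL_self {w v} (h : IsWt (K := K) (n := n) (r := r) w v) (l) :
    hL l l v = (w.2.1 (.inr l) : K) • v :=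
  apply_eq_smul_of_repr _ (fun x hx => by rw [repr_hatL_self, h x hx])
    (fun x hx => by rw [repr_hatL_self, hx, mul_zero])

theorem IsWt.shift {w v δ} {T : Module.End K (Fk K n r)} (h : IsWt w v)
    (hT : Shifts (fb K _ _) W T δ) : IsWt (w + δ) (T v) := by
  intro y hy
  obtain ⟨x, hx, e⟩ := hT v y hy
  rw [e, h x hx]

theorem IsGl.casimir_apply {N : ℕ} {u : Fin N → Fin N → Module.End K (Fk K n r)} (hu : IsGl u)
    (a : Fin N → ℤ) (v : Fk K n r) (ha : ∀ i, u i i v = (a i : K) • v) :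
    (∑ p, ∑ q, u p q * u q p) v =
      ((∑ p, a p * a p + ∑ p, ∑ q, if p < q then a p - a q else 0 : ℤ) : K) • v +
        (2 : K) • (∑ p, ∑ q, if p < q then u q p * u p q else 0) v := by
  rw [hu.casimir]
  have h1 : (∑ p, u p p * u p p) v = ((∑ p, a p * a p : ℤ) : K) • v := by
    rw [LinearMap.sum_apply]
    push_cast
    rw [Finset.sum_smul]
    refine Finset.sum_congr rfl fun p _ => ?_
    rw [Module.End.mul_apply, ha, map_smul, ha, smul_smul]
  have h2 : (∑ p, ∑ q, if p < q then 2 * (u q p * u p q) + (u p p - u q q) else 0) v =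
      ((∑ p, ∑ q, if p < q then a p - a q else 0 : ℤ) : K) • v +
        (2 : K) • (∑ p, ∑ q, if p < q then u q p * u p q else 0) v := by
    simp only [LinearMap.sum_apply]
    push_cast
    simp only [Finset.sum_smul, Finset.smul_sum, ← Finset.sum_add_distrib]
    refine Finset.sum_congr rfl fun p _ => Finset.sum_congr rfl fun q _ => ?_
    split_ifs
    · rw [LinearMap.add_apply, LinearMap.sub_apply, ha, ha, two_mul, LinearMap.add_apply, two_smul]
      rw [sub_smul, add_comm]
    · simp
  rw [LinearMap.add_apply, h1, h2]
  push_cast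
  rw [add_smul, add_assoc]

theorem two_smul_Lp_apply {w} {v : Fk K n r} (h : IsWt w v) (d : ℤ) (hd : ∀ l, w.2.1 (.inr l) = d)
    (hR : ∀ i i', i < i' → Rn K n r i i' v = 0) (hKv : ∀ k k', k < k' → hK k k' v = 0) :
    (2 : K) • Lp K n r v = ((∑ i, w.1 i * w.1 i + ∑ i, ∑ j, (if i < j then w.1 i - w.1 j else 0) -
      (∑ k, w.2.1 (.inl k) * w.2.1 (.inl k) +
        ∑ k, ∑ k', if k < k' then w.2.1 (.inl k) - w.2.1 (.inl k') else 0) - r * (d * d) -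
      r * ∑ k, w.2.1 (.inl k) + n * (r * d) : ℤ) : K) • v := by
  have e := LinearMap.congr_fun (laplacian_identity (kdata K n r)) v
  rw [casimir_En_eq] at e
  simp only [LinearMap.add_apply, LinearMap.sub_apply] at e
  rw [(isGl_Rn K n r).casimir_apply w.1 v h.Rn_self,
    (isGl_hatK (kdata K n r)).casimir_apply _ v h.hatK_self,
    (isGl_hatL (kdata K n r)).casimir_apply _ v h.hatL_self] at e
  have z1 : (∑ p, ∑ q, if p < q then Rn K n r q p * Rn K n r p q else 0) v = 0 := by
    simp only [LinearMap.sum_apply]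
    refine Finset.sum_eq_zero fun p _ => Finset.sum_eq_zero fun q _ => ?_
    split_ifs with hpq
    · rw [Module.End.mul_apply, hR p q hpq, map_zero]
    · rfl
  have z2 : (∑ p, ∑ q, if p < q then hK q p * hK p q else 0) v = 0 := by
    simp only [LinearMap.sum_apply]
    refine Finset.sum_eq_zero fun p _ => Finset.sum_eq_zero fun q _ => ?_
    split_ifs with hpq
    · rw [Module.End.mul_apply, hKv p q hpq, map_zero]
    · rfl
  have z3 : (∑ p, ∑ q, if p < q then hL q p * hL p q else 0) v = Kr K n r v := rfl
  have z4 : (∑ k, hK k k) v = ((∑ k, w.2.1 (.inl k) : ℤ) : K) • v := by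
    push_cast
    simp [LinearMap.sum_apply, Finset.sum_smul, h.hatK_self]
  have z5 : (∑ k, hL k k) v = ((r * d : ℤ) : K) • v := by
    simp [LinearMap.sum_apply, h.hatL_self, hd, ← smul_assoc]
  rw [z1, z2, z3, LinearMap.smul_apply, LinearMap.smul_apply, z4, z5, smul_zero, two_mul,
    LinearMap.add_apply] at e
  simp only [hd] at e
  simp only [Fintype.card_fin, ← Nat.cast_smul_eq_nsmul K, smul_smul] at e
  rw [Lp, LinearMap.add_apply, smul_add, two_smul K ((dK * dS + dS * dK) v), e]
  simp
  module

theorem isWt_zero_of_height {w} {v : Fk K n r} (h : IsWt w v) (hw : wtHeight w < 0) : v = 0 := by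
  refine eq_zero_of_repr_eq_zero fun x => ?_
  by_contra hx
  have := wtHeight_nonneg x
  rw [h x hx] at this
  omega

variable [CharZero K]

theorem eq_zero_of_Lp_of_isWt (d : ℤ) (i : ℕ) (hi : ¬ ∃ t ≤ n, i = t * r) (N : ℕ) :
    ∀ w, wtHeight w < N → (∀ l, w.2.1 (.inr l) = d) → w.2.2 = i →
      ∀ v : Fk K n r, IsWt w v → Lp K n r v = 0 → v = 0 := by
  induction N with
  | zero => exact fun w hw _ _ v hv _ => isWt_zero_of_height hv (by simpa using hw)
  | succ N ih =>
    intro w hw hwd hwi v hv hLv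
    have hR : ∀ i i', i < i' → Rn K n r i i' v = 0 := by
      intro i i' hii
      refine ih _ ?_ ?_ ?_ _ (hv.shift (shifts_Rn i i')) ?_
      · rw [wtHeight_add_row]
        have : i.val < i'.val := hii
        push_cast at hw ⊢
        omega
      · simpa using hwd
      · simpa using hwi
      · have := LinearMap.congr_fun (cm_eq_zero_iff.1 (cm_Rn_Lp (K := K) (n := n) (r := r) i i')) v
        rw [Module.End.mul_apply, Module.End.mul_apply, hLv, map_zero] at this
        exact this.symm
    have hKv : ∀ k k', k < k' → hK k k' v = 0 := by
      intro i i' hii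
      refine ih _ ?_ ?_ ?_ _ (hv.shift (shifts_hatK i i')) ?_
      · rw [wtHeight_add_col]
        have : i.val < i'.val := hii
        push_cast at hw ⊢
        omega
      · simpa using hwd
      · simpa using hwi
      · have := LinearMap.congr_fun (cm_eq_zero_iff.1 (cm_hatK_Lp (K := K) (n := n) (r := r) i i')) v
        rw [Module.End.mul_apply, Module.End.mul_apply, hLv, map_zero] at this
        exact this.symm
    by_contra hv0
    have hb := two_smul_Lp_apply hv d hwd hR hKv
    rw [hLv, smul_zero, eq_comm, smul_eq_zero, or_iff_left hv0, Int.cast_eq_zero] at hb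
    obtain ⟨s, hs⟩ : ∃ s, v s ≠ 0 := by
      by_contra! h
      exact hv0 (funext h)
    have hcoef : ∀ a, coeff a (v s) ≠ 0 → W ⟨s, a⟩ = w := fun a ha => hv _ (by rwa [fb_repr])
    obtain ⟨a₀, ha₀⟩ := exists_coeff_ne_zero hs
    have hw0 := hcoef a₀ ha₀
    have htotw : ∑ c, w.2.1 c = ∑ i, w.1 i := by rw [← hw0]; exact sum_W_col _
    have htot : ∑ i, w.1 i = ∑ k, w.2.1 (.inl k) + r * d := by
      rw [← htotw, Fintype.sum_sum_type]
      simp [hwd]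
    have hcard : (s.card : ℤ) = i := by rw [← hwi, ← hw0]; rfl
    suffices h : ∃ t ≤ n, s.card = t * r by
      obtain ⟨t, ht, e⟩ := h
      exact hi ⟨t, ht, by rw [← e]; exact_mod_cast hcard.symm⟩
    refine card_eq_mul_of_weights s w.1 (fun k => w.2.1 (.inl k)) d
      (fun c => w.2.1 c - ∑ p ∈ s, fw p c) (fun k => by rw [sum_fw_inl, sub_neg_eq_add])
      (fun l => by rw [sum_fw_inr, hwd]) (fun B => ?_) ?_ (sum_sq_eq_of_bracket _ _ d htot hb)
    · refine majorization (v s) hs (fun i i' hii => ?_) _ _ (fun a ha i => ?_) (fun a ha c => ?_) B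
      · exact congrFun (hR i i' hii) s
      · rw [← hcoef a ha]; rfl
      · rw [← hcoef a ha]; simp [W]
    · rw [Finset.sum_sub_distrib, htotw, Finset.sum_comm]
      simp [fw]

/-- Homogeneous in exterior degree `i`, and of degree `d` in each of the last columns. -/
def InF (i : ℕ) (d : ℤ) (v : Fk K n r) : Prop :=
  ∀ x, (fb K _ _).repr v x ≠ 0 → (∀ l, (W x).2.1 (.inr l) = d) ∧ (W x).2.2 = i

theorem eq_zero_of_Lp (d : ℤ) (i : ℕ) (hi : ¬ ∃ t ≤ n, i = t * r) (v : Fk K n r)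
    (hv : InF i d v) (hLv : Lp K n r v = 0) : v = 0 := by
  refine eq_zero_of_repr_eq_zero fun x => ?_
  by_contra hx
  obtain ⟨v₁, v₂, hs, h1, h2, h3⟩ := exists_split (fb K _ _) (fun y => W y = W x) v
  have hLv₁ := shifts_Lp.eq_zero_of_split (W x) hs (fun y hy => (h1 y hy).2) h2 hLv
  have := eq_zero_of_Lp_of_isWt d i hi ((wtHeight (W x)).toNat + 1) (W x)
    (by have := Int.self_le_toNat (wtHeight (W x)); push_cast; omega) (hv x hx).1 (hv x hx).2 v₁
    (fun y hy => (h1 y hy).2) hLv₁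
  rw [← h3 x rfl, this] at hx
  simp at hx

/-- Elements with bounded support of weights, as a submodule. -/
def boundedF (i : ℕ) (d : ℤ) (D : ℤ) : Submodule K (Fk K n r) where
  carrier := {v | ∀ x, (fb K _ _).repr v x ≠ 0 →
    (∀ l, (W x).2.1 (.inr l) = d) ∧ (W x).2.2 = i ∧ ∑ j, (W x).1 j ≤ D}
  zero_mem' := fun x hx => by simp at hx
  add_mem' := by
    intro v v' h h' x hx
    by_cases h1 : (fb K _ _).repr v x = 0
    · refine h' x fun h2 => hx ?_
      rw [map_add, Finsupp.add_apply, h1, h2, add_zero]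
    · exact h x h1
  smul_mem' := by
    intro c v h x hx
    refine h x fun h1 => hx ?_
    rw [map_smul, Finsupp.smul_apply, h1, smul_zero]

theorem finite_setOf_W_row_sum_le (D : ℤ) :
    {x | ∑ j, (W (n := n) (r := r) x).1 j ≤ D}.Finite := by
  have hfin : {a : (Fin (n + r) × (Fin n ⊕ Fin r)) →₀ ℕ | a ≤ Finsupp.equivFunOnFinite.symm
    fun _ => D.toNat}.Finite := Set.finite_Iic _
  refine (Set.finite_iUnion fun s : Finset (Fin n × Fin r) => hfin.image (Sigma.mk s)).subset ?_
  rintro ⟨s, a⟩ hx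
  refine Set.mem_iUnion.2 ⟨s, a, fun p => ?_, rfl⟩
  have h1 : ∑ p, (a p : ℤ) ≤ D := by
    rw [Fintype.sum_prod_type]; exact hx
  have h2 : (a p : ℤ) ≤ ∑ p, (a p : ℤ) :=
    Finset.single_le_sum (f := fun p => (a p : ℤ)) (fun _ _ => by positivity) (Finset.mem_univ p)
  change a p ≤ D.toNat
  omega

instance finite_boundedF (i : ℕ) (d D : ℤ) : Module.Finite K (boundedF (K := K) (n := n) (r := r) i d D) := by
  have h : boundedF (K := K) (n := n) (r := r) i d D ≤
      Submodule.span K ((fb K _ _) '' {x | ∑ j, (W (n := n) (r := r) x).1 j ≤ D}) := by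
    intro v hv
    rw [Module.Basis.mem_span_image]
    intro x hx
    exact (hv x (by simpa using hx)).2.2
  have : Module.Finite K (Submodule.span K
      ((fb K (Fin n × Fin r) _) '' {x | ∑ j, (W (n := n) (r := r) x).1 j ≤ D})) :=
    Module.Finite.span_of_finite K ((finite_setOf_W_row_sum_le D).image _)
  exact Submodule.finiteDimensional_of_le h

/-- The vanishing theorem: a `dd`-closed element of `InF` whose image under `Kr` is exact,
is itself exact, unless its degree is a multiple of `r`. -/
theorem exists_dd_eq (d : ℤ) (i : ℕ) (hi : ¬ ∃ t ≤ n, i = t * r) (g h : Fk K n r)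
    (hg : InF i d g) (hdg : dK g = 0) (hKg : Kr K n r g = dK h) : ∃ u, dK u = g := by
  obtain ⟨D, hD⟩ : ∃ D : ℤ, ∀ x, (fb K _ _).repr g x ≠ 0 → ∑ j, (W x).1 j ≤ D := by
    have := ((fb K (Fin n × Fin r) _).repr g).support.finite_toSet.image
      (fun x => ∑ j, (W (n := n) (r := r) x).1 j)
    obtain ⟨D, hD⟩ := this.bddAbove
    exact ⟨D, fun x hx => hD ⟨x, by simpa using hx, rfl⟩⟩
  set F : Submodule K (Fk K n r) := boundedF i d D ⊓ LinearMap.range dK with hF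
  have hFfin : Module.Finite K F := Submodule.finiteDimensional_of_le (inf_le_left (a := boundedF i d D))
  have hst : ∀ v ∈ boundedF (K := K) (n := n) (r := r) i d D, Lp K n r v ∈ boundedF i d D := by
    intro v hv y hy
    obtain ⟨x, hx, e⟩ := shifts_Lp v y hy
    rw [e, add_zero]
    exact hv x hx
  have hLF : ∀ v ∈ F, Lp K n r v ∈ F := by
    rintro v ⟨hv1, u, rfl⟩
    refine ⟨hst _ hv1, Lp K n r u, ?_⟩
    exact LinearMap.congr_fun (cm_eq_zero_iff.1 cm_dd_Lp) u
  have hinj : Function.Injective ((Lp K n r).restrict hLF) := by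
    rw [← LinearMap.ker_eq_bot, LinearMap.ker_eq_bot']
    rintro ⟨v, hv⟩ hv0
    have : v = 0 := eq_zero_of_Lp d i hi v (fun x hx => ⟨(hv.1 x hx).1, (hv.1 x hx).2.1⟩)
      (congrArg Subtype.val hv0)
    exact Subtype.ext this
  have hsurj := LinearMap.injective_iff_surjective.1 hinj
  have hgb : g ∈ boundedF i d D := fun x hx => ⟨(hg x hx).1, (hg x hx).2, hD x hx⟩
  have hLg : Lp K n r g ∈ F := by
    refine ⟨hst g hgb, dS g + h, ?_⟩
    rw [map_add, ← hKg, Lp]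
    simp [hdg]
  obtain ⟨⟨b, hb1, u, hu⟩, hb⟩ := hsurj ⟨_, hLg⟩
  have hb' : Lp K n r b = Lp K n r g := congrArg Subtype.val hb
  have : b - g = 0 := eq_zero_of_Lp d i hi _ (fun x hx => by
    have := (sub_mem hb1 hgb) x hx
    exact ⟨this.1, this.2.1⟩) (by rw [map_sub, hb', sub_self])
  exact ⟨u, by rw [hu]; exact sub_eq_zero.1 this⟩

end FockKostantVanishing

section WeightOrder

universe u

/-- A monomial order with a weight put in front. -/
noncomputable def weightHom {σ : Type u} (m₀ : MonomialOrder.{u, u} σ) (ω : σ → ℕ) :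
    (σ →₀ ℕ) →+ Lex (ℕ × m₀.syn) where
  toFun a := toLex (Finsupp.weight ω a, m₀.toSyn a)
  map_zero' := by simp
  map_add' a b := by simp only [map_add]; rfl

theorem weightHom_injective {σ : Type u} (m₀ : MonomialOrder.{u, u} σ) (ω : σ → ℕ) :
    Function.Injective (weightHom m₀ ω) := fun _ _ hab =>
  m₀.toSyn.injective (congrArg (fun x => (ofLex x).2) hab)

/-- The exponents are isomorphic to the image of `weightHom`. -/
noncomputable def weightEquiv {σ : Type u} (m₀ : MonomialOrder.{u, u} σ) (ω : σ → ℕ) :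
    (σ →₀ ℕ) ≃+ AddMonoidHom.mrange (weightHom m₀ ω) :=
  AddEquiv.ofBijective (weightHom m₀ ω).mrangeRestrict
    ⟨fun _ _ hab => weightHom_injective m₀ ω (congrArg Subtype.val hab),
      (weightHom m₀ ω).mrangeRestrict_surjective⟩

/-- The monomial order refining a given one by a weight. -/
noncomputable def weightOrder {σ : Type u} (m₀ : MonomialOrder.{u, u} σ) (ω : σ → ℕ) :
    MonomialOrder.{u, u} σ where
  syn := AddMonoidHom.mrange (weightHom m₀ ω)
  toSyn := weightEquiv m₀ ω
  toSyn_monotone := by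
    intro a b hab
    change weightHom m₀ ω a ≤ weightHom m₀ ω b
    refine Prod.Lex.toLex_le_toLex.2 ?_
    have h1 : Finsupp.weight ω a ≤ Finsupp.weight ω b := by
      rw [← add_tsub_cancel_of_le hab, map_add]
      exact Nat.le_add_right _ _
    rcases h1.lt_or_eq with h1 | h1
    · exact Or.inl h1
    · exact Or.inr ⟨h1, m₀.toSyn_monotone hab⟩

/-- A monomial order refining the order by a weight. -/
theorem exists_monomialOrder_weight {σ : Type u} [Finite σ] (ω : σ → ℕ) :
    ∃ m : MonomialOrder.{u, u} σ, ∀ a b : σ →₀ ℕ,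
      Finsupp.weight ω a < Finsupp.weight ω b → m.toSyn a < m.toSyn b := by
  obtain ⟨m₀⟩ : Nonempty (MonomialOrder.{u, u} σ) := by
    obtain ⟨N, ⟨e⟩⟩ := Finite.exists_equiv_fin σ
    let _ : LinearOrder σ := LinearOrder.lift' e e.injective
    have : WellFoundedGT σ := Finite.to_wellFoundedGT
    exact ⟨MonomialOrder.lex⟩
  refine ⟨weightOrder m₀ ω, fun a b hab => ?_⟩
  change weightHom m₀ ω a < weightHom m₀ ω b
  exact Prod.Lex.toLex_lt_toLex.2 (Or.inl hab)

theorem degree_eq_of_weight {σ R : Type*} [CommRing R] (m : MonomialOrder σ) (ω : σ → ℕ)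
    (hm : ∀ a b : σ →₀ ℕ, Finsupp.weight ω a < Finsupp.weight ω b → m.toSyn a < m.toSyn b)
    (f : MvPolynomial σ R) (e : σ →₀ ℕ) (he : coeff e f ≠ 0)
    (hf : ∀ b, coeff b f ≠ 0 → b = e ∨ Finsupp.weight ω b < Finsupp.weight ω e) :
    m.degree f = e := by
  apply m.toSyn.injective
  refine le_antisymm (m.degree_le_iff.2 fun c hc => ?_) (m.le_degree (mem_support_iff.2 he))
  rcases hf c (mem_support_iff.1 hc) with rfl | h
  · exact le_rfl
  · exact (hm _ _ h).le

end WeightOrder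

section CoprimeLeading

variable {σ ι K : Type*} [Field K] (m : MonomialOrder σ) (f : ι → MvPolynomial σ K)

theorem le_of_le_add_of_disjoint {a b c : σ →₀ ℕ} (h : a ≤ b + c) (hd : Disjoint a.support c.support) :
    a ≤ b := by
  intro x
  by_cases hx : x ∈ a.support
  · have hc : c x = 0 := by
      rw [← Finsupp.notMem_support_iff]
      exact Finset.disjoint_left.1 hd hx
    have := h x
    rw [Finsupp.add_apply, hc, add_zero] at this
    exact this
  · rw [Finsupp.notMem_support_iff] at hx
    rw [hx]; exact Nat.zero_le _

theorem exists_reduced (hf : ∀ i, f i ≠ 0) (U : Set ι) (g : MvPolynomial σ K) :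
    ∃ g', g - g' ∈ Ideal.span (f '' U) ∧ (g' = 0 ∨ ∀ i ∈ U, ¬ m.degree (f i) ≤ m.degree g') := by
  obtain ⟨c, r, h1, -, h3⟩ := m.div_set (B := f '' U) (by
    rintro _ ⟨i, -, rfl⟩
    exact (m.leadingCoeff_ne_zero_iff.2 (hf i)).isUnit) g
  refine ⟨r, ?_, ?_⟩
  · rw [h1, add_sub_cancel_right, Finsupp.linearCombination_apply]
    exact Submodule.sum_mem _ fun b _ => Ideal.mul_mem_left _ _ (Ideal.subset_span b.2)
  · by_cases hr : r = 0
    · exact Or.inl hr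
    · exact Or.inr fun i hi => h3 _ (m.degree_mem_support hr) _ ⟨i, hi, rfl⟩

theorem exists_degree_le_of_mem_span
    (hd : ∀ i j, i ≠ j → Disjoint (m.degree (f i)).support (m.degree (f j)).support)
    [DecidableEq ι] (hf : ∀ i, f i ≠ 0) (U : Finset ι) :
    ∀ h ∈ Ideal.span (f '' (U : Set ι)), h ≠ 0 → ∃ i ∈ U, m.degree (f i) ≤ m.degree h := by
  induction U using Finset.induction_on with
  | empty => intro h hh h0; simp at hh; exact absurd hh h0
  | insert t U ht ih =>
    intro h hh h0
    rw [Finset.coe_insert, Set.image_insert_eq, Ideal.mem_span_insert] at hh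
    obtain ⟨g₀, z, hz, e₀⟩ := hh
    obtain ⟨g, hg, hred⟩ := exists_reduced m f hf (U : Set ι) g₀
    obtain ⟨h', hh', e⟩ : ∃ h' ∈ Ideal.span (f '' (U : Set ι)), h = g * f t + h' := by
      refine ⟨(g₀ - g) * f t + z, add_mem (Ideal.mul_mem_right _ _ hg) hz, ?_⟩
      rw [e₀]; ring
    clear e₀ hz hg
    by_cases hg0 : g = 0
    · subst hg0
      rw [zero_mul, zero_add] at e
      obtain ⟨i, hi, hle⟩ := ih h (e ▸ hh') h0
      exact ⟨i, by simp [hi], hle⟩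
    replace hred := hred.resolve_left hg0
    have hdeg : m.degree (g * f t) = m.degree g + m.degree (f t) := m.degree_mul hg0 (hf t)
    by_cases hh0 : h' = 0
    · subst hh0
      rw [add_zero] at e
      refine ⟨t, by simp, ?_⟩
      rw [e, hdeg]; exact le_add_self
    obtain ⟨i, hi, hle⟩ := ih h' hh' hh0
    by_cases hne : m.degree (g * f t) = m.degree h'
    · refine absurd (le_of_le_add_of_disjoint (c := m.degree (f t)) ?_ (hd i t ?_)) (hred i hi)
      · rw [← hdeg, hne]; exact hle
      · rintro rfl; exact ht hi
    · have := m.degree_add_of_ne hne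
      rw [← e] at this
      rcases le_total (m.toSyn (m.degree (g * f t))) (m.toSyn (m.degree h')) with hl | hl
      · rw [sup_eq_right.2 hl] at this
        exact ⟨i, by simp [hi], by rw [m.toSyn.injective this]; exact hle⟩
      · rw [sup_eq_left.2 hl] at this
        refine ⟨t, by simp, ?_⟩
        rw [m.toSyn.injective this, hdeg]; exact le_add_self

/-- Polynomials with pairwise coprime leading monomials form a regular sequence. -/
theorem mem_span_of_mul_mem_span
    (hd : ∀ i j, i ≠ j → Disjoint (m.degree (f i)).support (m.degree (f j)).support)
    (hf : ∀ i, f i ≠ 0) (U : Finset ι) (a : ι) (ha : a ∉ U)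
    (g : MvPolynomial σ K) (hg : f a * g ∈ Ideal.span (f '' (U : Set ι))) :
    g ∈ Ideal.span (f '' (U : Set ι)) := by
  classical
  obtain ⟨g', h1, h2⟩ := exists_reduced m f hf (U : Set ι) g
  rcases h2 with rfl | h2
  · simpa using h1
  by_cases hg' : g' = 0
  · subst hg'; simpa using h1
  have h3 : f a * g' ∈ Ideal.span (f '' (U : Set ι)) := by
    have : f a * g' = f a * g - f a * (g - g') := by ring
    rw [this]
    exact sub_mem hg (Ideal.mul_mem_left _ _ h1)
  obtain ⟨i, hi, hle⟩ := exists_degree_le_of_mem_span m f hd hf U _ h3 (mul_ne_zero (hf a) hg')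
  rw [m.degree_mul (hf a) hg', add_comm] at hle
  exact absurd (le_of_le_add_of_disjoint hle (hd i a (by rintro rfl; exact ha hi))) (h2 i hi)

end CoprimeLeading

section LeadingMonomials

theorem degree_det_X {σ R : Type*} [CommRing R] [Nontrivial R] (m : MonomialOrder σ) (ω : σ → ℕ)
    (hm : ∀ a b : σ →₀ ℕ, Finsupp.weight ω a < Finsupp.weight ω b → m.toSyn a < m.toSyn b)
    {n : ℕ} (v : Fin n → Fin n → σ)
    (hω : ∀ π : Equiv.Perm (Fin n), π ≠ 1 → ∑ k, ω (v (π k) k) < ∑ k, ω (v k k)) :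
    m.degree (Matrix.det (Matrix.of fun i j => (X (v i j) : MvPolynomial σ R))) =
      ∑ k, Finsupp.single (v k k) 1 := by
  classical
  set E : Equiv.Perm (Fin n) → (σ →₀ ℕ) := fun π => ∑ k, Finsupp.single (v (π k) k) 1 with hE
  have hdet : Matrix.det (Matrix.of fun i j => (X (v i j) : MvPolynomial σ R)) =
      ∑ π : Equiv.Perm (Fin n), monomial (E π) (((Equiv.Perm.sign π : ℤ) : R)) := by
    rw [Matrix.det_apply']
    refine Finset.sum_congr rfl fun π _ => ?_
    have : ∏ i, (Matrix.of fun i j => (X (v i j) : MvPolynomial σ R)) (π i) i =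
        monomial (E π) 1 := by
      simp only [Matrix.of_apply, X, hE]
      rw [← monomial_sum_one]
    rw [this]
    rw [← map_intCast (C : R →+* MvPolynomial σ R), C_mul_monomial, mul_one]
  have hw : ∀ π, Finsupp.weight ω (E π) = ∑ k, ω (v (π k) k) := fun π => by
    simp [hE, map_sum, Finsupp.weight_single]
  have hcoef : ∀ b, coeff b (Matrix.det (Matrix.of fun i j => (X (v i j) : MvPolynomial σ R))) =
      ∑ π : Equiv.Perm (Fin n), if E π = b then (((Equiv.Perm.sign π : ℤ) : R)) else 0 := by
    intro b
    rw [hdet, coeff_sum]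
    simp only [coeff_monomial]
  refine degree_eq_of_weight m ω hm _ _ ?_ ?_
  · rw [hcoef, Finset.sum_eq_single 1]
    · simp [hE]
    · intro π _ hπ
      rw [if_neg]
      intro h
      have := hω π hπ
      rw [← hw, h] at this
      simp [map_sum, Finsupp.weight_single] at this
    · simp
  · intro b hb
    rw [hcoef] at hb
    obtain ⟨π, -, hπ⟩ := Finset.exists_ne_zero_of_sum_ne_zero hb
    have hb' : E π = b := by
      by_contra h
      rw [if_neg h] at hπ
      exact hπ rfl
    by_cases h1 : π = 1
    · left; rw [← hb', h1]; simp [hE]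
    · right
      rw [← hb', hw]
      simpa [map_sum, Finsupp.weight_single] using hω π h1

theorem sum_sub_sq_pos {n : ℕ} (π : Equiv.Perm (Fin n)) (h : π ≠ 1) :
    0 < ∑ k, (((π k).val : ℤ) - k.val) ^ 2 := by
  refine (Finset.sum_nonneg fun k _ => sq_nonneg _).lt_of_ne fun h0 => h ?_
  ext k
  have := (Finset.sum_eq_zero_iff_of_nonneg (fun k _ => sq_nonneg _)).1 h0.symm k (Finset.mem_univ k)
  have := pow_eq_zero_iff (two_ne_zero) |>.1 this
  simp; omega

/-- Leading monomial of a minor on consecutive rows. -/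
theorem sum_weight_lt {n : ℕ} (c C₀ : ℕ) (w : Fin n → Fin n → ℕ)
    (hw : ∀ i k, (w i k : ℤ) = C₀ - ((i.val : ℤ) + c - k.val) ^ 2)
    (π : Equiv.Perm (Fin n)) (h : π ≠ 1) : ∑ k, w (π k) k < ∑ k, w k k := by
  have h1 := sum_sub_sq_pos π h
  have h2 : ∑ k, ((π k).val : ℤ) = ∑ k : Fin n, (k.val : ℤ) :=
    Equiv.sum_comp π fun k => (k.val : ℤ)
  zify
  simp only [hw]
  rw [← sub_pos, ← Finset.sum_sub_distrib]
  have h3 : ∑ k : Fin n, ((C₀ - ((k.val : ℤ) + c - k.val) ^ 2) -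
      (C₀ - (((π k).val : ℤ) + c - k.val) ^ 2)) = ∑ k, (((π k).val : ℤ) - k.val) ^ 2 +
      2 * c * (∑ k, ((π k).val : ℤ) - ∑ k : Fin n, (k.val : ℤ)) := by
    rw [← Finset.sum_sub_distrib, Finset.mul_sum, ← Finset.sum_add_distrib]
    exact Finset.sum_congr rfl fun k _ => by ring
  rw [h3, h2]
  simpa using h1

end LeadingMonomials

section StrongRegular

/-- A family each of whose members is a nonzerodivisor modulo any finite set of others. -/
def IsStronglyRegular {ι G : Type*} [CommRing G] (q : ι → G) : Prop :=
  ∀ U : Finset ι, ∀ a ∉ U, ∀ g, q a * g ∈ Ideal.span (q '' (U : Set ι)) →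
    g ∈ Ideal.span (q '' (U : Set ι))

theorem IsStronglyRegular.of_ringEquiv {ι G H : Type*} [CommRing G] [CommRing H] (Θ : G ≃+* H)
    {q : ι → G} (h : IsStronglyRegular fun a => Θ (q a)) : IsStronglyRegular q := by
  have key : ∀ (U : Finset ι) (x : G), x ∈ Ideal.span (q '' (U : Set ι)) ↔
      Θ x ∈ Ideal.span ((fun a => Θ (q a)) '' (U : Set ι)) := by
    intro U x
    have h1 : Ideal.span ((fun a => Θ (q a)) '' (U : Set ι)) =
        (Ideal.span (q '' (U : Set ι))).map (Θ : G →+* H) := by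
      rw [Ideal.map_span, Set.image_image]; rfl
    rw [h1]
    refine ⟨fun hx => Ideal.mem_map_of_mem _ hx, fun hx => ?_⟩
    obtain ⟨y, hy, e⟩ := (Ideal.mem_map_iff_of_surjective (Θ : G →+* H) Θ.surjective).1 hx
    rw [← Θ.injective e]; exact hy
  intro U a ha g hg
  rw [key] at hg ⊢
  exact h U a ha _ (by rwa [map_mul] at hg)

end StrongRegular

section Concrete

variable (K : Type) [Field K] (n r : ℕ)

/-- The rows `r, …, n + r - 1`. -/
def lowRow {n r : ℕ} (i : Fin n) : Fin (n + r) := ⟨i + r, by omega⟩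

/-- The rows `0, …, r - 1`. -/
def headRow {n r : ℕ} (l : Fin r) : Fin (n + r) := ⟨l, by omega⟩

/-- The weight for which `x_{k+l,k} w_{k+l,l}` is the leading monomial of the `(k,l)` entry of
the product of the transpose of the first matrix with the second. -/
def pairingWeight (p : Fin (n + r) × (Fin n ⊕ Fin r)) : ℕ :=
  Sum.elim (fun k : Fin n => ((n + r : ℤ) ^ 2 - (p.1.val - k.val : ℤ) ^ 2).toNat)
    (fun l => 2 * p.1.val * l.val) p.2

theorem toNat_weight {n r : ℕ} (i : Fin (n + r)) (k : Fin n) :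
    ((((n + r : ℤ) ^ 2 - (i.val - k.val : ℤ) ^ 2).toNat : ℕ) : ℤ) =
      (n + r : ℤ) ^ 2 - (i.val - k.val : ℤ) ^ 2 := by
  apply Int.toNat_of_nonneg
  have h1 := i.2
  have h2 := k.2
  have : |(i.val - k.val : ℤ)| ≤ |(n + r : ℤ)| := by
    rw [abs_le, abs_of_nonneg (by positivity)]
    omega
  have := sq_le_sq' (abs_le.1 (this.trans_eq (abs_of_nonneg (by positivity)))).1
    (abs_le.1 (this.trans_eq (abs_of_nonneg (by positivity)))).2
  linarith

/-- The entries of the product of the transpose of the first matrix with the second. -/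
noncomputable def qA (p : Fin n × Fin r) : MvPolynomial (Fin (n + r) × (Fin n ⊕ Fin r)) K :=
  ∑ i, X (i, .inl p.1) * X (i, .inr p.2)

theorem degree_qA (m : MonomialOrder (Fin (n + r) × (Fin n ⊕ Fin r)))
    (hm : ∀ a b : (Fin (n + r) × (Fin n ⊕ Fin r)) →₀ ℕ,
      Finsupp.weight (pairingWeight n r) a < Finsupp.weight (pairingWeight n r) b →
        m.toSyn a < m.toSyn b) (p : Fin n × Fin r) (i₀ : Fin (n + r))
    (hi : i₀.val = p.1.val + p.2.val) :
    qA K n r p ≠ 0 ∧ m.degree (qA K n r p) =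
      Finsupp.single (i₀, .inl p.1) 1 + Finsupp.single (i₀, .inr p.2) 1 := by
  classical
  set E : Fin (n + r) → ((Fin (n + r) × (Fin n ⊕ Fin r)) →₀ ℕ) := fun i =>
    Finsupp.single (i, .inl p.1) 1 + Finsupp.single (i, .inr p.2) 1 with hE
  have hq : qA K n r p = ∑ i, monomial (E i) 1 := by
    refine Finset.sum_congr rfl fun i _ => ?_
    rw [X, X, monomial_mul, one_mul]
  have hw : ∀ i, (Finsupp.weight (pairingWeight n r) (E i) : ℤ) =
      ((n + r : ℤ) ^ 2 - (i.val - p.1.val : ℤ) ^ 2) + 2 * i.val * p.2.val := by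
    intro i
    rw [← toNat_weight]
    simp [hE, Finsupp.weight_single, pairingWeight]
  have hcoef : ∀ b, coeff b (qA K n r p) = ∑ i, if E i = b then (1 : K) else 0 := by
    intro b; rw [hq, coeff_sum]; simp only [coeff_monomial]
  have hlt : ∀ i, i ≠ i₀ → Finsupp.weight (pairingWeight n r) (E i) <
      Finsupp.weight (pairingWeight n r) (E i₀) := by
    intro i hne
    zify
    rw [hw, hw, hi]
    have : (i.val : ℤ) - (p.1.val + p.2.val) ≠ 0 := by
      intro h; apply hne; ext; omega
    have := pow_pos (abs_pos.2 this) 2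
    rw [sq_abs] at this
    push_cast
    nlinarith
  have hc : coeff (E i₀) (qA K n r p) = 1 := by
    rw [hcoef, Finset.sum_eq_single i₀]
    · simp
    · intro i _ hne
      rw [if_neg]
      intro h
      have := hlt i hne
      rw [h] at this
      exact lt_irrefl _ this
    · simp
  refine ⟨fun h => by rw [h] at hc; simp at hc, ?_⟩
  refine degree_eq_of_weight m _ hm _ _ (by rw [hc]; exact one_ne_zero) fun b hb => ?_
  rw [hcoef] at hb
  obtain ⟨i, -, hπ⟩ := Finset.exists_ne_zero_of_sum_ne_zero hb
  have hb' : E i = b := by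
    by_contra h; rw [if_neg h] at hπ; exact hπ rfl
  by_cases h1 : i = i₀
  · left; rw [← hb', h1]
  · right; rw [← hb']; exact hlt i h1

theorem det_X_of_injective_ne_zero {σ : Type*} {n : ℕ} (v : Fin n → Fin n → σ)
    (hv : Function.Injective fun p : Fin n × Fin n => v p.1 p.2) :
    Matrix.det (Matrix.of fun i j => (X (v i j) : MvPolynomial σ K)) ≠ 0 := by
  have h := Matrix.det_mvPolynomialX_ne_zero (Fin n) K
  intro h0
  apply h
  apply rename_injective _ hv
  rw [map_zero, AlgHom.map_det, ← h0]
  congr 1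
  ext i j
  simp [Matrix.mvPolynomialX_apply]

/-- The minor on the rows `r, …, n + r - 1`. -/
noncomputable def lowMinorA : MvPolynomial (Fin (n + r) × (Fin n ⊕ Fin r)) K :=
  Matrix.det (Matrix.of fun i k : Fin n => X (lowRow i, .inl k))

theorem isStronglyRegular_qA : IsStronglyRegular
    (fun o : Option (Fin n × Fin r) => o.elim (lowMinorA K n r) (qA K n r)) := by
  obtain ⟨m, hm⟩ := exists_monomialOrder_weight (pairingWeight n r)
  have hq : ∀ p : Fin n × Fin r, qA K n r p ≠ 0 ∧ m.degree (qA K n r p) =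
      Finsupp.single ((⟨p.1.val + p.2.val, by omega⟩ : Fin (n + r)), .inl p.1) 1 +
        Finsupp.single ((⟨p.1.val + p.2.val, by omega⟩ : Fin (n + r)), .inr p.2) 1 := fun p =>
    degree_qA K n r m hm p ⟨p.1.val + p.2.val, by omega⟩ rfl
  have hl : m.degree (lowMinorA K n r) =
      ∑ k : Fin n, Finsupp.single ((lowRow k : Fin (n + r)), (.inl k : Fin n ⊕ Fin r)) 1 := by
    refine degree_det_X m _ hm _ fun π hπ => ?_
    refine sum_weight_lt r ((n + r) ^ 2) (fun i k : Fin n =>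
      pairingWeight n r ((lowRow i : Fin (n + r)), .inl k)) (fun i k => ?_) π hπ
    simp only [pairingWeight, Sum.elim_inl]
    rw [toNat_weight]
    simp [lowRow]
  have hs1 : ∀ p : Fin n × Fin r, ∀ x, x ∈ (m.degree (qA K n r p)).support →
      x = (⟨p.1.val + p.2.val, by omega⟩, .inl p.1) ∨
        x = (⟨p.1.val + p.2.val, by omega⟩, .inr p.2) := by
    classical
    intro p x hx
    rw [(hq p).2] at hx
    rcases Finset.mem_union.1 (Finsupp.support_add hx) with h | h
    · left; simpa using Finsupp.support_single_subset h
    · right; simpa using Finsupp.support_single_subset h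
  have hs2 : ∀ x, x ∈ (m.degree (lowMinorA K n r)).support →
      ∃ k : Fin n, x = (lowRow k, .inl k) := by
    classical
    intro x hx
    rw [hl] at hx
    obtain ⟨k, -, hk⟩ := Finset.mem_biUnion.1 (Finsupp.support_finsetSum hx)
    exact ⟨k, by simpa using Finsupp.support_single_subset hk⟩
  have hdis : ∀ p, Disjoint (m.degree (lowMinorA K n r)).support
      (m.degree (qA K n r p)).support := by
    intro p
    refine Finset.disjoint_left.2 fun x h1 h2 => ?_
    obtain ⟨k, rfl⟩ := hs2 x h1
    rcases hs1 p _ h2 with h | h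
    · simp only [lowRow, Prod.mk.injEq, Fin.mk.injEq, Sum.inl.injEq] at h
      obtain ⟨h, rfl⟩ := h
      have := p.2.2
      omega
    · simp at h
  intro U a ha g hg
  refine mem_span_of_mul_mem_span m _ ?_ ?_ U a ha g hg
  · rintro (_ | p) (_ | p') hne
    · exact absurd rfl hne
    · exact hdis p'
    · exact (hdis p).symm
    · refine Finset.disjoint_left.2 fun x h1 h2 => hne ?_
      have h1 := hs1 p x h1
      have h2 := hs1 p' x h2
      rcases h1 with rfl | rfl <;> rcases h2 with h | h <;>
        simp only [Prod.mk.injEq, Fin.mk.injEq, Sum.inl.injEq, Sum.inr.injEq, reduceCtorEq,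
          and_false] at h
      · congr 1
        refine Prod.ext h.2 (Fin.ext ?_)
        have := congrArg Fin.val h.2
        omega
      · congr 1
        refine Prod.ext (Fin.ext ?_) h.2
        have := congrArg Fin.val h.2
        omega
  · rintro (_ | p)
    · refine det_X_of_injective_ne_zero K _ fun p p' h => ?_
      simp only [Prod.mk.injEq, lowRow, Fin.mk.injEq, Sum.inl.injEq] at h
      exact Prod.ext (Fin.ext (by omega)) h.2
    · exact (hq p).1

/-- Powers of the two extreme maximal minors are coprime. -/
theorem dvd_of_dvd_mul_minor (hr : 1 ≤ r) (d : ℕ) (g : MvPolynomial (Fin (n + r) × Fin n) K)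
    (hg : Matrix.det (Matrix.of fun i k : Fin n =>
        (X (lowRow i, k) : MvPolynomial (Fin (n + r) × Fin n) K)) ^ d ∣
      Matrix.det (Matrix.of fun i k : Fin n =>
        (X (Fin.castAdd r i, k) : MvPolynomial (Fin (n + r) × Fin n) K)) ^ d * g) :
    Matrix.det (Matrix.of fun i k : Fin n =>
        (X (lowRow i, k) : MvPolynomial (Fin (n + r) × Fin n) K)) ^ d ∣ g := by
  set ω : Fin (n + r) × Fin n → ℕ := fun p =>
    ((n + r : ℤ) ^ 2 - (p.1.val - p.2.val : ℤ) ^ 2).toNat with hω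
  obtain ⟨m, hm⟩ := exists_monomialOrder_weight ω
  have hdeg : ∀ (c : ℕ) (v : Fin n → Fin (n + r)) (hv : ∀ i, (v i).val = i.val + c),
      Matrix.det (Matrix.of fun i k : Fin n =>
        (X (v i, k) : MvPolynomial (Fin (n + r) × Fin n) K)) ≠ 0 ∧
      ∀ x ∈ (m.degree (Matrix.det (Matrix.of fun i k : Fin n =>
        (X (v i, k) : MvPolynomial (Fin (n + r) × Fin n) K)) ^ d)).support,
        x.1.val = x.2.val + c := by
    classical
    intro c v hv
    have h1 : Matrix.det (Matrix.of fun i k : Fin n =>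
        (X (v i, k) : MvPolynomial (Fin (n + r) × Fin n) K)) ≠ 0 := by
      refine det_X_of_injective_ne_zero K _ fun p p' h => ?_
      simp only [Prod.mk.injEq] at h
      have h2 := congrArg Fin.val h.1
      rw [hv, hv] at h2
      exact Prod.ext (Fin.ext (by omega)) h.2
    refine ⟨h1, fun x hx => ?_⟩
    rw [m.degree_pow] at hx
    have hx := Finsupp.support_smul hx
    rw [degree_det_X m ω hm] at hx
    · obtain ⟨k, -, hk⟩ := Finset.mem_biUnion.1 (Finsupp.support_finsetSum hx)
      have : x = (v k, k) := by simpa using Finsupp.support_single_subset hk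
      rw [this]; exact hv k
    · intro π hπ
      refine sum_weight_lt c ((n + r) ^ 2) (fun i k : Fin n => ω (v i, k)) (fun i k => ?_) π hπ
      simp only [hω]
      rw [toNat_weight, hv]
      simp
  obtain ⟨h1, h2⟩ := hdeg r lowRow fun i => rfl
  obtain ⟨h3, h4⟩ := hdeg 0 (Fin.castAdd r) fun i => rfl
  have hdis := Finset.disjoint_left.2 fun x hx hx' => by
    have := h2 x hx
    have := h4 x hx'
    omega
  have := mem_span_of_mul_mem_span m (fun b : Bool => bif b then
      Matrix.det (Matrix.of fun i k : Fin n =>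
        (X (lowRow i, k) : MvPolynomial (Fin (n + r) × Fin n) K)) ^ d
    else Matrix.det (Matrix.of fun i k : Fin n =>
        (X (Fin.castAdd r i, k) : MvPolynomial (Fin (n + r) × Fin n) K)) ^ d) ?_ ?_ {true} false
      (by simp) g
  · simp only [Finset.coe_singleton, Set.image_singleton, Ideal.mem_span_singleton] at this
    exact this hg
  · rintro (_ | _) (_ | _) hne
    · exact absurd rfl hne
    · exact hdis.symm
    · exact hdis
    · exact absurd rfl hne
  · rintro (_ | _)
    · exact pow_ne_zero _ h3
    · exact pow_ne_zero _ h1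

end Concrete

section Koszul

variable {ι : Type*} [Fintype ι] [DecidableEq ι] (R : Type*) {G : Type*} [CommRing R] [CommRing G]
  [Algebra R G] (q : ι → G)

set_option linter.unusedSectionVars false

/-- The Koszul differential. -/
noncomputable def kosz : Module.End R (Finset ι → G) :=
  ∑ a, lift0 R (LinearMap.mulLeft R (q a)) * an R a

theorem kosz_apply (f : Finset ι → G) (s : Finset ι) :
    kosz R q f s = ∑ a, q a * an R a f s := by
  simp only [kosz, LinearMap.sum_apply, Finset.sum_apply, Module.End.mul_apply, lift0_apply,
    LinearMap.mulLeft_apply]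

theorem an_mul_kosz (a : ι) : an R a * kosz R q + kosz R q * an R a = 0 := by
  simp only [kosz, Finset.mul_sum, Finset.sum_mul, ← Finset.sum_add_distrib]
  refine Finset.sum_eq_zero fun b _ => ?_
  rw [← mul_assoc, ← lift0_mul_an, mul_assoc, mul_assoc, ← mul_add, an_anticomm, mul_zero]

theorem kosz_mul_lift0 (x : G) : kosz R q * lift0 R (LinearMap.mulLeft R x) =
    lift0 R (LinearMap.mulLeft R x) * kosz R q := by
  rw [kosz, Finset.mul_sum, Finset.sum_mul]
  refine Finset.sum_congr rfl fun a _ => ?_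
  rw [mul_assoc, ← lift0_mul_an, ← mul_assoc, ← mul_assoc, ← map_mul, ← map_mul]
  congr 2
  ext y
  simp [mul_left_comm]

theorem kosz_mul_cr (a : ι) :
    kosz R q * cr R a = lift0 R (LinearMap.mulLeft R (q a)) - cr R a * kosz R q := by
  rw [eq_sub_iff_add_eq]
  simp only [kosz, Finset.mul_sum, Finset.sum_mul, ← Finset.sum_add_distrib]
  rw [Finset.sum_eq_single a]
  · rw [mul_assoc, ← mul_assoc (cr R a), ← lift0_mul_cr, mul_assoc, ← mul_add, add_comm,
      cr_an_anticomm, if_pos rfl, mul_one]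
  · intro b _ hb
    rw [mul_assoc, ← mul_assoc (cr R a), ← lift0_mul_cr, mul_assoc, ← mul_add, add_comm,
      cr_an_anticomm, if_neg hb.symm, mul_zero]
  · simp

theorem kosz_mul_self [CharZero G] [NoZeroDivisors G] : kosz R q * kosz R q = 0 := by
  have h : kosz R q * kosz R q + kosz R q * kosz R q = 0 := by
    have h1 : kosz R q * kosz R q =
        ∑ a, lift0 R (LinearMap.mulLeft R (q a)) * (an R a * kosz R q) := by
      conv_lhs =>
        enter [1]
        rw [kosz]
      rw [Finset.sum_mul]
      simp only [mul_assoc]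
    have h2 : kosz R q * kosz R q =
        ∑ a, lift0 R (LinearMap.mulLeft R (q a)) * (kosz R q * an R a) := by
      conv_lhs =>
        enter [2]
        rw [kosz]
      rw [Finset.mul_sum]
      simp only [← mul_assoc, kosz_mul_lift0]
    nth_rw 1 [h1]
    rw [h2, ← Finset.sum_add_distrib]
    exact Finset.sum_eq_zero fun a _ => by rw [← mul_add, an_mul_kosz, mul_zero]
  refine LinearMap.ext fun f => funext fun s => ?_
  have := congrFun (LinearMap.congr_fun h f) s
  rw [LinearMap.add_apply, Pi.add_apply, LinearMap.zero_apply, Pi.zero_apply,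
    add_self_eq_zero] at this
  exact this

theorem kosz_exact_aux (hq : IsStronglyRegular q) (U : Finset ι) : ∀ (j : ℕ) (z : Finset ι → G),
    (∀ s, z s ≠ 0 → s ⊆ U ∧ s.card = j + 1) → kosz R q z = 0 →
      ∃ u : Finset ι → G, (∀ s, u s ≠ 0 → s ⊆ U ∧ s.card = j + 2) ∧ kosz R q u = z := by
  induction U using Finset.induction_on with
  | empty =>
    intro j z hz _
    have : z = 0 := by
      funext s
      by_contra h
      obtain ⟨h1, h2⟩ := hz s h
      rw [Finset.subset_empty.1 h1] at h2
      simp at h2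
    exact ⟨0, by simp, by rw [this, map_zero]⟩
  | insert a U ha ih =>
    intro j z hz hcl
    have hsm : ∀ (s t : Finset ι) (x : G), ksign a s • x ≠ 0 → x ≠ 0 := fun s t x h h0 =>
      h (by rw [h0, smul_zero])
    have hz1 : ∀ s, an R a z s ≠ 0 → s ⊆ U ∧ s.card = j := by
      intro s hs
      rw [an_apply] at hs
      split_ifs at hs with has
      · exact absurd rfl hs
      · obtain ⟨h1, h2⟩ := hz _ (hsm s s _ hs)
        rw [Finset.card_insert_of_notMem has] at h2
        refine ⟨fun x hx => ?_, by omega⟩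
        rcases Finset.mem_insert.1 (h1 (Finset.mem_insert_of_mem hx)) with rfl | h
        · exact absurd hx has
        · exact h
    have hcl1 : kosz R q (an R a z) = 0 := by
      have := LinearMap.congr_fun (an_mul_kosz R q a) z
      rw [LinearMap.add_apply, Module.End.mul_apply, Module.End.mul_apply, hcl, map_zero,
        zero_add] at this
      exact this
    obtain ⟨u₁, hu₁, e₁⟩ : ∃ u₁ : Finset ι → G, (∀ s, u₁ s ≠ 0 → s ⊆ U ∧ s.card = j + 1) ∧
        kosz R q u₁ = an R a z := by
      rcases j with _ | j
      · have h0 := congrFun hcl ∅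
        rw [kosz_apply, Pi.zero_apply] at h0
        have hterm : ∀ b, q b * an R b z ∅ = ksign b ∅ • (q b * z {b}) := fun b => by
          rw [an_apply, if_neg (Finset.notMem_empty b), mul_smul_comm]; rfl
        have hout : ∀ b, b ∉ insert a U → q b * an R b z ∅ = 0 := by
          intro b hb
          have : z {b} = 0 := by
            by_contra h
            exact hb (Finset.singleton_subset_iff.1 (hz _ h).1)
          rw [hterm, this, mul_zero, smul_zero]
        rw [← Finset.sum_subset (Finset.subset_univ (insert a U)) fun b _ hb => hout b hb,
          Finset.sum_insert ha] at h0
        have hmem : q a * an R a z ∅ ∈ Ideal.span (q '' (U : Set ι)) := by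
          rw [eq_neg_of_add_eq_zero_left h0]
          exact neg_mem (Submodule.sum_mem _ fun b hb => Ideal.mul_mem_right _ _
            (Ideal.subset_span ⟨b, hb, rfl⟩))
        obtain ⟨c, hc⟩ := (Submodule.mem_span_image_finset_iff_exists_fun' G).1 (hq U a ha _ hmem)
        have hus : ∀ s, (∑ b ∈ U, Pi.single ({b} : Finset ι) (ksign b ∅ • c b) : Finset ι → G) s ≠ 0 →
            s ⊆ U ∧ s.card = 1 := by
          intro s hs
          rw [Finset.sum_apply] at hs
          obtain ⟨b, hb, hne⟩ := Finset.exists_ne_zero_of_sum_ne_zero hs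
          have : s = {b} := by
            by_contra h
            exact hne (Pi.single_eq_of_ne h _)
          subst this
          exact ⟨Finset.singleton_subset_iff.2 hb, Finset.card_singleton b⟩
        refine ⟨_, hus, funext fun s => ?_⟩
        by_cases hs : s = ∅
        · subst hs
          rw [kosz_apply, ← hc]
          rw [← Finset.sum_subset (Finset.subset_univ U)]
          · refine Finset.sum_congr rfl fun b hb => ?_
            rw [an_apply, if_neg (Finset.notMem_empty b)]
            rw [Finset.sum_apply, Finset.sum_eq_single b]
            · rw [show insert b (∅ : Finset ι) = {b} from rfl, Pi.single_eq_same, smul_smul,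
                ksign_mul_self, one_smul, smul_eq_mul, mul_comm]
            · intro b' _ hb'
              refine Pi.single_eq_of_ne ?_ _
              intro h
              exact hb' (Finset.singleton_injective h).symm
            · exact fun h => absurd hb h
          · intro b _ hb
            rw [an_apply, if_neg (Finset.notMem_empty b)]
            have : (∑ b ∈ U, Pi.single ({b} : Finset ι) (ksign b ∅ • c b) : Finset ι → G)
                (insert b ∅) = 0 := by
              by_contra h
              exact hb ((hus _ h).1 (Finset.mem_insert_self b ∅))
            rw [this, smul_zero, mul_zero]
        · have h1 : an R a z s = 0 := by
            by_contra h
            exact hs (Finset.card_eq_zero.1 (hz1 s h).2)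
          rw [h1, kosz_apply]
          refine Finset.sum_eq_zero fun b _ => ?_
          rw [an_apply]
          split_ifs with hbs
          · rw [mul_zero]
          · have : (∑ b ∈ U, Pi.single ({b} : Finset ι) (ksign b ∅ • c b) : Finset ι → G)
                (insert b s) = 0 := by
              by_contra h
              have h2 := (hus _ h).2
              rw [Finset.card_insert_of_notMem hbs] at h2
              exact hs (Finset.card_eq_zero.1 (by omega))
            rw [this, smul_zero, mul_zero]
      · exact ih j _ hz1 hcl1
    have hanu : an R a u₁ = 0 := by
      funext s
      rw [an_apply, Pi.zero_apply]
      split_ifs with has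
      · rfl
      · have : u₁ (insert a s) = 0 := by
          by_contra h
          exact ha ((hu₁ _ h).1 (Finset.mem_insert_self a s))
        rw [this, smul_zero]
    have hcr : ∀ (v : Finset ι → G) (k : ℕ), (∀ s, v s ≠ 0 → s ⊆ U ∧ s.card = k) →
        ∀ s, cr R a v s ≠ 0 → s ⊆ insert a U ∧ s.card = k + 1 := by
      intro v k hv s hs
      rw [cr_apply] at hs
      split_ifs at hs with has
      · obtain ⟨h1, h2⟩ := hv _ (hsm s s _ hs)
        refine ⟨?_, ?_⟩
        · rw [← Finset.insert_erase has]; exact Finset.insert_subset_insert a h1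
        · rw [← Finset.insert_erase has, Finset.card_insert_of_notMem (Finset.notMem_erase a s), h2]
      · exact absurd rfl hs
    have ek : kosz R q (cr R a u₁) = lift0 R (LinearMap.mulLeft R (q a)) u₁ - cr R a (an R a z) := by
      have := LinearMap.congr_fun (kosz_mul_cr R q a) u₁
      rw [LinearMap.sub_apply, Module.End.mul_apply, Module.End.mul_apply, e₁] at this
      exact this
    set z' := z + kosz R q (cr R a u₁) with hz'
    have han' : an R a z' = 0 := by
      have h1 := LinearMap.congr_fun (an_mul_kosz R q a) (cr R a u₁)
      have h2 := LinearMap.congr_fun (cr_an_anticomm R (G := G) a a) u₁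
      rw [if_pos rfl, LinearMap.add_apply, Module.End.mul_apply, Module.End.mul_apply, hanu, map_zero,
        zero_add, Module.End.one_apply] at h2
      rw [LinearMap.add_apply, Module.End.mul_apply, Module.End.mul_apply, h2, e₁] at h1
      rw [hz', map_add, add_comm]
      exact h1
    have hsup' : ∀ s, z' s ≠ 0 → s ⊆ U ∧ s.card = j + 1 := by
      intro s hs
      have has : a ∉ s := by
        intro has
        have := congrFun han' (s.erase a)
        rw [an_apply, if_neg (Finset.notMem_erase a s), Finset.insert_erase has] at this
        apply hs
        have h2 := congrArg (fun x => ksign a (s.erase a) • x) this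
        simpa only [smul_smul, ksign_mul_self, one_smul, Pi.zero_apply, smul_zero] using h2
      have hor : s ⊆ insert a U ∧ s.card = j + 1 := by
        by_contra hn
        have t1 : z s = 0 := by by_contra h; exact hn (hz s h)
        have t2 : u₁ s = 0 := by
          by_contra h
          exact hn ⟨(hu₁ s h).1.trans (Finset.subset_insert a U), (hu₁ s h).2⟩
        have t3 : cr R a (an R a z) s = 0 := by
          by_contra h
          exact hn (hcr _ j hz1 s h)
        apply hs
        rw [hz', ek, Pi.add_apply, Pi.sub_apply, t1, t3, lift0_apply, t2, map_zero]
        simp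
      refine ⟨fun x hx => ?_, hor.2⟩
      rcases Finset.mem_insert.1 (hor.1 hx) with rfl | h
      · exact absurd hx has
      · exact h
    have hcl' : kosz R q z' = 0 := by
      have h3 := LinearMap.congr_fun (kosz_mul_cr R q a) (an R a z)
      rw [LinearMap.sub_apply, Module.End.mul_apply, Module.End.mul_apply, hcl1, map_zero,
        sub_zero] at h3
      have h4 : kosz R q (lift0 R (LinearMap.mulLeft R (q a)) u₁) =
          lift0 R (LinearMap.mulLeft R (q a)) (kosz R q u₁) :=
        LinearMap.congr_fun (kosz_mul_lift0 R q (q a)) u₁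
      rw [hz', map_add, hcl, zero_add, ek, map_sub, h3, h4, e₁, sub_self]
    obtain ⟨u₀, hu₀, e₀⟩ := ih j z' hsup' hcl'
    refine ⟨u₀ - cr R a u₁, fun s hs => ?_, by rw [map_sub, e₀, hz', add_sub_cancel_right]⟩
    by_cases h : u₀ s = 0
    · rw [Pi.sub_apply, h, zero_sub, neg_ne_zero] at hs
      exact hcr u₁ (j + 1) hu₁ s hs
    · exact ⟨(hu₀ s h).1.trans (Finset.subset_insert a U), (hu₀ s h).2⟩

end Koszul

section WeightSpaces

variable {R V Ξ M : Type*} [CommRing R] [AddCommGroup V] [Module R V] [AddCommGroup M]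
variable (b : Module.Basis Ξ R V) (wt : Ξ → M) (w : M)

/-- The span of the basis vectors of a given weight. -/
def wtSub : Submodule R V where
  carrier := {v | ∀ y, b.repr v y ≠ 0 → wt y = w}
  zero_mem' := fun y hy => by simp at hy
  add_mem' := by
    intro u v hu hv y hy
    by_cases h : b.repr u y = 0
    · refine hv y fun h' => hy ?_
      rw [map_add, Finsupp.add_apply, h, h', add_zero]
    · exact hu y h
  smul_mem' := by
    intro c v hv y hy
    refine hv y fun h' => hy ?_
    rw [map_smul, Finsupp.smul_apply, h', smul_zero]

open Classical in
/-- The projection to a weight space. -/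
noncomputable def wtProj : V →ₗ[R] V := b.constr R fun y => if wt y = w then b y else 0

variable {b wt w}

open Classical in
theorem repr_wtProj (v : V) (y : Ξ) :
    b.repr (wtProj b wt w v) y = if wt y = w then b.repr v y else 0 := by
  have : (Finsupp.lapply y : (Ξ →₀ R) →ₗ[R] R) ∘ₗ b.repr.toLinearMap ∘ₗ wtProj b wt w =
      (if wt y = w then (Finsupp.lapply y : (Ξ →₀ R) →ₗ[R] R) ∘ₗ b.repr.toLinearMap else 0) := by
    refine b.ext fun x => ?_
    simp only [LinearMap.comp_apply, wtProj, Module.Basis.constr_basis, LinearEquiv.coe_coe,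
      Finsupp.lapply_apply]
    by_cases hx : wt x = w <;> by_cases hy : wt y = w
    · simp [hx, hy]
    · rw [if_pos hx, if_neg hy, b.repr_self, Finsupp.single_apply, if_neg]
      · rfl
      · rintro rfl; exact hy hx
    · rw [if_neg hx, if_pos hy, map_zero, Finsupp.zero_apply]
      simp only [LinearMap.comp_apply, LinearEquiv.coe_coe, Finsupp.lapply_apply, b.repr_self]
      rw [Finsupp.single_apply, if_neg]
      rintro rfl; exact hx hy
    · simp [hx, hy]
  have h := LinearMap.congr_fun this v
  simp only [LinearMap.comp_apply, LinearEquiv.coe_coe, Finsupp.lapply_apply] at h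
  rw [h]
  split_ifs <;> rfl

theorem wtProj_mem (v : V) : wtProj b wt w v ∈ wtSub b wt w := by
  intro y hy
  rw [repr_wtProj] at hy
  by_contra h
  rw [if_neg h] at hy
  exact hy rfl

theorem wtProj_of_mem {v : V} (hv : v ∈ wtSub b wt w) : wtProj b wt w v = v := by
  refine b.repr.injective (Finsupp.ext fun y => ?_)
  rw [repr_wtProj]
  split_ifs with h
  · rfl
  · by_contra h'
    exact h (hv y fun h0 => h' h0.symm)

theorem Shifts.map_mem {T : Module.End R V} {δ : M} (h : Shifts b wt T δ) {v : V}
    (hv : v ∈ wtSub b wt w) : T v ∈ wtSub b wt (w + δ) := by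
  intro y hy
  obtain ⟨x, hx, e⟩ := h v y hy
  rw [e, hv x hx]

theorem Shifts.wtProj_comm {T : Module.End R V} {δ : M} (h : Shifts b wt T δ) (v : V) :
    wtProj b wt (w + δ) (T v) = T (wtProj b wt w v) := by
  refine b.repr.injective (Finsupp.ext fun y => ?_)
  rw [repr_wtProj]
  split_ifs with hy
  · have : v = wtProj b wt w v + (v - wtProj b wt w v) := by abel
    conv_lhs => rw [this, map_add, map_add, Finsupp.add_apply]
    rw [add_eq_left]
    by_contra hne
    obtain ⟨x, hx, e⟩ := h _ _ hne
    have hxw : wt x = w := add_right_cancel (e.symm.trans hy)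
    rw [map_sub, Finsupp.sub_apply, repr_wtProj, if_pos hxw, sub_self] at hx
    exact hx rfl
  · by_contra hne
    exact hy (h.map_mem (wtProj_mem v) y fun h0 => hne h0.symm)

instance : Module.Projective R (wtSub b wt w) := by
  have := Module.Projective.of_basis b
  refine Module.Projective.of_split (wtSub b wt w).subtype
    ((wtProj b wt w).codRestrict _ fun v => wtProj_mem v) ?_
  refine LinearMap.ext fun v => Subtype.ext ?_
  exact wtProj_of_mem v.2

end WeightSpaces

section Pairing

variable {R : Type*} [CommRing R] {σ : Type*} [DecidableEq σ]

/-- The product of the factorials of the exponents. -/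
noncomputable def mfac (a : σ →₀ ℕ) : ℕ := a.prod fun _ k => k.factorial

theorem mfac_ne_zero (a : σ →₀ ℕ) : mfac a ≠ 0 :=
  Finset.prod_ne_zero_iff.2 fun _ _ => Nat.factorial_ne_zero _

theorem mfac_add_single (a : σ →₀ ℕ) (v : σ) :
    mfac (a + Finsupp.single v 1) = (a v + 1) * mfac a := by
  have h1 : ∀ c : σ →₀ ℕ, c.support ⊆ insert v a.support →
      mfac c = ∏ x ∈ insert v a.support, (c x).factorial := fun c hc =>
    Finsupp.prod_of_support_subset _ hc _ fun _ _ => rfl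
  rw [h1 a (Finset.subset_insert _ _), h1]
  · rw [← Finset.mul_prod_erase _ _ (Finset.mem_insert_self v a.support),
      ← Finset.mul_prod_erase _ (fun x => (a x).factorial) (Finset.mem_insert_self v a.support),
      ← mul_assoc]
    congr 1
    · simp [Nat.factorial_succ]
    · refine Finset.prod_congr rfl fun x hx => ?_
      rw [Finsupp.add_apply, Finsupp.single_apply, if_neg (Finset.ne_of_mem_erase hx).symm, add_zero]
  · refine (Finsupp.support_add).trans (Finset.union_subset (Finset.subset_insert _ _) ?_)
    exact Finsupp.support_single_subset.trans (by simp)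

/-- The pairing of polynomials by letting variables act as derivatives. -/
noncomputable def pr0 : MvPolynomial σ R →ₗ[R] MvPolynomial σ R →ₗ[R] R :=
  (basisMonomials σ R).constr R fun a => (mfac a : R) • lcoeff R a

theorem pr0_monomial (a : σ →₀ ℕ) (c : R) (f : MvPolynomial σ R) :
    pr0 (monomial a c) f = c * (mfac a * coeff a f) := by
  have h : (monomial a c : MvPolynomial σ R) = c • basisMonomials σ R a := by
    rw [coe_basisMonomials, smul_monomial, smul_eq_mul, mul_one]
  rw [h, pr0, map_smul, Module.Basis.constr_basis]
  rfl

theorem pr0_comm (g f : MvPolynomial σ R) : pr0 g f = pr0 f g := by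
  have : (pr0 : MvPolynomial σ R →ₗ[R] MvPolynomial σ R →ₗ[R] R) = pr0.flip := by
    refine (basisMonomials σ R).ext fun a => (basisMonomials σ R).ext fun b => ?_
    rw [LinearMap.flip_apply, coe_basisMonomials, pr0_monomial, pr0_monomial, coeff_monomial,
      coeff_monomial]
    by_cases h : a = b
    · simp [h]
    · simp [h, Ne.symm h]
  exact LinearMap.congr_fun (LinearMap.congr_fun this g) f

theorem pr0_mz (v : σ) (g f : MvPolynomial σ R) : pr0 g (mz R v f) = pr0 (pd R v g) f := by
  rw [pr0_comm g, pr0_comm _ f]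
  have : pr0.compr₂ (LinearMap.id : R →ₗ[R] R) ∘ₗ mz R v =
      pr0.compl₂ (pd R v) := by
    refine (basisMonomials σ R).ext fun a => LinearMap.ext fun g => ?_
    simp only [LinearMap.comp_apply, LinearMap.compr₂_apply, LinearMap.compl₂_apply, mz_apply,
      pd_apply, LinearMap.id_apply]
    rw [coe_basisMonomials, X, monomial_mul, one_mul, pr0_monomial, pr0_monomial, coeff_pderiv,
      add_comm, mfac_add_single]
    push_cast
    ring
  exact LinearMap.congr_fun (LinearMap.congr_fun this f) g

variable {ι : Type*} [Fintype ι] [DecidableEq ι]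

/-- The pairing on the Fock space. -/
noncomputable def prL (g : Finset ι → MvPolynomial σ R) : (Finset ι → MvPolynomial σ R) →ₗ[R] R :=
  ∑ s, pr0 (g s) ∘ₗ LinearMap.proj s

theorem prL_apply (g f : Finset ι → MvPolynomial σ R) : prL g f = ∑ s, pr0 (g s) (f s) := by
  simp [prL, LinearMap.sum_apply]

theorem prL_comm (g f : Finset ι → MvPolynomial σ R) : prL g f = prL f g := by
  simp only [prL_apply]
  exact Finset.sum_congr rfl fun s _ => pr0_comm _ _

theorem fb_apply (x : Σ _ : Finset ι, σ →₀ ℕ) :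
    fb R ι σ x = Pi.single x.1 (monomial x.2 1) := by
  rw [fb, Pi.basis_apply]; rfl

theorem prL_fb (g : Finset ι → MvPolynomial σ R) (x) :
    prL g (fb R ι σ x) = mfac x.2 * (fb R ι σ).repr g x := by
  rw [prL_comm, prL_apply, fb_apply, Finset.sum_eq_single x.1]
  · rw [Pi.single_eq_same, pr0_monomial, one_mul, fb_repr]
  · intro s _ hs
    rw [Pi.single_eq_of_ne hs, map_zero, LinearMap.zero_apply]
  · simp

theorem eq_zero_of_prL_eq_zero [CharZero R] [NoZeroDivisors R] {g : Finset ι → MvPolynomial σ R}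
    (h : ∀ f, prL g f = 0) : g = 0 := by
  refine (fb R ι σ).repr.injective (Finsupp.ext fun x => ?_)
  have := h (fb R ι σ x)
  rw [prL_fb, mul_eq_zero] at this
  rw [map_zero]
  exact this.resolve_left (Nat.cast_ne_zero.2 (mfac_ne_zero _))

theorem exists_prL_eq (hR : ∀ k : ℕ, k ≠ 0 → IsUnit (k : R))
    (φ : (Finset ι → MvPolynomial σ R) →ₗ[R] R) (hφ : {x | φ (fb R ι σ x) ≠ 0}.Finite) :
    ∃ g, φ = prL g := by
  classical
  refine ⟨∑ x ∈ hφ.toFinset, (φ (fb R ι σ x) * ((hR _ (mfac_ne_zero x.2)).unit⁻¹ : Rˣ)) •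
    fb R ι σ x, (fb R ι σ).ext fun y => ?_⟩
  rw [prL_fb, map_sum, Finsupp.finsetSum_apply]
  simp only [map_smul, Module.Basis.repr_self, Finsupp.smul_apply, Finsupp.single_apply, smul_eq_mul,
    mul_ite, mul_one, mul_zero, Finset.sum_ite_eq', Set.Finite.mem_toFinset, Set.mem_ofPred_eq]
  split_ifs with h
  · rw [mul_left_comm, IsUnit.mul_val_inv, mul_one]
  · exact not_not.1 h

/-- `T'` is the transpose of `T`. -/
def Adj (T T' : Module.End R (Finset ι → MvPolynomial σ R)) : Prop :=
  ∀ g f, prL g (T f) = prL (T' g) f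

variable {T T' U U' : Module.End R (Finset ι → MvPolynomial σ R)}

theorem Adj.symm (h : Adj T T') : Adj T' T := fun g f => by rw [prL_comm, ← h, prL_comm]

theorem Adj.mul (h : Adj T T') (h' : Adj U U') : Adj (T * U) (U' * T') := fun g f => by
  rw [Module.End.mul_apply, h, h', Module.End.mul_apply]

theorem prL_add_left (g g' f : Finset ι → MvPolynomial σ R) :
    prL (g + g') f = prL g f + prL g' f := by
  rw [prL_comm, map_add, prL_comm f g, prL_comm f g']

theorem Adj.zero : Adj (0 : Module.End R (Finset ι → MvPolynomial σ R)) 0 := fun g f => by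
  rw [LinearMap.zero_apply, LinearMap.zero_apply, map_zero, prL_comm, map_zero]

theorem Adj.add (h : Adj T T') (h' : Adj U U') : Adj (T + U) (T' + U') := fun g f => by
  rw [LinearMap.add_apply, map_add, h, h', LinearMap.add_apply, prL_add_left]

theorem Adj.smul (c : R) (h : Adj T T') : Adj (c • T) (c • T') := fun g f => by
  rw [LinearMap.smul_apply, map_smul, h, LinearMap.smul_apply, prL_comm (c • _), map_smul,
    prL_comm f]

theorem Adj.sum {κ : Type*} (s : Finset κ) {F F' : κ → Module.End R (Finset ι → MvPolynomial σ R)}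
    (h : ∀ i ∈ s, Adj (F i) (F' i)) : Adj (∑ i ∈ s, F i) (∑ i ∈ s, F' i) := by
  classical
  induction s using Finset.induction_on with
  | empty => simpa using Adj.zero
  | insert a s ha ih =>
    rw [Finset.sum_insert ha, Finset.sum_insert ha]
    exact (h a (by simp)).add (ih fun i hi => h i (by simp [hi]))

theorem adj_mz (v : σ) : Adj (lift0 (ι := ι) R (mz R v)) (lift0 R (pd R v)) := fun g f => by
  simp only [prL_apply, lift0_apply]
  exact Finset.sum_congr rfl fun s _ => pr0_mz _ _ _

theorem adj_an (p : ι) : Adj (an (G := MvPolynomial σ R) R p) (cr R p) := fun g f => by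
  simp only [prL_apply]
  have h1 : ∀ s, pr0 (g s) (an R p f s) =
      if p ∉ s then ksign p s • pr0 (g s) (f (insert p s)) else 0 := by
    intro s
    rw [an_apply]
    by_cases h : p ∈ s
    · simp [h]
    · rw [if_neg h, if_pos h, map_zsmul]
  have h2 : ∀ s, pr0 (cr R p g s) (f s) =
      if p ∈ s then ksign p s • pr0 (g (s.erase p)) (f s) else 0 := by
    intro s
    rw [cr_apply]
    split_ifs
    · rw [map_zsmul, LinearMap.smul_apply]
    · rw [map_zero, LinearMap.zero_apply]
  simp only [h1, h2, ← Finset.sum_filter]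
  refine Finset.sum_bij' (fun s _ => insert p s) (fun s _ => s.erase p) ?_ ?_ ?_ ?_ ?_
  · simp
  · simp
  · intro s hs
    exact Finset.erase_insert (by simpa using hs)
  · intro s hs
    exact Finset.insert_erase (by simpa using hs)
  · intro s hs
    rw [Finset.erase_insert (by simpa using hs), ksign_insert_self]

end Pairing

section Transport

variable (K : Type) [Field K] (n r : ℕ)

/-- The coordinate ring of generic matrices. -/
abbrev Sx := MvPolynomial (Fin (n + r) × Fin n) K

/-- Polynomials in additional columns. -/
abbrev Bx := MvPolynomial (Fin (n + r) × Fin r) (Sx K n r)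

/-- The terms of the Koszul complex. -/
abbrev FB := Finset (Fin n × Fin r) → Bx K n r

/-- Joining the two blocks of columns. -/
def blockEquiv : (Fin (n + r) × Fin r) ⊕ (Fin (n + r) × Fin n) ≃ Fin (n + r) × (Fin n ⊕ Fin r) :=
  (Equiv.sumComm _ _).trans (Equiv.prodSumDistrib _ _ _).symm

/-- Iterated polynomials as polynomials. -/
noncomputable def Th : Bx K n r ≃+* MvPolynomial (Fin (n + r) × (Fin n ⊕ Fin r)) K :=
  ((sumAlgEquiv K _ _).symm.trans (renameEquiv K (blockEquiv n r))).toRingEquiv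

variable {K n r}

theorem Th_X (i : Fin (n + r)) (l : Fin r) : Th K n r (X (i, l)) = X (i, .inr l) := by
  change rename _ ((sumAlgEquiv K _ _).symm (X (i, l))) = _
  rw [sumAlgEquiv_symm_X, rename_X]; rfl

theorem Th_C_X (i : Fin (n + r)) (k : Fin n) : Th K n r (C (X (i, k))) = X (i, .inl k) := by
  change rename _ ((sumAlgEquiv K _ _).symm (C (X (i, k)))) = _
  rw [sumAlgEquiv_symm_C_X, rename_X]; rfl

theorem Th_C_C (c : K) : Th K n r (C (C c)) = C c := by
  change rename _ ((sumAlgEquiv K _ _).symm (C (C c))) = _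
  rw [sumAlgEquiv_symm_C_C, rename_C]

theorem Th_C (p : Sx K n r) : Th K n r (C p) = rename (fun q => (q.1, Sum.inl q.2)) p := by
  induction p using MvPolynomial.induction_on with
  | C c => rw [Th_C_C, rename_C]
  | add p q hp hq => rw [map_add, map_add, hp, hq, map_add]
  | mul_X p q hp => rw [map_mul, map_mul, hp, Th_C_X, map_mul, rename_X]

theorem Th_pderiv (i : Fin (n + r)) (l : Fin r) (f : Bx K n r) :
    Th K n r (pderiv (i, l) f) = pderiv (i, .inr l) (Th K n r f) := by
  induction f using MvPolynomial.induction_on with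
  | C p =>
    rw [pderiv_C, map_zero]
    induction p using MvPolynomial.induction_on with
    | C c => rw [Th_C_C, pderiv_C]
    | add p q hp hq => rw [map_add, map_add, map_add, ← hp, ← hq, add_zero]
    | mul_X p q hp =>
      rw [map_mul, map_mul, pderiv_mul, ← hp, Th_C_X, pderiv_X_of_ne (by simp)]
      simp
  | add p q hp hq => rw [map_add, map_add, map_add, map_add, hp, hq]
  | mul_X p q hp =>
    obtain ⟨i', l'⟩ := q
    rw [pderiv_mul, map_add, map_mul, map_mul, map_mul, pderiv_mul, hp, Th_X, pderiv_X, pderiv_X]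
    congr 2
    by_cases h : (i', l') = (i, l)
    · obtain ⟨rfl, rfl⟩ := Prod.mk.inj h
      simp
    · rw [Pi.single_eq_of_ne h, Pi.single_eq_of_ne, map_zero]
      simpa using h

theorem Th_monomial (a : (Fin (n + r) × Fin r) →₀ ℕ) (p : Sx K n r) :
    Th K n r (monomial a p) = rename (fun q => (q.1, Sum.inl q.2)) p *
      monomial (a.mapDomain fun q => (q.1, Sum.inr q.2)) 1 := by
  rw [← rename_monomial, monomial_eq, monomial_eq, map_mul, Th_C, map_mul, C_1, map_one, one_mul,
    Finsupp.prod, Finsupp.prod, map_prod, map_prod]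
  congr 1
  refine Finset.prod_congr rfl fun q _ => ?_
  rw [map_pow, map_pow, rename_X, Th_X]

theorem exists_coeff_of_coeff_Th (f : Bx K n r) (b) (hb : coeff b (Th K n r f) ≠ 0) :
    ∃ a, coeff a f ≠ 0 ∧ ∀ i l, b (i, .inr l) = a (i, l) := by
  rw [f.as_sum, map_sum, coeff_sum] at hb
  obtain ⟨a, ha, hne⟩ := Finset.exists_ne_zero_of_sum_ne_zero hb
  refine ⟨a, mem_support_iff.1 ha, fun i l => ?_⟩
  rw [Th_monomial, coeff_mul_monomial'] at hne
  split_ifs at hne with hle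
  · rw [mul_one] at hne
    obtain ⟨u, hu, -⟩ := coeff_rename_ne_zero _ _ _ hne
    have h1 : (a.mapDomain fun q : Fin (n + r) × Fin r => (q.1, (Sum.inr q.2 : Fin n ⊕ Fin r)))
        (i, .inr l) = a (i, l) :=
      Finsupp.mapDomain_apply (f := fun q : Fin (n + r) × Fin r =>
        (q.1, (Sum.inr q.2 : Fin n ⊕ Fin r))) (fun q q' h => by
          simp only [Prod.mk.injEq, Sum.inr.injEq] at h; exact Prod.ext h.1 h.2) a (i, l)
    have h2 := DFunLike.congr_fun hu (i, .inr l)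
    rw [Finsupp.mapDomain_of_notMem_range _ _ (by simp), Finsupp.tsub_apply, h1] at h2
    have h3 := hle (i, .inr l)
    rw [h1] at h3
    omega
  · exact absurd rfl hne

variable (K n r)

/-- Column operators on the Koszul complex. -/
noncomputable def EB : Fin n ⊕ Fin r → Fin n ⊕ Fin r → Module.End (Sx K n r) (FB K n r)
  | .inl k, .inr l => ∑ i, (X (i, k) : Sx K n r) • lift0 _ (pd _ (i, l))
  | .inr l, .inr l' => ∑ i, lift0 _ (mz _ (i, l)) * lift0 _ (pd _ (i, l'))
  | _, _ => 0

/-- The counterpart of `Kr`. -/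
noncomputable def KB : Module.End (Sx K n r) (FB K n r) :=
  ∑ l, ∑ l', if l < l' then
    hatL (EB K n r) (cr _) (an _) l' l * hatL (EB K n r) (cr _) (an _) l l' else 0

/-- The entries of the product of the transposed generic matrix with the additional columns. -/
noncomputable def qB (p : Fin n × Fin r) : Bx K n r := ∑ i, C (X (i, p.1)) * X (i, p.2)

variable {K n r}

theorem Th_qB (p : Fin n × Fin r) : Th K n r (qB K n r p) = qA K n r p := by
  rw [qB, qA, map_sum]
  exact Finset.sum_congr rfl fun i _ => by rw [map_mul, Th_X, Th_C_X]

theorem kosz_qB : kosz (Sx K n r) (qB K n r) = ∑ p, ∑ i, (X (i, p.1) : Sx K n r) •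
    (lift0 _ (mz _ (i, p.2)) * an _ p) := by
  refine LinearMap.ext fun f => funext fun s => ?_
  rw [kosz_apply, LinearMap.sum_apply, Finset.sum_apply]
  refine Finset.sum_congr rfl fun p _ => ?_
  rw [LinearMap.sum_apply, Finset.sum_apply, qB, Finset.sum_mul]
  refine Finset.sum_congr rfl fun i _ => ?_
  rw [LinearMap.smul_apply, Pi.smul_apply, Module.End.mul_apply, lift0_apply, mz_apply, smul_eq_C_mul,
    mul_assoc]

theorem adj_kosz : Adj (kosz (Sx K n r) (qB K n r)) (dd (EB K n r) (cr _)) := by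
  rw [kosz_qB, dd]
  refine Adj.sum _ fun p _ => ?_
  simp only [EB, Finset.sum_mul, smul_mul_assoc]
  refine Adj.sum _ fun i _ => Adj.smul _ ?_
  rw [lift0_mul_cr]
  exact (adj_mz _).mul (adj_an _)

theorem adj_hatL (l l' : Fin r) : Adj (hatL (EB K n r) (cr _) (an _) l l')
    (hatL (EB K n r) (cr _) (an _) l' l) :=
  (Adj.sum _ fun _ _ => (adj_mz _).mul (adj_mz _).symm).add
    (Adj.sum _ fun _ _ => (adj_an _).symm.mul (adj_an _))

theorem adj_KB : Adj (KB K n r) (KB K n r) := by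
  refine Adj.sum _ fun l _ => Adj.sum _ fun l' _ => ?_
  split_ifs
  · exact (adj_hatL _ _).mul (adj_hatL _ _)
  · exact Adj.zero

theorem Th_cr (f : FB K n r) (p) :
    (fun s => Th K n r (cr (Sx K n r) p f s)) = cr K p (fun s => Th K n r (f s)) := by
  funext s
  simp only [cr_apply]
  split_ifs <;> simp

theorem Th_an (f : FB K n r) (p) :
    (fun s => Th K n r (an (Sx K n r) p f s)) = an K p (fun s => Th K n r (f s)) := by
  funext s
  simp only [an_apply]
  split_ifs <;> simp

theorem Th_EB_inr (f : FB K n r) (c : Fin n ⊕ Fin r) (l : Fin r) :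
    (fun s => Th K n r (EB K n r c (.inr l) f s)) =
      En K n r c (.inr l) (fun s => Th K n r (f s)) := by
  funext s
  rcases c with k | l' <;>
  simp only [EB, En, LinearMap.sum_apply, Finset.sum_apply, lift0_apply, map_sum, Module.End.mul_apply,
    LinearMap.smul_apply, Pi.smul_apply, mz_apply, pd_apply, smul_eq_C_mul, map_mul, Th_C_X,
    Th_X, Th_pderiv]

theorem Th_dd (f : FB K n r) : (fun s => Th K n r (dd (EB K n r) (cr _) f s)) =
    dd (En K n r) (cr K) (fun s => Th K n r (f s)) := by
  funext s
  simp only [dd, LinearMap.sum_apply, Finset.sum_apply, map_sum, Module.End.mul_apply]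
  refine Finset.sum_congr rfl fun p _ => ?_
  rw [← Th_cr, ← Th_EB_inr]

theorem Th_hatL (f : FB K n r) (l l') :
    (fun s => Th K n r (hatL (EB K n r) (cr _) (an _) l l' f s)) =
      hatL (En K n r) (cr K) (an K) l l' (fun s => Th K n r (f s)) := by
  funext s
  simp only [hatL, ferL, LinearMap.add_apply, LinearMap.sum_apply, Finset.sum_apply, map_sum,
    Module.End.mul_apply, Pi.add_apply, map_add]
  rw [← Th_EB_inr]
  congr 1
  refine Finset.sum_congr rfl fun p _ => ?_
  rw [← Th_an, ← Th_cr]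

theorem Th_KB (f : FB K n r) : (fun s => Th K n r (KB K n r f s)) =
    Kr K n r (fun s => Th K n r (f s)) := by
  funext s
  simp only [KB, Kr, LinearMap.sum_apply, Finset.sum_apply, map_sum]
  refine Finset.sum_congr rfl fun l _ => Finset.sum_congr rfl fun l' _ => ?_
  split_ifs
  · rw [Module.End.mul_apply, Module.End.mul_apply, ← Th_hatL, ← Th_hatL]
  · simp

theorem Th_injective {f g : FB K n r} (h : (fun s => Th K n r (f s)) = fun s => Th K n r (g s)) :
    f = g := by
  funext s
  have hs : Th K n r (f s) = Th K n r (g s) := congrFun h s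
  exact RingEquiv.injective _ hs

theorem KB_dd_comm [CharZero K] (f : FB K n r) :
    KB K n r (dd (EB K n r) (cr _) f) = dd (EB K n r) (cr _) (KB K n r f) := by
  apply Th_injective
  rw [Th_KB, Th_dd, Th_dd, Th_KB]
  have h : cm (dd (En K n r) (cr K)) (Kr K n r) = 0 := cm_Kr_of fun l l' => by
    rw [← cm_skew, cm_hatL_dd (kdata K n r), neg_zero]
  exact (LinearMap.congr_fun (cm_eq_zero_iff.1 h) _).symm

theorem KB_kosz_comm [CharZero K] (f : FB K n r) :
    KB K n r (kosz (Sx K n r) (qB K n r) f) = kosz (Sx K n r) (qB K n r) (KB K n r f) := by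
  rw [← sub_eq_zero]
  refine eq_zero_of_prL_eq_zero fun g => ?_
  rw [prL_comm, map_sub, adj_KB, adj_kosz, adj_kosz, adj_KB, KB_dd_comm, sub_self]

/-- Column weight and exterior degree. -/
def wB (x : Σ _ : Finset (Fin n × Fin r), (Fin (n + r) × Fin r) →₀ ℕ) : (Fin r → ℤ) × ℤ :=
  (fun l => ∑ i, (x.2 (i, l) : ℤ) + ∑ p ∈ x.1, fw p (.inr l), x.1.card)

theorem wB_add_single (s : Finset (Fin n × Fin r)) (a) (i : Fin (n + r)) (c : Fin r) :
    wB ⟨s, a + Finsupp.single (i, c) 1⟩ = wB ⟨s, a⟩ + (Pi.single c 1, 0) := by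
  refine Prod.ext ?_ ?_
  · funext c'
    by_cases hj : c' = c
    · simp [wB, Finset.sum_add_distrib, Finsupp.single_apply, hj, Finset.filter_eq]; ring
    · simp [wB, Finset.sum_add_distrib, Finsupp.single_apply, hj, eq_comm (a := c)]
  · simp [wB]

theorem wB_insert (s : Finset (Fin n × Fin r)) (a) (p : Fin n × Fin r) (hp : p ∉ s) :
    wB (n := n) (r := r) ⟨insert p s, a⟩ = wB ⟨s, a⟩ + (Pi.single p.2 1, 1) := by
  refine Prod.ext ?_ ?_
  · funext c'
    simp [wB, Finset.sum_insert hp, fw, Pi.single_apply]; ring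
  · simp [wB, Finset.card_insert_of_notMem hp]

theorem Shifts.smul {R V Ξ M : Type*} [CommRing R] [AddCommGroup V] [Module R V] [AddCommGroup M]
    {b : Module.Basis Ξ R V} {wt : Ξ → M} {T : Module.End R V} {δ : M} (c : R)
    (h : Shifts b wt T δ) : Shifts b wt (c • T) δ := by
  intro v y hy
  refine h v y fun h1 => hy ?_
  rw [LinearMap.smul_apply, map_smul, Finsupp.smul_apply, h1, smul_zero]

theorem shifts_lift0_mz (i : Fin (n + r)) (l : Fin r) :
    Shifts (fb (Sx K n r) (Fin n × Fin r) _) wB (lift0 _ (mz _ (i, l))) (Pi.single l 1, 0) :=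
  shifts_lift0 fun s => shifts_mz _ fun a => wB_add_single s a i l

theorem shifts_lift0_pd (i : Fin (n + r)) (l : Fin r) :
    Shifts (fb (Sx K n r) (Fin n × Fin r) _) wB (lift0 _ (pd _ (i, l))) (-(Pi.single l 1, 0)) :=
  shifts_lift0 fun s => shifts_pd _ fun a => by rw [wB_add_single s a i l, sub_neg_eq_add]

theorem shifts_wB_cr (p : Fin n × Fin r) :
    Shifts (fb (Sx K n r) (Fin n × Fin r) _) wB (cr _ p) (Pi.single p.2 1, 1) :=
  shifts_cr _ fun s a hs => wB_insert s a p hs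

theorem shifts_wB_an (p : Fin n × Fin r) :
    Shifts (fb (Sx K n r) (Fin n × Fin r) _) wB (an _ p) (-(Pi.single p.2 1, 1)) :=
  shifts_an _ fun s a hs => by rw [wB_insert s a p hs, sub_neg_eq_add]

theorem shifts_kosz : Shifts (fb (Sx K n r) (Fin n × Fin r) _) wB (kosz _ (qB K n r)) (0, -1) := by
  rw [kosz_qB]
  exact Shifts.sum _ fun p _ => Shifts.sum _ fun i _ => Shifts.smul _
    (((shifts_lift0_mz _ _).mul (shifts_wB_an _)).congr (by simp))

theorem shifts_KB_hatL (l l') : Shifts (fb (Sx K n r) (Fin n × Fin r) _) wB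
    (hatL (EB K n r) (cr _) (an _) l l') (Pi.single l 1 - Pi.single l' 1, 0) :=
  (Shifts.sum _ fun i _ => ((shifts_lift0_mz _ _).mul (shifts_lift0_pd _ _)).congr
    (by simp [sub_eq_add_neg])).add (Shifts.sum _ fun k _ =>
      ((shifts_wB_cr _).mul (shifts_wB_an _)).congr (by simp [sub_eq_add_neg]))

theorem shifts_KB : Shifts (fb (Sx K n r) (Fin n × Fin r) _) wB (KB K n r) 0 := by
  refine Shifts.sum _ fun l _ => Shifts.sum _ fun l' _ => ?_
  split_ifs
  · exact ((shifts_KB_hatL _ _).mul (shifts_KB_hatL _ _)).congr (by simp)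
  · exact Shifts.zero

end Transport

section Relation

universe u

variable {R : Type u} [CommRing R]

/-- A version of `subsingleton_ext_of_linear_resolution` with the section given by a relation. -/
theorem subsingleton_ext_of_relation {P : ℕ → Type u} [∀ j, AddCommGroup (P j)]
    [∀ j, Module R (P j)] (δ : ∀ j, P (j + 1) →ₗ[R] P j)
    (hex : ∀ j, Function.Exact (δ (j + 1)) (δ j)) [∀ j, Module.Projective R (P j)]
    {J Y : Type u} [AddCommGroup J] [Module R J] [AddCommGroup Y] [Module R Y]
    (α : P 0 →ₗ[R] J) (hα : ∀ v, α (δ 0 v) = 0) (rel : P 0 → J → Prop)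
    (hadd : ∀ v x v' x', rel v x → rel v' x' → rel (v + v') (x + x'))
    (hsmul : ∀ (c : R) v x, rel v x → rel (c • v) (c • x))
    (hexists : ∀ x, ∃ v, rel v x) (hunique : ∀ v, rel v 0 → ∃ u, δ 0 u = v)
    (hval : ∀ v x, rel v x → α v = x) (k : ∀ j, P j →ₗ[R] P j)
    (hk : ∀ j, k j ∘ₗ δ j = δ j ∘ₗ k (j + 1)) (hkα : ∀ v, α (k 0 v) = 0) (p : ℕ)
    (H : ∀ φ : P (p + 1) →ₗ[R] Y, φ ∘ₗ δ (p + 1) = 0 →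
      (∃ ψ : P p →ₗ[R] Y, ψ ∘ₗ δ p = φ ∘ₗ k (p + 1)) → ∃ u : P p →ₗ[R] Y, u ∘ₗ δ p = φ) :
    Subsingleton (CategoryTheory.Abelian.Ext.{u} (ModuleCat.of R J) (ModuleCat.of R Y)
      (p + 1)) := by
  choose f hf using hexists
  have key : ∀ v v' x, rel v x → rel v' x →
      (Submodule.Quotient.mk v : P 0 ⧸ LinearMap.range (δ 0)) = Submodule.Quotient.mk v' := by
    intro v v' x h h'
    refine (Submodule.Quotient.eq _).2 (hunique _ ?_)
    have := hadd _ _ _ _ h (hsmul (-1) _ _ h')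
    simpa [← sub_eq_add_neg] using this
  let β : J →ₗ[R] P 0 ⧸ LinearMap.range (δ 0) :=
    { toFun := fun x => Submodule.Quotient.mk (f x)
      map_add' := fun x y => key _ _ _ (hf _) (hadd _ _ _ _ (hf x) (hf y))
      map_smul' := fun c x => key _ _ _ (hf _) (hsmul c _ _ (hf x)) }
  exact subsingleton_ext_of_linear_resolution P δ hex
    (Submodule.liftQ _ α (by rintro _ ⟨v, rfl⟩; exact hα v)) β (fun x => hval _ _ (hf x)) k hk
    hkα p H

end Relation

section ExtRetract

variable (K : Type) [Field K] (n r d : ℕ)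

/-- The weight of the `j`-th term of the resolution. -/
def wj (j : ℕ) : (Fin r → ℤ) × ℤ := (fun _ => d, j)

/-- The `j`-th term of the resolution. -/
noncomputable abbrev Pj (j : ℕ) : Submodule (Sx K n r) (FB K n r) := wtSub (fb _ _ _) wB (wj r d j)

variable {K n r d}

theorem wj_add (j : ℕ) : wj r d (j + 1) + (0, -1) = wj r d j := by
  simp [wj]

theorem kosz_mem {j : ℕ} {v : FB K n r} (hv : v ∈ Pj K n r d (j + 1)) :
    kosz (Sx K n r) (qB K n r) v ∈ Pj K n r d j := by
  have := shifts_kosz.map_mem hv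
  rwa [wj_add] at this

theorem KB_mem {j : ℕ} {v : FB K n r} (hv : v ∈ Pj K n r d j) : KB K n r v ∈ Pj K n r d j := by
  have := shifts_KB.map_mem hv
  rwa [add_zero] at this

variable (K n r d)

/-- The differential of the resolution. -/
noncomputable def dj (j : ℕ) : Pj K n r d (j + 1) →ₗ[Sx K n r] Pj K n r d j :=
  (kosz (Sx K n r) (qB K n r)).restrict fun _ hv => kosz_mem hv

/-- The endomorphism of the resolution. -/
noncomputable def kj (j : ℕ) : Pj K n r d j →ₗ[Sx K n r] Pj K n r d j :=
  (KB K n r).restrict fun _ hv => KB_mem hv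

/-- The projection to a term of the resolution. -/
noncomputable def tj (j : ℕ) : FB K n r →ₗ[Sx K n r] Pj K n r d j :=
  (wtProj (fb _ _ _) wB (wj r d j)).codRestrict _ fun v => wtProj_mem v

variable {K n r d}

theorem tj_of_mem {j : ℕ} (v : Pj K n r d j) : tj K n r d j v = v :=
  Subtype.ext (wtProj_of_mem v.2)

theorem tj_kosz (j : ℕ) (v : FB K n r) :
    tj K n r d j (kosz (Sx K n r) (qB K n r) v) = dj K n r d j (tj K n r d (j + 1) v) := by
  refine Subtype.ext ?_
  have := shifts_kosz.wtProj_comm (w := wj r d (j + 1)) v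
  rwa [wj_add] at this

theorem tj_KB (j : ℕ) (v : FB K n r) :
    tj K n r d j (KB K n r v) = kj K n r d j (tj K n r d j v) := by
  refine Subtype.ext ?_
  have := shifts_KB.wtProj_comm (w := wj r d j) v
  rwa [add_zero] at this

theorem isStronglyRegular_qB : IsStronglyRegular (qB K n r) := by
  refine IsStronglyRegular.of_ringEquiv (Th K n r) fun U a ha g hg => ?_
  have h := isStronglyRegular_qA K n r (U.map Function.Embedding.some) (some a)
    (by simpa using ha) g
  have e : (fun o : Option (Fin n × Fin r) => o.elim (lowMinorA K n r) (qA K n r)) ''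
      (U.map Function.Embedding.some : Finset _) = (fun a => Th K n r (qB K n r a)) '' U := by
    rw [Finset.coe_map, Set.image_image]
    exact Set.image_congr fun a _ => (Th_qB a).symm
  rw [e] at h
  simp only [Th_qB] at hg h ⊢
  exact h hg

theorem card_of_mem_Pj {j : ℕ} {v : FB K n r} (hv : v ∈ Pj K n r d j) {s} (hs : v s ≠ 0) :
    s.card = j := by
  obtain ⟨a, ha⟩ := exists_coeff_ne_zero hs
  have := hv ⟨s, a⟩ (by rwa [fb_repr])
  simpa [wB, wj] using congrArg Prod.snd this

theorem dj_exact [CharZero K] (j : ℕ) :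
    Function.Exact (dj K n r d (j + 1)) (dj K n r d j) := by
  intro v
  constructor
  · intro hv
    obtain ⟨u, -, hu⟩ := kosz_exact_aux (Sx K n r) (qB K n r) isStronglyRegular_qB Finset.univ j v
      (fun s hs => ⟨Finset.subset_univ _, card_of_mem_Pj v.2 hs⟩) (congrArg Subtype.val hv)
    exact ⟨tj K n r d (j + 2) u, by rw [← tj_kosz, hu, tj_of_mem]⟩
  · rintro ⟨u, rfl⟩
    exact Subtype.ext (LinearMap.congr_fun (kosz_mul_self (Sx K n r) (qB K n r)) u.1)

theorem finite_wB_eq (w : (Fin r → ℤ) × ℤ) :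
    {x : Σ _ : Finset (Fin n × Fin r), (Fin (n + r) × Fin r) →₀ ℕ | wB x = w}.Finite := by
  have hf : ((Set.univ : Set (Finset (Fin n × Fin r))) ×ˢ
      Set.Iic (fun q : Fin (n + r) × Fin r => (w.1 q.2).toNat)).Finite :=
    Set.finite_univ.prod (Set.finite_Iic _)
  refine Set.Finite.of_injOn (f := fun x : Σ _ : Finset (Fin n × Fin r),
    (Fin (n + r) × Fin r) →₀ ℕ => (x.1, (x.2 : Fin (n + r) × Fin r → ℕ)))
    (fun x hx => ?_) (fun x _ y _ h => ?_) hf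
  · refine ⟨trivial, fun q => ?_⟩
    have h := congrFun (congrArg Prod.fst hx) q.2
    have h1 : (x.2 q : ℤ) ≤ ∑ i, (x.2 (i, q.2) : ℤ) :=
      Finset.single_le_sum (f := fun i => (x.2 (i, q.2) : ℤ)) (fun _ _ => by positivity)
        (Finset.mem_univ q.1)
    have h2 : 0 ≤ ∑ p ∈ x.1, fw p (Sum.inr q.2 : Fin n ⊕ Fin r) :=
      Finset.sum_nonneg fun p _ => by
      simp only [fw, Pi.sub_apply, Pi.single_apply, reduceCtorEq, if_false, sub_zero]
      split_ifs <;> norm_num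
    simp only [wB] at h
    simp only
    omega
  · obtain ⟨s, a⟩ := x
    obtain ⟨t, b⟩ := y
    simp only [Prod.mk.injEq] at h
    obtain ⟨rfl, h⟩ := h
    rw [DFunLike.coe_injective h]

theorem exists_prL_eq_comp_tj [CharZero K] {j : ℕ} (φ : Pj K n r d j →ₗ[Sx K n r] Sx K n r) :
    ∃ g : FB K n r, φ ∘ₗ tj K n r d j = prL g ∧
      ∀ x, (fb (Sx K n r) _ _).repr g x ≠ 0 → wB x = wj r d j := by
  have key : ∀ x, (φ ∘ₗ tj K n r d j) (fb _ _ _ x) ≠ 0 → wB x = wj r d j := by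
    intro x hx
    by_contra h
    refine hx ?_
    have : tj K n r d j (fb _ _ _ x) = 0 := by
      refine Subtype.ext ((fb _ _ _).repr.injective (Finsupp.ext fun y => ?_))
      refine (repr_wtProj _ _).trans ?_
      split_ifs with hy
      · rw [Module.Basis.repr_self, Finsupp.single_apply, if_neg (by rintro rfl; exact h hy)]; simp
      · simp
    rw [LinearMap.comp_apply, this, map_zero]
  obtain ⟨g, hg⟩ := exists_prL_eq (fun k hk => by
    have := ((Nat.cast_ne_zero (R := K)).2 hk).isUnit.map (C : K →+* Sx K n r)
    rwa [map_natCast] at this) _ ((finite_wB_eq (wj r d j)).subset key)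
  refine ⟨g, hg, fun x hx => key x ?_⟩
  rw [hg, prL_fb]
  exact mul_ne_zero (Nat.cast_ne_zero.2 (mfac_ne_zero _)) hx

theorem inF_Th {j : ℕ} {g : FB K n r}
    (hg : ∀ x, (fb (Sx K n r) _ _).repr g x ≠ 0 → wB x = wj r d j) :
    InF j d (fun s => Th K n r (g s)) := by
  intro x hx
  rw [fb_repr] at hx
  obtain ⟨a, ha, hb⟩ := exists_coeff_of_coeff_Th _ _ hx
  have h := hg ⟨x.1, a⟩ (by rwa [fb_repr])
  refine ⟨fun l => ?_, congrArg Prod.snd h⟩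
  have h1 := congrFun (congrArg Prod.fst h) l
  simp only [wB, wj] at h1
  simp only [W, hb, h1]

theorem exists_dj_lift [CharZero K] {p : ℕ} (hp : ¬ ∃ t ≤ n, p + 1 = t * r)
    (φ : Pj K n r d (p + 1) →ₗ[Sx K n r] Sx K n r) (hφ : φ ∘ₗ dj K n r d (p + 1) = 0)
    (ψ : Pj K n r d p →ₗ[Sx K n r] Sx K n r)
    (hψ : ψ ∘ₗ dj K n r d p = φ ∘ₗ kj K n r d (p + 1)) :
    ∃ u : Pj K n r d p →ₗ[Sx K n r] Sx K n r, u ∘ₗ dj K n r d p = φ := by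
  obtain ⟨g, hg, hgw⟩ := exists_prL_eq_comp_tj φ
  obtain ⟨h, hh, -⟩ := exists_prL_eq_comp_tj ψ
  have hdg : dd (EB K n r) (cr _) g = 0 := by
    refine eq_zero_of_prL_eq_zero fun f => ?_
    rw [← adj_kosz, ← hg, LinearMap.comp_apply, tj_kosz]
    exact LinearMap.congr_fun hφ _
  have hKg : KB K n r g = dd (EB K n r) (cr _) h := by
    rw [← sub_eq_zero]
    refine eq_zero_of_prL_eq_zero fun f => ?_
    rw [prL_comm, map_sub, prL_comm, prL_comm f, ← adj_KB, ← adj_kosz, ← hg, ← hh,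
      LinearMap.comp_apply, LinearMap.comp_apply, tj_kosz, tj_KB, sub_eq_zero]
    exact (LinearMap.congr_fun hψ _).symm
  obtain ⟨u, hu⟩ := exists_dd_eq (K := K) (n := n) (r := r) d (p + 1) hp
    (fun s => Th K n r (g s)) (fun s => Th K n r (h s)) (inF_Th hgw)
    (by rw [← Th_dd, hdg]; funext s; simp) (by rw [← Th_KB, hKg, Th_dd])
  have hu' : dd (EB K n r) (cr _) (fun s => (Th K n r).symm (u s)) = g := by
    apply Th_injective
    rw [Th_dd, ← hu]
    simp
  refine ⟨prL (fun s => (Th K n r).symm (u s)) ∘ₗ Submodule.subtype _, LinearMap.ext fun v => ?_⟩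
  have e := LinearMap.congr_fun hg v.1
  rw [LinearMap.comp_apply, tj_of_mem] at e
  rw [e, ← hu', ← adj_kosz]
  rfl

/-- Vanishing of `Ext` for a retract of the cokernel of the resolution. -/
theorem subsingleton_ext_of_retract [CharZero K] (J : Ideal (Sx K n r))
    (α : Pj K n r d 0 →ₗ[Sx K n r] J) (hα : ∀ v, α (dj K n r d 0 v) = 0)
    (hαk : ∀ v, α (kj K n r d 0 v) = 0)
    (rel : Pj K n r d 0 → J → Prop)
    (hadd : ∀ v x v' x', rel v x → rel v' x' → rel (v + v') (x + x'))
    (hsmul : ∀ (c : Sx K n r) v x, rel v x → rel (c • v) (c • x))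
    (hexists : ∀ x, ∃ v, rel v x) (hunique : ∀ v, rel v 0 → ∃ u, dj K n r d 0 u = v)
    (hval : ∀ v x, rel v x → α v = x)
    (p : ℕ) (hp : ¬ ∃ t ≤ n, p + 1 = t * r) :
    Subsingleton (CategoryTheory.Abelian.Ext.{0} (ModuleCat.of (Sx K n r) J)
      (ModuleCat.of (Sx K n r) (Sx K n r)) (p + 1)) :=
  subsingleton_ext_of_relation (P := fun j => Pj K n r d j) (dj K n r d) dj_exact α hα rel hadd hsmul
    hexists hunique hval (kj K n r d)
    (fun _ => LinearMap.ext fun _ => Subtype.ext (KB_kosz_comm _)) hαk p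
    fun φ hφ ⟨ψ, hψ⟩ => exists_dj_lift hp φ hφ ψ hψ

end ExtRetract

section Determinants

variable {R A : Type*} [CommRing R] [CommRing A] [Algebra R A]

theorem derivation_prod_eq_zero {ι : Type*} (θ : Derivation R A A) (s : Finset ι) (f : ι → A)
    (h : ∀ i ∈ s, θ (f i) = 0) : θ (∏ i ∈ s, f i) = 0 := by
  classical
  induction s using Finset.induction_on with
  | empty => simp
  | insert a s ha ih =>
    rw [Finset.prod_insert ha, Derivation.leibniz, h a (Finset.mem_insert_self _ _),
      ih fun i hi => h i (Finset.mem_insert_of_mem hi), smul_zero, smul_zero, add_zero]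

theorem derivation_det {N : Type*} [Fintype N] [DecidableEq N] (θ : Derivation R A A)
    (M : Matrix N N A) (c : N) (h : ∀ a b, b ≠ c → θ (M a b) = 0) :
    θ M.det = (M.updateCol c fun a => θ (M a c)).det := by
  rw [Matrix.det_apply, Matrix.det_apply, map_sum]
  refine Finset.sum_congr rfl fun σ _ => ?_
  rw [Units.smul_def, Units.smul_def, map_zsmul]
  congr 1
  rw [← Finset.mul_prod_erase _ _ (Finset.mem_univ c), ← Finset.mul_prod_erase _ _ (Finset.mem_univ c),
    Derivation.leibniz, derivation_prod_eq_zero _ _ _ fun b hb => h _ b (Finset.ne_of_mem_erase hb),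
    smul_zero, zero_add, smul_eq_mul, mul_comm, Matrix.updateCol_self]
  congr 1
  exact Finset.prod_congr rfl fun b hb => by
    rw [Matrix.updateCol_ne (Finset.ne_of_mem_erase hb)]

/-- A determinant lies in the ideal generated by the minors of a block of columns. -/
theorem det_mem_of_minors_mem {N P : Type*} [Fintype N] [DecidableEq N] [Fintype P]
    [DecidableEq P] (M : Matrix (N ⊕ P) (N ⊕ P) A) (J : Ideal A)
    (hN : IsUnit ((Fintype.card N).factorial : A))
    (hJ : ∀ g : N → N ⊕ P, Function.Injective g → (M.submatrix g Sum.inl).det ∈ J) : M.det ∈ J := by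
  have h1 : ∀ σ : Equiv.Perm N, M.det = ∑ τ : Equiv.Perm (N ⊕ P),
      (τ.sign : ℤ) • (∏ l, M (τ (.inr l)) (.inr l)) *
        ((σ.sign : ℤ) • ∏ k, M (τ (.inl (σ k))) (.inl k)) := by
    intro σ
    rw [Matrix.det_apply]
    refine (Fintype.sum_equiv (Equiv.mulRight (Equiv.Perm.sumCongr σ 1)) _ _ fun τ => ?_).symm
    rw [Equiv.coe_mulRight, Equiv.Perm.sign_mul, Equiv.Perm.sign_sumCongr, Equiv.Perm.sign_one,
      mul_one, Fintype.prod_sum_type, Units.smul_def, Units.val_mul]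
    simp only [Equiv.Perm.mul_apply, Equiv.Perm.sumCongr_apply, Sum.map_inl, Sum.map_inr,
      Equiv.Perm.one_apply, smul_mul_smul_comm, mul_comm]
  have h2 : ((Fintype.card N).factorial : A) * M.det = ∑ τ : Equiv.Perm (N ⊕ P),
      (τ.sign : ℤ) • (∏ l, M (τ (.inr l)) (.inr l)) *
        (M.submatrix (fun k => τ (.inl k)) Sum.inl).det := by
    have : ((Fintype.card N).factorial : A) * M.det = ∑ _σ : Equiv.Perm N, M.det := by
      rw [Finset.sum_const, Finset.card_univ, Fintype.card_perm, nsmul_eq_mul]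
    rw [this, Finset.sum_congr rfl fun σ _ => h1 σ, Finset.sum_comm]
    refine Finset.sum_congr rfl fun τ _ => ?_
    rw [← Finset.mul_sum, Matrix.det_apply]
    rfl
  rw [← Ideal.unit_mul_mem_iff_mem J hN, h2]
  exact J.sum_mem fun τ _ => J.mul_mem_left _ (hJ _ (τ.injective.comp Sum.inl_injective))

/-- Any minor on an injective choice of rows lies in the ideal generated by the minors on increasing
choices of rows. -/
theorem det_submatrix_mem {n m : ℕ} (M : Matrix (Fin m) (Fin n) A) (J : Ideal A)
    (hJ : ∀ g : Fin n → Fin m, StrictMono g → (M.submatrix g id).det ∈ J) (g : Fin n → Fin m)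
    (hg : Function.Injective g) : (M.submatrix g id).det ∈ J := by
  have h := hJ (g ∘ Tuple.sort g)
    ((Tuple.monotone_sort g).strictMono_of_injective (hg.comp (Tuple.sort g).injective))
  have e : (M.submatrix (g ∘ Tuple.sort g) id).det =
      Equiv.Perm.sign (Tuple.sort g) * (M.submatrix g id).det :=
    Matrix.det_permute (Tuple.sort g) (M.submatrix g id)
  rw [e] at h
  exact (Ideal.unit_mul_mem_iff_mem J
    ((Equiv.Perm.sign (Tuple.sort g)).isUnit.map (Int.castRingHom A))).1 h

end Determinants

section Minors

variable (K : Type) [Field K] (n r : ℕ)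

/-- Splitting off the first `r` rows. -/
def rowEquiv : Fin n ⊕ Fin r ≃ Fin (n + r) :=
  (Equiv.sumComm _ _).trans (finSumFinEquiv.trans (finCongr (Nat.add_comm r n)))

variable {n r} in
theorem rowEquiv_inl (i : Fin n) : rowEquiv n r (.inl i) = lowRow i :=
  Fin.ext (Nat.add_comm r i)

variable {n r} in
theorem rowEquiv_inr (l : Fin r) : rowEquiv n r (.inr l) = headRow l := rfl

/-- The generic matrix completed to a square matrix by the additional columns. -/
noncomputable def sqM : Matrix (Fin n ⊕ Fin r) (Fin n ⊕ Fin r) (Bx K n r) :=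
  Matrix.of fun a c => c.elim (fun k => C (X (rowEquiv n r a, k))) (fun l => X (rowEquiv n r a, l))

/-- The bottom maximal minor. -/
noncomputable def lowMinor : Sx K n r :=
  Matrix.det (Matrix.of fun i k : Fin n => X (lowRow i, k))

/-- The top maximal minor of the additional columns. -/
noncomputable def headMinor : Bx K n r :=
  Matrix.det (Matrix.of fun l l' : Fin r => X (headRow l, l'))

theorem det_sqM_mem [CharZero K] (I : Ideal (Sx K n r))
    (hI : ∀ g : Fin n → Fin (n + r), StrictMono g →
      (Matrix.of fun i k : Fin n => (X (g i, k) : Sx K n r)).det ∈ I) :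
    (sqM K n r).det ∈ I.map C := by
  refine det_mem_of_minors_mem _ _ ?_ fun g hg => ?_
  · have := ((Nat.cast_ne_zero (R := K)).2 (Nat.factorial_ne_zero (Fintype.card (Fin n)))).isUnit.map
      ((C : Sx K n r →+* Bx K n r).comp C)
    rwa [map_natCast] at this
  · have h := det_submatrix_mem (Matrix.of fun i k => (X (i, k) : Sx K n r)) I hI
      (fun k => rowEquiv n r (g k)) ((rowEquiv n r).injective.comp hg)
    have h' := Ideal.mem_map_of_mem (C : Sx K n r →+* Bx K n r) h
    rw [RingHom.map_det] at h'
    exact h'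

theorem exists_derivation_eq_sum {R σ τ : Type*} [CommRing R] [Fintype τ]
    (z : τ → MvPolynomial σ R) (v : τ → σ) :
    ∃ θ : Derivation R (MvPolynomial σ R) (MvPolynomial σ R),
      ∀ f, θ f = ∑ i, z i * pderiv (v i) f := by
  refine ⟨∑ i, z i • pderiv (v i), fun f => ?_⟩
  rw [← Derivation.coeFnAddMonoidHom_apply, map_sum, Finset.sum_apply]
  rfl

theorem sum_mul_pderiv_det (z : Fin (n + r) → Bx K n r) (l : Fin r) (c : Fin n ⊕ Fin r)
    (hc : c ≠ .inr l) (hz : ∀ a, sqM K n r a c = z (rowEquiv n r a)) (d : ℕ) :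
    ∑ i, z i * pderiv (i, l) ((sqM K n r).det ^ d) = 0 := by
  obtain ⟨θ, hθ⟩ := exists_derivation_eq_sum z fun i => (i, l)
  have h0 : ((sqM K n r).updateCol (.inr l) fun a => θ (sqM K n r a (.inr l))).det = 0 := by
    refine Matrix.det_zero_of_column_eq hc fun a => ?_
    rw [Matrix.updateCol_ne hc, Matrix.updateCol_self, hz, hθ,
      Finset.sum_eq_single (rowEquiv n r a)]
    · simp [sqM]
    · intro i _ hi
      simp [sqM, pderiv_X, hi.symm]
    · simp
  rw [← hθ, Derivation.leibniz_pow, derivation_det θ _ (.inr l), h0, smul_zero, smul_zero]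
  · intro a b hb
    rcases b with k | l'
    · simp [sqM, hθ]
    · have : l' ≠ l := fun h => hb (by rw [h])
      rw [hθ]
      refine Finset.sum_eq_zero fun i _ => ?_
      simp [sqM, pderiv_X, Pi.single_apply, this]

variable (d : ℕ)

/-- The power of the determinant in exterior degree zero. -/
noncomputable def detE : FB K n r := Pi.single ∅ ((sqM K n r).det ^ d)

variable {K n r d}

theorem lift0_single {G R ι : Type*} [CommRing R] [CommRing G] [Algebra R G] [Fintype ι]
    [DecidableEq ι]
    (T : Module.End R G) (s : Finset ι) (g : G) :
    lift0 R T (Pi.single s g) = (Pi.single s (T g) : Finset ι → G) := by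
  funext t
  rw [lift0_apply]
  by_cases h : t = s
  · subst h; simp
  · simp [Pi.single_eq_of_ne h]

theorem an_single_empty {G R ι : Type*} [CommRing R] [CommRing G] [Algebra R G] [Fintype ι]
    [DecidableEq ι] (a : ι) (g : G) : an R a (Pi.single ∅ g : Finset ι → G) = 0 := by
  funext t
  rw [an_apply, Pi.single_eq_of_ne (Finset.insert_ne_empty _ _)]
  simp

theorem EB_inl_detE (k : Fin n) (l : Fin r) : EB K n r (.inl k) (.inr l) (detE K n r d) = 0 := by
  have h : EB K n r (.inl k) (.inr l) (detE K n r d) = Pi.single ∅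
      (∑ i, C (X (i, k)) * pderiv (i, l) ((sqM K n r).det ^ d)) := by
    funext t
    simp only [EB, detE, LinearMap.sum_apply, LinearMap.smul_apply, lift0_single, Finset.sum_apply,
      Pi.smul_apply, smul_eq_C_mul, pd_apply]
    by_cases h : t = ∅
    · subst h; simp
    · simp [Pi.single_eq_of_ne h]
  rw [h, sum_mul_pderiv_det K n r (fun i => C (X (i, k))) l (.inl k) (by simp) fun _ => rfl,
    Pi.single_zero]

theorem EB_inr_detE (l l' : Fin r) (hl : l ≠ l') :
    EB K n r (.inr l) (.inr l') (detE K n r d) = 0 := by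
  have h : EB K n r (.inr l) (.inr l') (detE K n r d) = Pi.single ∅
      (∑ i, X (i, l) * pderiv (i, l') ((sqM K n r).det ^ d)) := by
    funext t
    simp only [EB, detE, LinearMap.sum_apply, Module.End.mul_apply, lift0_single, Finset.sum_apply,
      pd_apply, mz_apply]
    by_cases h : t = ∅
    · subst h; simp
    · simp [Pi.single_eq_of_ne h]
  rw [h, sum_mul_pderiv_det K n r (fun i => X (i, l)) l' (.inr l) (by simpa using hl) fun _ => rfl,
    Pi.single_zero]

theorem dd_detE : dd (EB K n r) (cr _) (detE K n r d) = 0 := by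
  rw [dd, LinearMap.sum_apply]
  refine Finset.sum_eq_zero fun p _ => ?_
  have h : EB K n r (.inl p.1) (.inr p.2) * cr (Sx K n r) p =
      cr (Sx K n r) p * EB K n r (.inl p.1) (.inr p.2) := by
    simp only [EB, Finset.sum_mul, Finset.mul_sum, smul_mul_assoc, mul_smul_comm, lift0_mul_cr]
  rw [h, Module.End.mul_apply, EB_inl_detE, map_zero]

theorem KB_detE : KB K n r (detE K n r d) = 0 := by
  rw [KB, LinearMap.sum_apply]
  refine Finset.sum_eq_zero fun l _ => ?_
  rw [LinearMap.sum_apply]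
  refine Finset.sum_eq_zero fun l' _ => ?_
  split_ifs with h
  · have : hatL (EB K n r) (cr _) (an _) l l' (detE K n r d) = 0 := by
      rw [hatL, LinearMap.add_apply, EB_inr_detE _ _ h.ne, ferL, LinearMap.sum_apply, zero_add]
      exact Finset.sum_eq_zero fun k _ => by
        rw [Module.End.mul_apply, detE, an_single_empty, map_zero]
    rw [Module.End.mul_apply, this, map_zero]
  · rfl

theorem prL_single (s : Finset (Fin n × Fin r)) (g : Bx K n r) (f : FB K n r) :
    prL (Pi.single s g : FB K n r) f = pr0 g (f s) := by
  rw [prL_apply, Finset.sum_eq_single s]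
  · rw [Pi.single_eq_same]
  · intro t _ ht
    rw [Pi.single_eq_of_ne ht, map_zero, LinearMap.zero_apply]
  · simp

theorem prL_detE_mem [CharZero K] (I : Ideal (Sx K n r))
    (hI : ∀ g : Fin n → Fin (n + r), StrictMono g →
      (Matrix.of fun i k : Fin n => (X (g i, k) : Sx K n r)).det ∈ I) (f : FB K n r) :
    prL (detE K n r d) f ∈ I ^ d := by
  rw [detE, prL_single]
  have h : (sqM K n r).det ^ d ∈ (I ^ d).map C := by
    rw [Ideal.map_pow]
    exact Ideal.pow_mem_pow (det_sqM_mem K n r I hI) d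
  rw [mem_map_C_iff] at h
  rw [((sqM K n r).det ^ d).as_sum, map_sum, LinearMap.sum_apply]
  refine Ideal.sum_mem _ fun a _ => ?_
  rw [pr0_monomial]
  exact Ideal.mul_mem_right _ _ (h a)

end Minors

section Exchange

theorem exists_mul_sub_mem_of_dvd {B : Type} [CommRing B] {Q : Ideal B} {a b : B}
    (h : ∀ (A : Type) [CommRing A] (φ : B →+* A), (∀ x ∈ Q, φ x = 0) → φ a ∣ φ b) :
    ∃ c, a * c - b ∈ Q := by
  obtain ⟨c, hc⟩ := h (B ⧸ Q) (Ideal.Quotient.mk Q) fun x hx => Ideal.Quotient.eq_zero_iff_mem.2 hx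
  obtain ⟨c, rfl⟩ := Ideal.Quotient.mk_surjective c
  refine ⟨c, Ideal.Quotient.eq.1 ?_⟩
  rw [hc, map_mul]

variable {K : Type} [Field K] {n r : ℕ}

theorem kosz_single_empty (g : Bx K n r) :
    kosz (Sx K n r) (qB K n r) (Pi.single ∅ g) = 0 := by
  rw [kosz, LinearMap.sum_apply]
  exact Finset.sum_eq_zero fun p _ => by
    rw [Module.End.mul_apply, an_single_empty, map_zero]

theorem kosz_empty_mem (u : FB K n r) :
    kosz (Sx K n r) (qB K n r) u ∅ ∈ Ideal.span (Set.range (qB K n r)) := by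
  rw [kosz_apply]
  exact Ideal.sum_mem _ fun p _ => Ideal.mul_mem_right _ _ (Ideal.subset_span ⟨p, rfl⟩)

theorem exists_kosz_eq_single {f : Bx K n r} (hf : f ∈ Ideal.span (Set.range (qB K n r))) :
    ∃ u, kosz (Sx K n r) (qB K n r) u = Pi.single ∅ f := by
  obtain ⟨g, rfl⟩ := Ideal.mem_span_range_iff_exists_fun.1 hf
  refine ⟨∑ p, cr (Sx K n r) p (Pi.single ∅ (g p)), ?_⟩
  rw [map_sum]
  have h : ∀ p, kosz (Sx K n r) (qB K n r) (cr (Sx K n r) p (Pi.single ∅ (g p))) =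
      Pi.single ∅ (g p * qB K n r p) := by
    intro p
    rw [← Module.End.mul_apply, kosz_mul_cr, LinearMap.sub_apply, Module.End.mul_apply,
      kosz_single_empty, map_zero, sub_zero, lift0_single, LinearMap.mulLeft_apply, mul_comm]
  simp only [h]
  exact (map_sum (AddMonoidHom.single (fun _ : Finset (Fin n × Fin r) => Bx K n r) ∅) _ _).symm

theorem mem_of_lowMinor_mul_mem {g : Bx K n r}
    (hg : C (lowMinor K n r) * g ∈ Ideal.span (Set.range (qB K n r))) :
    g ∈ Ideal.span (Set.range (qB K n r)) := by
  have hlow : Th K n r (C (lowMinor K n r)) = lowMinorA K n r := by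
    rw [Th_C, lowMinor, AlgHom.map_det]
    congr 1
    ext i k
    simp
  have h : IsStronglyRegular (fun o : Option (Fin n × Fin r) =>
      o.elim (C (lowMinor K n r)) (qB K n r)) := by
    refine IsStronglyRegular.of_ringEquiv (Th K n r) ?_
    convert isStronglyRegular_qA K n r using 2 with o
    cases o with
    | none => exact hlow
    | some p => exact Th_qB p
  have e : (fun o : Option (Fin n × Fin r) => o.elim (C (lowMinor K n r)) (qB K n r)) ''
      ((Finset.univ.map Function.Embedding.some : Finset (Option (Fin n × Fin r))) : Set _) =
      Set.range (qB K n r) := by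
    rw [Finset.coe_map, Set.image_image, Finset.coe_univ, Set.image_univ]
    rfl
  have h' := h (Finset.univ.map Function.Embedding.some) none (by simp) g
  rw [e] at h'
  exact h' hg

theorem mem_of_lowMinor_pow_mul_mem {d : ℕ} {g : Bx K n r}
    (hg : C (lowMinor K n r) ^ d * g ∈ Ideal.span (Set.range (qB K n r))) :
    g ∈ Ideal.span (Set.range (qB K n r)) := by
  induction d with
  | zero => rwa [pow_zero, one_mul] at hg
  | succ d ih =>
    rw [pow_succ', mul_assoc] at hg
    exact ih (mem_of_lowMinor_mul_mem hg)

/-- The exchange relation between maximal minors modulo the entries of the product. -/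
theorem lowMinor_dvd_mul_headMinor {A : Type*} [CommRing A] (φ : Bx K n r →+* A)
    (hφ : ∀ p, φ (qB K n r p) = 0) (g : Fin n → Fin (n + r)) :
    φ (C (lowMinor K n r)) ∣
      φ
        (C (Matrix.of fun i k : Fin n => (X (g i, k) : Sx K n r)).det * headMinor K n r) := by
  let M₁ : Matrix (Fin n ⊕ Fin r) (Fin n ⊕ Fin r) (Bx K n r) := Matrix.of fun a c =>
    c.elim (fun k => if rowEquiv n r a = g k then 1 else 0) (fun l => X (rowEquiv n r a, l))
  let M₂ : Matrix (Fin n ⊕ Fin r) (Fin n ⊕ Fin r) (Bx K n r) := Matrix.of fun a c =>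
    c.elim (fun k => C (X (rowEquiv n r a, k))) (fun l => if a = .inr l then 1 else 0)
  have h₂ : M₂.det = C (lowMinor K n r) := by
    have : M₂ = Matrix.fromBlocks (Matrix.of fun i k => C (X (lowRow i, k))) 0
        (Matrix.of fun l k => C (X (headRow l, k))) 1 := by
      refine Matrix.ext fun a c => ?_
      rcases a with i | l <;> rcases c with k | l'
      · simp [M₂, rowEquiv_inl]
      · simp [M₂]
      · simp [M₂, rowEquiv_inr]
      · simp [M₂, Matrix.one_apply]
    rw [this, Matrix.det_fromBlocks_zero₁₂, Matrix.det_one, mul_one, lowMinor, RingHom.map_det]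
    rfl
  have hsum : ∀ (a : Fin n ⊕ Fin r → Bx K n r) (i : Fin (n + r)),
      ∑ x, (if rowEquiv n r x = i then 1 else 0) * a x = a ((rowEquiv n r).symm i) := by
    intro a i
    rw [Finset.sum_eq_single ((rowEquiv n r).symm i)]
    · simp
    · intro b _ hb
      rw [if_neg, zero_mul]
      rintro rfl
      simp at hb
    · simp
  have hprod : φ.mapMatrix (M₁.transpose * M₂) =
      Matrix.fromBlocks (φ.mapMatrix (Matrix.of fun i k => C (X (g i, k))))
        (φ.mapMatrix (M₁.transpose * M₂)).toBlocks₁₂ 0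
        (φ.mapMatrix (Matrix.of fun l l' : Fin r => (X (headRow l, l') : Bx K n r)).transpose) := by
    refine Matrix.ext fun a c => ?_
    rcases a with i | l <;> rcases c with k | l'
    · simp only [RingHom.mapMatrix_apply, Matrix.map_apply, Matrix.fromBlocks_apply₁₁, Matrix.mul_apply,
        Matrix.transpose_apply, Matrix.of_apply, M₁, M₂, Sum.elim_inl, hsum, Equiv.apply_symm_apply]
    · rfl
    · simp only [RingHom.mapMatrix_apply, Matrix.map_apply, Matrix.fromBlocks_apply₂₁, Matrix.mul_apply,
        Matrix.transpose_apply, Matrix.of_apply, M₁, M₂, Sum.elim_inl, Sum.elim_inr,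
        Matrix.zero_apply]
      rw [Equiv.sum_comp (rowEquiv n r) fun i => (X (i, l) * C (X (i, k)) : Bx K n r)]
      refine (congrArg φ (Finset.sum_congr rfl fun i _ => mul_comm _ _)).trans (hφ (k, l))
    · simp only [RingHom.mapMatrix_apply, Matrix.map_apply, Matrix.fromBlocks_apply₂₂, Matrix.mul_apply,
        Matrix.transpose_apply, Matrix.of_apply, M₁, M₂, Sum.elim_inr, mul_ite, mul_one, mul_zero,
        Finset.sum_ite_eq', Finset.sum_ite_eq, Finset.mem_univ, if_true, rowEquiv_inr]
  refine ⟨φ M₁.det, ?_⟩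
  have h := congrArg Matrix.det hprod
  rw [Matrix.det_fromBlocks_zero₂₁, ← RingHom.map_det, ← RingHom.map_det, ← RingHom.map_det,
    Matrix.det_mul, Matrix.det_transpose, Matrix.det_transpose, h₂, map_mul] at h
  rw [map_mul, RingHom.map_det C]
  exact h.symm.trans (mul_comm _ _)

theorem lowMinor_pow_dvd_mul_headMinor_pow {A : Type*} [CommRing A] (φ : Bx K n r →+* A)
    (hφ : ∀ p, φ (qB K n r p) = 0) (I : Ideal (Sx K n r))
    (hI : I = Ideal.span {p | ∃ g : Fin n → Fin (n + r), StrictMono g ∧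
      p = (Matrix.of fun i k : Fin n => (X (g i, k) : Sx K n r)).det}) (d : ℕ) (x : Sx K n r)
    (hx : x ∈ I ^ d) :
    φ (C (lowMinor K n r) ^ d) ∣
      φ (C x * headMinor K n r ^ d) := by
  induction d generalizing x with
  | zero => simp
  | succ d ih =>
    rw [pow_succ] at hx
    refine Submodule.mul_induction_on hx (fun a ha b hb => ?_) fun a b ha hb => ?_
    · have hb' : φ (C (lowMinor K n r)) ∣
          φ (C b * headMinor K n r) := by
        rw [hI] at hb
        refine Submodule.span_induction ?_ ?_ ?_ ?_ hb
        · rintro _ ⟨g, -, rfl⟩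
          exact lowMinor_dvd_mul_headMinor φ hφ g
        · simp
        · intro a b _ _ ha hb
          rw [map_add, add_mul, map_add]
          exact dvd_add ha hb
        · intro c a _ ha
          rw [smul_eq_mul, map_mul C, mul_assoc, map_mul φ]
          exact ha.mul_left _
      have := mul_dvd_mul (ih a ha) hb'
      rw [← map_mul, ← map_mul] at this
      rw [show C (a * b) * headMinor K n r ^ (d + 1) =
        C a * headMinor K n r ^ d * (C b * headMinor K n r) by rw [map_mul]; ring, pow_succ]
      exact this
    · rw [map_add, add_mul, map_add]
      exact dvd_add ha hb

theorem exists_lowMinor_pow_mul_sub_mem (I : Ideal (Sx K n r))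
    (hI : I = Ideal.span {p | ∃ g : Fin n → Fin (n + r), StrictMono g ∧
      p = (Matrix.of fun i k : Fin n => (X (g i, k) : Sx K n r)).det}) (d : ℕ) (x : Sx K n r)
    (hx : x ∈ I ^ d) : ∃ b : Bx K n r, C (lowMinor K n r) ^ d * b - C x * headMinor K n r ^ d ∈
      Ideal.span (Set.range (qB K n r)) := by
  refine exists_mul_sub_mem_of_dvd fun A _ φ hφ => ?_
  exact lowMinor_pow_dvd_mul_headMinor_pow φ
    (fun p => hφ _ (Ideal.subset_span (Set.mem_range_self p))) I hI d x hx

end Exchange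

section PairingConstant

theorem pr0_map {R S σ : Type*} [CommRing R] [CommRing S] [DecidableEq σ] (φ : R →+* S)
    (g h : MvPolynomial σ R) : pr0 (map φ g) (map φ h) = φ (pr0 g h) := by
  induction g using MvPolynomial.induction_on' with
  | monomial a c =>
    rw [map_monomial, pr0_monomial, pr0_monomial, coeff_map, map_mul, map_mul, map_natCast]
  | add p q hp hq => rw [map_add, map_add, map_add, LinearMap.add_apply, LinearMap.add_apply,
      map_add, hp, hq]

theorem pr0_self_ne_zero {σ : Type*} [DecidableEq σ] {g : MvPolynomial σ ℤ} (hg : g ≠ 0) :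
    pr0 g g ≠ 0 := by
  have h : pr0 g g = ∑ a ∈ g.support, coeff a g * (mfac a * coeff a g) := by
    conv_lhs => rw [g.as_sum, ← g.as_sum]
    nth_rw 1 [g.as_sum]
    rw [map_sum, LinearMap.sum_apply]
    exact Finset.sum_congr rfl fun a _ => pr0_monomial _ _ _
  rw [h]
  refine (Finset.sum_pos (fun a ha => ?_) (support_nonempty.2 hg)).ne'
  have h1 : 0 < coeff a g ^ 2 := by
    have := mem_support_iff.1 ha
    positivity
  have h2 : (0 : ℤ) < mfac a := by exact_mod_cast Nat.pos_of_ne_zero (mfac_ne_zero a)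
  nlinarith [mul_pos h1 h2]

theorem pr0_aeval_of_support {R σ : Type*} [CommRing R] [DecidableEq σ] (t : σ → Prop)
    [DecidablePred t] {h : MvPolynomial σ R} (hh : ∀ a, coeff a h ≠ 0 → ∀ q, a q ≠ 0 → t q)
    (f : MvPolynomial σ R) :
    pr0 (aeval (fun q => if t q then (X q : MvPolynomial σ R) else 0) f) h = pr0 f h := by
  induction f using MvPolynomial.induction_on' with
  | monomial a c =>
    rw [aeval_monomial]
    by_cases ha : ∀ q, a q ≠ 0 → t q
    · congr 2
      rw [monomial_eq, algebraMap_eq]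
      congr 1
      exact Finsupp.prod_congr fun q hq => by rw [if_pos (ha q (Finsupp.mem_support_iff.1 hq))]
    · have h0 : coeff a h = 0 := by
        by_contra h0
        exact ha (hh a h0)
      push Not at ha
      obtain ⟨q, hq, ht⟩ := ha
      rw [pr0_monomial, h0, Finsupp.prod, Finset.prod_eq_zero (Finsupp.mem_support_iff.2 hq)]
      · simp
      · rw [if_neg ht, zero_pow hq]
  | add p q hp hq => rw [map_add, map_add, map_add, LinearMap.add_apply, LinearMap.add_apply, hp, hq]

variable {K : Type} [Field K] {n r d : ℕ}

theorem headMinor_mem_supported : headMinor K n r ∈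
    supported (Sx K n r) {q : Fin (n + r) × Fin r | q.1.val < r} := by
  rw [headMinor, Matrix.det_apply]
  refine sum_mem fun τ _ => zsmul_mem (prod_mem fun l _ => ?_) _
  exact X_mem_supported.2 (τ l).2

theorem aeval_sqM_det : aeval (fun q : Fin (n + r) × Fin r =>
      if q.1.val < r then (X q : Bx K n r) else 0) (sqM K n r).det =
    C (lowMinor K n r) * headMinor K n r := by
  rw [AlgHom.map_det, lowMinor, RingHom.map_det, headMinor, ← Matrix.det_fromBlocks_zero₁₂ _
    (Matrix.of fun l k => (C (X (headRow l, k) : Sx K n r) : Bx K n r))]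
  congr 1
  refine Matrix.ext fun a c => ?_
  rcases a with i | l <;> rcases c with k | l'
  · simp [sqM, rowEquiv_inl]
  · simp [sqM, rowEquiv_inl, lowRow]
  · simp [sqM, rowEquiv_inr]
  · simp [sqM, rowEquiv_inr, headRow]

theorem exists_pr0_sqM_det_eq [CharZero K] : ∃ c : K, c ≠ 0 ∧
    pr0 ((sqM K n r).det ^ d) (headMinor K n r ^ d) = lowMinor K n r ^ d * C c := by
  let g : MvPolynomial (Fin (n + r) × Fin r) ℤ :=
    (Matrix.of fun l l' : Fin r => X (headRow l, l')).det ^ d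
  have hmap : ∀ (A : Type) [CommRing A], map (Int.castRingHom A) g =
      (Matrix.of fun l l' : Fin r => X (headRow l, l')).det ^ d := by
    intro A _
    rw [map_pow, RingHom.map_det]
    congr 2
    ext l l'
    simp
  have hg : g ≠ 0 := by
    intro h0
    have h := hmap K
    rw [h0, map_zero] at h
    refine pow_ne_zero d (det_X_of_injective_ne_zero K (fun l l' : Fin r =>
      ((headRow l, l') : Fin (n + r) × Fin r)) fun p q hpq => ?_) h.symm
    simp only [headRow, Prod.mk.injEq, Fin.mk.injEq, Fin.val_inj] at hpq
    exact Prod.ext hpq.1 hpq.2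
  have hH : headMinor K n r ^ d = map (Int.castRingHom _) g := (hmap _).symm
  refine ⟨((pr0 g g : ℤ) : K), Int.cast_ne_zero.2 (pr0_self_ne_zero hg), ?_⟩
  rw [← pr0_aeval_of_support (fun q : Fin (n + r) × Fin r => q.1.val < r) (fun a ha q hq => ?_),
    map_pow (aeval _), aeval_sqM_det, mul_pow, ← map_pow, ← smul_eq_C_mul, map_smul, LinearMap.smul_apply,
    smul_eq_mul, hH, pr0_map]
  · simp
  · have h := pow_mem (headMinor_mem_supported (K := K) (n := n) (r := r)) d
    exact mem_supported.1 h ((mem_vars_iff_mem_support _).2 ⟨a, mem_support_iff.2 ha, Finsupp.mem_support_iff.2 hq⟩)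

theorem isWeightedHomogeneous_headMinor : IsWeightedHomogeneous
    (fun q : Fin (n + r) × Fin r => (Pi.single q.2 1 : Fin r → ℕ)) (headMinor K n r)
    (fun _ => 1) := by
  rw [headMinor, Matrix.det_apply]
  refine IsWeightedHomogeneous.sum _ _ _ fun τ _ => ?_
  have h : IsWeightedHomogeneous (fun q : Fin (n + r) × Fin r => (Pi.single q.2 1 : Fin r → ℕ))
      (∏ l, (X (headRow (τ l), l) : Bx K n r)) (∑ l : Fin r, Pi.single l 1) :=
    IsWeightedHomogeneous.prod _ _ _ fun l _ => isWeightedHomogeneous_X _ _ _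
  rw [show (fun _ => 1 : Fin r → ℕ) = ∑ l : Fin r, Pi.single l 1 by
    funext l; simp [Finset.sum_apply]]
  rw [Units.smul_def]
  exact zsmul_mem (S := Submodule _ _)
    (K := weightedHomogeneousSubmodule (Sx K n r) _ (∑ l : Fin r, Pi.single l 1)) h _

theorem single_headMinor_pow_mem : (Pi.single ∅ (headMinor K n r ^ d) : FB K n r) ∈
    Pj K n r d 0 := by
  rintro ⟨s, a⟩ h
  rw [fb_repr] at h
  simp only at h
  have hs : s = ∅ := by
    by_contra hs
    rw [Pi.single_eq_of_ne hs, coeff_zero] at h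
    exact h rfl
  subst hs
  rw [Pi.single_eq_same] at h
  have h1 := (isWeightedHomogeneous_headMinor.pow d) h
  refine Prod.ext (funext fun l => ?_) (by simp [wB, wj])
  have h2 := congrFun h1 l
  rw [Finsupp.weight_apply, Finsupp.sum_fintype _ _ (by simp), Finset.sum_apply,
    Fintype.sum_prod_type] at h2
  simp [Pi.single_apply] at h2
  simp only [wB, wj, Finset.sum_empty, add_zero]
  exact_mod_cast h2

end PairingConstant

section Retract

variable {K : Type} [Field K] {n r : ℕ}

theorem lowMinor_ne_zero : lowMinor K n r ≠ 0 := by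
  refine det_X_of_injective_ne_zero K (fun i k : Fin n =>
    ((lowRow i, k) : Fin (n + r) × Fin n)) fun p q hpq => ?_
  simp only [lowRow, Prod.mk.injEq, Fin.mk.injEq, Nat.add_right_cancel_iff, Fin.val_inj] at hpq
  exact Prod.ext hpq.1 hpq.2

theorem eq_single_of_mem_Pj_zero {d : ℕ} {v : FB K n r} (hv : v ∈ Pj K n r d 0) :
    v = Pi.single ∅ (v ∅) := by
  funext s
  by_cases hs : s = ∅
  · subst hs; rw [Pi.single_eq_same]
  · rw [Pi.single_eq_of_ne hs]
    by_contra h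
    exact hs (Finset.card_eq_zero.1 (card_of_mem_Pj hv h))

theorem exists_dj_eq_of_kosz_eq {d : ℕ} (v : Pj K n r d 0) {u : FB K n r}
    (hu : kosz (Sx K n r) (qB K n r) u = lowMinor K n r ^ d • v.1) :
    ∃ u, dj K n r d 0 u = v := by
  have h := kosz_empty_mem u
  rw [hu, Pi.smul_apply, smul_eq_C_mul, map_pow] at h
  obtain ⟨u', hu'⟩ := exists_kosz_eq_single (mem_of_lowMinor_pow_mul_mem h)
  rw [← eq_single_of_mem_Pj_zero v.2] at hu'
  exact ⟨tj K n r d 1 u', by rw [← tj_kosz, hu', tj_of_mem]⟩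

variable (K n r) in
/-- The power of the top maximal minor in exterior degree zero. -/
noncomputable def headE (d : ℕ) : FB K n r := Pi.single ∅ (headMinor K n r ^ d)

theorem exists_kosz_eq_sub (I : Ideal (Sx K n r))
    (hI : I = Ideal.span {p | ∃ g : Fin n → Fin (n + r), StrictMono g ∧
      p = (Matrix.of fun i k : Fin n => (X (g i, k) : Sx K n r)).det}) {d : ℕ} {x : Sx K n r}
    (hx : x ∈ I ^ d) : ∃ v : Pj K n r d 0, ∃ u, kosz (Sx K n r) (qB K n r) u =
      lowMinor K n r ^ d • v.1 - x • headE K n r d := by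
  obtain ⟨b, hb⟩ := exists_lowMinor_pow_mul_sub_mem I hI d x hx
  obtain ⟨u, hu⟩ := exists_kosz_eq_single hb
  refine ⟨tj K n r d 0 (Pi.single ∅ b), (tj K n r d 1 u).1, ?_⟩
  have h1 : kosz (Sx K n r) (qB K n r) (tj K n r d 1 u).1 =
      (tj K n r d 0 (kosz (Sx K n r) (qB K n r) u)).1 := by
    rw [tj_kosz]; rfl
  have h2 : (Pi.single ∅ (C (lowMinor K n r) ^ d * b - C x * headMinor K n r ^ d) : FB K n r) =
      lowMinor K n r ^ d • (Pi.single ∅ b : FB K n r) - x • headE K n r d := by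
    rw [headE, Pi.single_sub, ← map_pow, ← smul_eq_C_mul, ← smul_eq_C_mul, Pi.single_smul, Pi.single_smul]
  rw [h1, hu, h2, map_sub, map_smul, map_smul,
    tj_of_mem ⟨headE K n r d, single_headMinor_pow_mem (K := K) (n := n) (r := r) (d := d)⟩]
  rfl

/-- Vanishing of `Ext` for the powers of the ideal of maximal minors. -/
theorem subsingleton_ext_pow [CharZero K] (I : Ideal (Sx K n r))
    (hI : I = Ideal.span {p | ∃ g : Fin n → Fin (n + r), StrictMono g ∧
      p = (Matrix.of fun i k : Fin n => (X (g i, k) : Sx K n r)).det}) (d p : ℕ)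
    (hp : ¬ ∃ t ≤ n, p + 1 = t * r) :
    Subsingleton (CategoryTheory.Abelian.Ext.{0}
      (ModuleCat.of (Sx K n r) (I ^ d : Ideal (Sx K n r)))
      (ModuleCat.of (Sx K n r) (Sx K n r)) (p + 1)) := by
  obtain ⟨c, hc, hpr⟩ := exists_pr0_sqM_det_eq (K := K) (n := n) (r := r) (d := d)
  let α₀ : FB K n r →ₗ[Sx K n r] Sx K n r := (C c⁻¹ : Sx K n r) • prL (detE K n r d)
  have hα₀ : ∀ v, α₀ v = C c⁻¹ * prL (detE K n r d) v := fun v => rfl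
  have hmem : ∀ v, α₀ v ∈ I ^ d := fun v => Ideal.mul_mem_left _ _
    (prL_detE_mem I (fun g hg => hI ▸ Ideal.subset_span ⟨g, hg, rfl⟩) v)
  have hkosz : ∀ v, α₀ (kosz (Sx K n r) (qB K n r) v) = 0 := by
    intro v
    rw [hα₀, adj_kosz, dd_detE, prL_comm, map_zero, mul_zero]
  have hKB : ∀ v, α₀ (KB K n r v) = 0 := by
    intro v
    rw [hα₀, adj_KB, KB_detE, prL_comm, map_zero, mul_zero]
  have hE : α₀ (headE K n r d) = lowMinor K n r ^ d := by
    rw [hα₀, headE, detE, prL_single, Pi.single_eq_same, hpr, mul_left_comm, ← map_mul,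
      inv_mul_cancel₀ hc, map_one, mul_one]
  refine subsingleton_ext_of_retract (d := d) (I ^ d)
    ((α₀.codRestrict (I ^ d) hmem) ∘ₗ Submodule.subtype _)
    (fun v => Subtype.ext (hkosz _)) (fun v => Subtype.ext (hKB _))
    (fun v x => ∃ u, kosz (Sx K n r) (qB K n r) u =
      lowMinor K n r ^ d • v.1 - x.1 • headE K n r d)
    ?_ ?_ (fun x => exists_kosz_eq_sub I hI x.2) ?_ ?_ p hp
  · rintro v x v' x' ⟨u, hu⟩ ⟨u', hu'⟩
    refine ⟨u + u', ?_⟩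
    rw [map_add, hu, hu', Submodule.coe_add, Submodule.coe_add, smul_add, add_smul]
    abel
  · rintro a v x ⟨u, hu⟩
    refine ⟨a • u, ?_⟩
    rw [map_smul, hu, smul_sub, Submodule.coe_smul, Submodule.coe_smul, smul_comm, smul_eq_mul,
      mul_smul]
  · rintro v ⟨u, hu⟩
    rw [Submodule.coe_zero, zero_smul, sub_zero] at hu
    exact exists_dj_eq_of_kosz_eq v hu
  · rintro v x ⟨u, hu⟩
    have h := hkosz u
    rw [hu, map_sub, map_smul, map_smul, hE, smul_eq_mul, smul_eq_mul, sub_eq_zero, mul_comm] at h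
    exact Subtype.ext (mul_right_cancel₀ (pow_ne_zero d lowMinor_ne_zero) h)

theorem lowMinor_mem (I : Ideal (Sx K n r))
    (hI : I = Ideal.span {p | ∃ g : Fin n → Fin (n + r), StrictMono g ∧
      p = (Matrix.of fun i k : Fin n => (X (g i, k) : Sx K n r)).det}) : lowMinor K n r ∈ I := by
  rw [hI]
  refine Ideal.subset_span ⟨lowRow, fun i j h => ?_, rfl⟩
  simpa [lowRow] using h

/-- Homomorphisms from a power of the ideal of maximal minors are multiplications. -/
theorem exists_forall_eq_mul (hr : 1 ≤ r) (I : Ideal (Sx K n r))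
    (hI : I = Ideal.span {p | ∃ g : Fin n → Fin (n + r), StrictMono g ∧
      p = (Matrix.of fun i k : Fin n => (X (g i, k) : Sx K n r)).det}) (d : ℕ)
    (f : (I ^ d : Ideal (Sx K n r)) →ₗ[Sx K n r] Sx K n r) :
    ∃ s, ∀ x, f x = x * s := by
  have htop : (Matrix.of fun i k : Fin n => (X (Fin.castAdd r i, k) : Sx K n r)).det ∈ I := by
    rw [hI]
    exact Ideal.subset_span ⟨Fin.castAdd r, Fin.strictMono_castAdd r, rfl⟩
  have hcomm : ∀ x y : (I ^ d : Ideal (Sx K n r)), x.1 * f y = y.1 * f x := by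
    intro x y
    rw [← smul_eq_mul, ← smul_eq_mul, ← map_smul, ← map_smul]
    congr 1
    exact Subtype.ext (mul_comm _ _)
  let a : (I ^ d : Ideal (Sx K n r)) := ⟨_, Ideal.pow_mem_pow (lowMinor_mem I hI) d⟩
  let b : (I ^ d : Ideal (Sx K n r)) := ⟨_, Ideal.pow_mem_pow htop d⟩
  obtain ⟨s, hs⟩ := dvd_of_dvd_mul_minor K n r hr d (f a) ⟨f b, (hcomm b a)⟩
  refine ⟨s, fun x => mul_left_cancel₀ (pow_ne_zero d (lowMinor_ne_zero (K := K) (n := n) (r := r)))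
    ((hcomm a x).trans ?_)⟩
  rw [hs, lowMinor]
  ring

end Retract

section QuotientHom

theorem subsingleton_hom_quotient {R : Type} [CommRing R] [IsDomain R] (J : Ideal R) (hJ : J ≠ ⊥) :
    Subsingleton (ModuleCat.of R (R ⧸ J) ⟶ ModuleCat.of R R) := by
  obtain ⟨a, ha, h0⟩ := Submodule.exists_mem_ne_zero_of_ne_bot hJ
  have h : ∀ f : (R ⧸ J) →ₗ[R] R, f = 0 := by
    refine fun f => LinearMap.ext fun x => ?_
    have h1 : a • x = 0 := by
      obtain ⟨x, rfl⟩ := Ideal.Quotient.mk_surjective x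
      exact (Submodule.Quotient.mk_eq_zero J).2 (Ideal.mul_mem_right _ _ ha)
    have h2 := congrArg f h1
    rw [map_smul, map_zero, smul_eq_mul] at h2
    exact (mul_eq_zero.1 h2).resolve_left h0
  exact ⟨fun f g => ModuleCat.hom_ext ((h _).trans (h _).symm)⟩

end QuotientHom

/-- For `d ≥ n`, the modules `Ext^j_S(S/I^d, S)` vanish when `j` is not of the form
`s * (m - n) + 1` for some `1 ≤ s ≤ n`, where `I` is the ideal of maximal minors of
the generic `m × n` matrix. -/
theorem ext_quotient_powers_maximal_minors_vanishing
    (K : Type) [Field K] [CharZero K] (m n : ℕ) (hn : 1 ≤ n) (hmn : n < m)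
    (X : Matrix (Fin m) (Fin n) (MvPolynomial (Fin m × Fin n) K))
    (hX : ∀ i j, X i j = MvPolynomial.X (i, j))
    (I : Ideal (MvPolynomial (Fin m × Fin n) K))
    (hI : I = Ideal.span {p | ∃ g : Fin n → Fin m, StrictMono g ∧
      p = (X.submatrix g id).det})
    (d : ℕ) (hd : n ≤ d) (j : ℕ) (hj : ¬ ∃ s : ℕ, 1 ≤ s ∧ s ≤ n ∧ j = s * (m - n) + 1) :
    Subsingleton
      (((Ext (MvPolynomial (Fin m × Fin n) K) (ModuleCat (MvPolynomial (Fin m × Fin n) K)) j).obj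
          (Opposite.op (ModuleCat.of (MvPolynomial (Fin m × Fin n) K)
            (MvPolynomial (Fin m × Fin n) K ⧸ (I ^ d))))).obj
        (ModuleCat.of (MvPolynomial (Fin m × Fin n) K) (MvPolynomial (Fin m × Fin n) K))) := by
  obtain ⟨r, rfl⟩ := Nat.exists_eq_add_of_le hmn.le
  have hr : 1 ≤ r := by omega
  have hX' : ∀ g : Fin n → Fin (n + r), X.submatrix g id =
      Matrix.of fun i k => MvPolynomial.X (g i, k) := fun g => Matrix.ext fun i k => hX _ _
  simp only [hX'] at hI
  rcases j with _ | _ | p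
  · refine subsingleton_derived_ext_zero _ _ (subsingleton_hom_quotient _ ?_)
    exact (Submodule.ne_bot_iff _).2 ⟨_, Ideal.pow_mem_pow (lowMinor_mem I hI) d, pow_ne_zero d lowMinor_ne_zero⟩
  · exact subsingleton_derived_ext_succ _ _ 0
      (subsingleton_ext_one_quotient _ (exists_forall_eq_mul hr I hI d))
  · refine subsingleton_derived_ext_succ _ _ (p + 1) (subsingleton_ext_quotient _ p
      (subsingleton_ext_pow I hI d p ?_))
    rintro ⟨t, ht, h⟩
    refine hj ⟨t, Nat.one_le_iff_ne_zero.2 ?_, ht, ?_⟩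
    · rintro rfl
      omega
    · rw [Nat.add_sub_cancel_left]
      omega
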